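/- arXiv:1206.6791 — 4 statements merged into one kernel-verified Lean document; each statement's English description precedes it below -/
import Mathlib

section
/- Let H be a real Hilbert space, f ∈ Γ₀(H), β > 0, and let g : H → ℝ be convex and differentiable with gradient g' : H → H (i.e. HasGradientAt g (g' x) x for all x) which is Lipschitz with constant 1/β. Let (η_n) be a summable sequence in [0,∞), α > 0, and (U_n) a sequence in P_α(H) with μ := sup_n ‖U_n‖ < ∞ and (1+η_n)⟪U_{n+1}x, x⟫ ≥ ⟪U_n x, x⟫ for all n, x. Let ε ∈ (0, min{1, 2β/(μ+1)}], let (λ_n) be a sequence in [ε,1], (γ_n) a sequence in [ε,(2β−ε)/μ], and let (a_n), (b_n) be sequences in H with Σ‖a_n‖ < ∞ and Σ‖b_n‖ < ∞. Assume Argmin(f+g) := {x : ∀y, f(x) + g(x) ≤ f(y) + g(y) in EReal} is nonempty, and let sequences (x_n), (y_n), (p_n) in H satisfy, for every n: y_n = x_n − γ_n U_n(g'(x_n) + b_n); p_n = prox^{U_n⁻¹}_{γ_n f}(y_n), i.e. γ_n·f(p_n) + (1/2)⟪U_n⁻¹(y_n−p_n), y_n−p_n⟫ ≤ γ_n·f(y)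 + (1/2)⟪U_n⁻¹(y_n−y), y_n−y⟫ for all y ∈ H; and x_{n+1} = x_n + λ_n(p_n + a_n − x_n). Then there exists x̄ ∈ Argmin(f+g) such that x_n ⇀ x̄ weakly and Σ_n ‖g'(x_n) − g'(x̄)‖² < ∞. -/
open RealInnerProductSpace Filter Topology

section Sequences

/-- The product of two factors `1 + A n`, `1 + B n` with nonnegative summable `A`, `B` is again of
this form. -/
theorem summable_one_add_mul_one_add_sub_one {A B : ℕ → ℝ} (hA0 : ∀ n, 0 ≤ A n)
    (hB0 : ∀ n, 0 ≤ B n) (hA : Summable A) (hB : Summable B) :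
    Summable fun n => (1 + A n) * (1 + B n) - 1 := by
  have hAB : Summable fun n => A n * B n := by
    refine Summable.of_nonneg_of_le (fun n => mul_nonneg (hA0 n) (hB0 n)) (fun n => ?_)
      (hB.mul_left (∑' k, A k))
    exact mul_le_mul_of_nonneg_right (hA.le_tsum n fun k _ => hA0 k) (hB0 n)
  exact ((hA.add hB).add hAB).congr fun n => by ring

theorem prod_range_one_add_le_exp_tsum {A : ℕ → ℝ} (hA0 : ∀ n, 0 ≤ A n) (hA : Summable A) (n : ℕ) :
    ∏ k ∈ Finset.range n, (1 + A k) ≤ Real.exp (∑' k, A k) :=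
  (Real.prod_one_add_le_exp_sum _ hA0).trans
    (Real.exp_le_exp.2 (hA.sum_le_tsum _ fun k _ => hA0 k))

theorem one_le_prod_range_one_add {A : ℕ → ℝ} (hA0 : ∀ n, 0 ≤ A n) (n : ℕ) :
    1 ≤ ∏ k ∈ Finset.range n, (1 + A k) :=
  Finset.one_le_prod (s := Finset.range n) fun k _ => by linarith [hA0 k]

/-- A deterministic version of the Robbins–Siegmund lemma. -/
theorem exists_tendsto_and_summable_of_le_one_add_mul_add {r E A B : ℕ → ℝ}
    (hr : ∀ n, 0 ≤ r n) (hE : ∀ n, 0 ≤ E n) (hA0 : ∀ n, 0 ≤ A n) (hB0 : ∀ n, 0 ≤ B n)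
    (hA : Summable A) (hB : Summable B)
    (h : ∀ n, r (n + 1) + E n ≤ (1 + A n) * r n + B n) :
    (∃ l, Tendsto r atTop (𝓝 l)) ∧ Summable E := by
  set M := Real.exp (∑' k, A k) with hM
  set R := M * (r 0 + ∑' k, B k) with hR
  have hbound : ∀ n, r n ≤ (∏ k ∈ Finset.range n, (1 + A k)) *
      (r 0 + ∑ k ∈ Finset.range n, B k) := by
    intro n
    induction n with
    | zero => simp
    | succ n ih =>
      rw [Finset.prod_range_succ, Finset.sum_range_succ]
      have h1 := one_le_prod_range_one_add hA0 n
      set P := ∏ k ∈ Finset.range n, (1 + A k)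
      set S := ∑ k ∈ Finset.range n, B k
      have h2 : (1 + A n) * r n ≤ (1 + A n) * (P * (r 0 + S)) :=
        mul_le_mul_of_nonneg_left ih (by linarith [hA0 n])
      have h3 : 1 ≤ P * (1 + A n) := one_le_mul_of_one_le_of_one_le h1 (by linarith [hA0 n])
      have h4 := mul_le_mul_of_nonneg_right h3 (hB0 n)
      nlinarith [h n, hE n]
  have hrR : ∀ n, r n ≤ R := fun n =>
    (hbound n).trans <| mul_le_mul (prod_range_one_add_le_exp_tsum hA0 hA n)
      (by linarith [hB.sum_le_tsum (Finset.range n) fun k _ => hB0 k])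
      (add_nonneg (hr 0) (Finset.sum_nonneg fun k _ => hB0 k)) (Real.exp_pos _).le
  have hR0 : 0 ≤ R := (hr 0).trans (hrR 0)
  set D : ℕ → ℝ := fun n => A n * R + B n with hD
  have hD0 : ∀ n, 0 ≤ D n := fun n => add_nonneg (mul_nonneg (hA0 n) hR0) (hB0 n)
  have hDs : Summable D := (hA.mul_right R).add hB
  have hstep : ∀ n, r (n + 1) + E n ≤ r n + D n := by
    intro n
    have := mul_le_mul_of_nonneg_left (hrR n) (hA0 n)
    simp only [hD]
    linarith [h n]
  have htel : ∀ n, r n + ∑ k ∈ Finset.range n, E k ≤ r 0 + ∑ k ∈ Finset.range n, D k := by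
    intro n
    induction n with
    | zero => simp
    | succ n ih => rw [Finset.sum_range_succ, Finset.sum_range_succ]; linarith [hstep n]
  have hEs : Summable E := by
    refine summable_of_sum_range_le (c := r 0 + ∑' k, D k) hE fun n => ?_
    linarith [htel n, hr n, hDs.sum_le_tsum (Finset.range n) fun k _ => hD0 k]
  refine ⟨?_, hEs⟩
  set s : ℕ → ℝ := fun n => r n - ∑ k ∈ Finset.range n, D k with hs
  have hanti : Antitone s := antitone_nat_of_succ_le fun n => by
    simp only [hs, Finset.sum_range_succ]
    linarith [hstep n, hE n]
  have hbdd : BddBelow (Set.range s) := by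
    refine ⟨-∑' k, D k, ?_⟩
    rintro _ ⟨n, rfl⟩
    simp only [hs]
    linarith [hr n, hDs.sum_le_tsum (Finset.range n) fun k _ => hD0 k]
  refine ⟨_, ((tendsto_atTop_ciInf hanti hbdd).add hDs.hasSum.tendsto_sum_nat).congr fun n => ?_⟩
  simp [hs]

end Sequences

section Convex

variable {H : Type*} [NormedAddCommGroup H] [InnerProductSpace ℝ H]

theorem le_of_hasDerivAt_of_forall_mul_le_sub {φ : ℝ → ℝ} {D k : ℝ} (hφ : HasDerivAt φ D 0)
    (h : ∀ t ∈ Set.Ioc (0 : ℝ) 1, t * k ≤ φ t - φ 0) : k ≤ D := by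
  have h1 := (hasDerivAt_iff_tendsto_slope_zero.1 hφ).mono_left
    (nhdsWithin_mono 0 (s := Set.Ioi 0) fun t ht => ne_of_gt ht)
  refine ge_of_tendsto h1 ?_
  filter_upwards [Ioc_mem_nhdsGT (zero_lt_one' ℝ)] with t ht
  have := h t ht
  simp only [zero_add, smul_eq_mul]
  rw [inv_mul_eq_div, le_div_iff₀ ht.1]
  linarith

theorem HasGradientAt.hasDerivAt_add_smul [CompleteSpace H] {g : H → ℝ} {v z d : H} {t : ℝ}
    (hg : HasGradientAt g v (z + t • d)) : HasDerivAt (fun s : ℝ => g (z + s • d)) ⟪v, d⟫ t := by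
  have h1 : HasDerivAt (fun s : ℝ => z + s • d) d t := by
    simpa using ((hasDerivAt_id t).smul_const d).const_add z
  exact (hg.hasFDerivAt.comp_hasDerivAt t h1).congr_deriv (by simp)

variable [CompleteSpace H]

theorem ConvexOn.add_inner_gradient_le {g : H → ℝ} {v z : H} (hg : ConvexOn ℝ Set.univ g)
    (hv : HasGradientAt g v z) (w : H) : g z + ⟪v, w - z⟫ ≤ g w := by
  have h1 : HasDerivAt (fun s : ℝ => g (z + s • (w - z))) ⟪v, w - z⟫ 0 :=
    HasGradientAt.hasDerivAt_add_smul (by simpa using hv)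
  have := le_of_hasDerivAt_of_forall_mul_le_sub (k := g z - g w) h1.neg fun t ht => by
    have h2 := hg.2 (Set.mem_univ w) (Set.mem_univ z) ht.1.le (sub_nonneg.2 ht.2) (by ring)
    have h3 : t • w + (1 - t) • z = z + t • (w - z) := by module
    rw [h3] at h2
    simp only [smul_eq_mul, Pi.neg_apply, zero_smul, add_zero] at h2 ⊢
    linarith
  linarith

/-- The descent lemma. -/
theorem le_add_inner_gradient_add_sq {g : H → ℝ} {g' : H → H} {L : ℝ}
    (hg : ∀ x, HasGradientAt g (g' x) x) (hL : ∀ x y, ‖g' x - g' y‖ ≤ L * ‖x - y‖) (x y : H) :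
    g y ≤ g x + ⟪g' x, y - x⟫ + L / 2 * ‖y - x‖ ^ 2 := by
  set d := y - x with hd
  have hder : ∀ t : ℝ, HasDerivAt
      (fun s : ℝ => g (x + s • d) - s * ⟪g' x, d⟫ - s ^ 2 * (L / 2 * ‖d‖ ^ 2))
      (⟪g' (x + t • d), d⟫ - ⟪g' x, d⟫ - 2 * t * (L / 2 * ‖d‖ ^ 2)) t := by
    intro t
    have h1 := (hg (x + t • d)).hasDerivAt_add_smul
    have h2 := (hasDerivAt_id t).mul_const ⟪g' x, d⟫
    have h3 := (hasDerivAt_pow 2 t).mul_const (L / 2 * ‖d‖ ^ 2)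
    exact ((h1.sub h2).sub h3).congr_deriv (by simp)
  have hanti : AntitoneOn
      (fun s : ℝ => g (x + s • d) - s * ⟪g' x, d⟫ - s ^ 2 * (L / 2 * ‖d‖ ^ 2)) (Set.Icc 0 1) := by
    refine antitoneOn_of_deriv_nonpos (convex_Icc 0 1)
      (fun t _ => (hder t).continuousAt.continuousWithinAt)
      (fun t _ => (hder t).differentiableAt.differentiableWithinAt) fun t ht => ?_
    rw [interior_Icc] at ht
    rw [(hder t).deriv, ← inner_sub_left]
    have h1 := real_inner_le_norm (g' (x + t • d) - g' x) d
    have h2 := hL (x + t • d) x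
    rw [add_sub_cancel_left, norm_smul, Real.norm_of_nonneg ht.1.le] at h2
    have h3 := mul_le_mul_of_nonneg_right h2 (norm_nonneg d)
    linarith
  have := hanti (Set.left_mem_Icc.2 zero_le_one) (Set.right_mem_Icc.2 zero_le_one) zero_le_one
  simp only [one_smul, zero_smul, add_zero, hd, add_sub_cancel] at this
  rw [hd]
  linarith

/-- The Baillon–Haddad theorem. -/
theorem ConvexOn.cocoercive_gradient {g : H → ℝ} {g' : H → H} {β : ℝ} (hβ : 0 < β)
    (hconv : ConvexOn ℝ Set.univ g) (hg : ∀ x, HasGradientAt g (g' x) x)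
    (hL : ∀ x y, ‖g' x - g' y‖ ≤ (1 / β) * ‖x - y‖) (x y : H) :
    β * ‖g' x - g' y‖ ^ 2 ≤ ⟪g' x - g' y, x - y⟫ := by
  have key : ∀ x y : H, g x + ⟪g' x, y - x⟫ + β / 2 * ‖g' y - g' x‖ ^ 2 ≤ g y := by
    intro x y
    set u := g' y - g' x with hu
    have h1 := hconv.add_inner_gradient_le (hg x) (y - β • u)
    have h2 := le_add_inner_gradient_add_sq hg hL y (y - β • u)
    have e1 : y - β • u - y = -(β • u) := by abel
    have e2 : y - β • u - x = (y - x) - β • u := by abel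
    rw [e1, norm_neg, norm_smul, Real.norm_of_nonneg hβ.le, inner_neg_right,
      real_inner_smul_right] at h2
    rw [e2, inner_sub_right, real_inner_smul_right] at h1
    have h3 : ⟪g' y, u⟫ - ⟪g' x, u⟫ = ‖u‖ ^ 2 := by
      rw [← inner_sub_left, ← hu, real_inner_self_eq_norm_sq]
    have h4 : 1 / β / 2 * (β * ‖u‖) ^ 2 = β / 2 * ‖u‖ ^ 2 := by field_simp
    have h5 : β * ⟪g' y, u⟫ - β * ⟪g' x, u⟫ = β * ‖u‖ ^ 2 := by rw [← mul_sub, h3]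
    linarith
  have h1 := key x y
  have h2 := key y x
  rw [norm_sub_rev (g' y)] at h1
  rw [← neg_sub x y, inner_neg_right] at h1
  rw [inner_sub_left]
  linarith

end Convex

section Weak

variable {H : Type*} [NormedAddCommGroup H] [InnerProductSpace ℝ H] [CompleteSpace H]

theorem mem_of_tendsto_inner {ι : Type*} {l : Filter ι} [l.NeBot] {s : Set H}
    (hs : Convex ℝ s) (hs' : IsClosed s) {x : ι → H} {z : H} (hx : ∀ᶠ i in l, x i ∈ s)
    (h : ∀ w, Tendsto (fun i => ⟪x i, w⟫) l (𝓝 ⟪z, w⟫)) : z ∈ s := by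
  by_contra hz
  obtain ⟨φ, c, h1, h2⟩ := geometric_hahn_banach_closed_point hs hs' hz
  have h3 := h ((InnerProductSpace.toDual ℝ H).symm φ)
  simp only [real_inner_comm ((InnerProductSpace.toDual ℝ H).symm φ),
    InnerProductSpace.toDual_symm_apply] at h3
  have h4 : φ z ≤ c := le_of_tendsto h3 (hx.mono fun i hi => (h1 _ hi).le)
  linarith

theorem exists_tendsto_inner_of_bounded {ι : Type*} (l : Ultrafilter ι) {x : ι → H} {R : ℝ}
    (hR : ∀ i, ‖x i‖ ≤ R) : ∃ z, ∀ w, Tendsto (fun i => ⟪x i, w⟫) l (𝓝 ⟪z, w⟫) := by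
  have hc := WeakDual.isCompact_closedBall (𝕜 := ℝ) (0 : StrongDual ℝ H) R
  obtain ⟨φ, -, hφ⟩ := hc.ultrafilter_le_nhds
    (l.map fun i => StrongDual.toWeakDual (InnerProductSpace.toDual ℝ H (x i))) (by
      rw [le_principal_iff]
      refine mem_map.2 (univ_mem' fun i => ?_)
      simpa using hR i)
  refine ⟨(InnerProductSpace.toDual ℝ H).symm (WeakDual.toStrongDual φ), fun w => ?_⟩
  rw [InnerProductSpace.toDual_symm_apply]
  exact ((WeakBilin.eval_continuous _ w).tendsto φ).comp hφ

end Weak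

section Operator

variable {H : Type*} [NormedAddCommGroup H] [InnerProductSpace ℝ H]

theorem inner_apply_sub_self {V : H →L[ℝ] H} (hsymm : ∀ x y, ⟪V x, y⟫ = ⟪x, V y⟫) (x y : H) :
    ⟪V (x - y), x - y⟫ = ⟪V x, x⟫ - 2 * ⟪V x, y⟫ + ⟪V y, y⟫ := by
  have e : ⟪V y, x⟫ = ⟪V x, y⟫ := by rw [hsymm, real_inner_comm]
  rw [map_sub, inner_sub_left, inner_sub_right, inner_sub_right, e]
  ring

theorem norm_sq_le_mul_inner_of_nonneg {A : H →L[ℝ] H} {C : ℝ} (hC : 0 < C)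
    (hsymm : ∀ x y, ⟪A x, y⟫ = ⟪x, A y⟫) (h0 : ∀ x, 0 ≤ ⟪A x, x⟫)
    (hle : ∀ x, ⟪A x, x⟫ ≤ C * ‖x‖ ^ 2) (x : H) : ‖A x‖ ^ 2 ≤ C * ⟪A x, x⟫ := by
  have h1 := h0 (C • x - A x)
  have h2 := hle (A x)
  simp only [map_sub, map_smul, inner_sub_left, inner_sub_right, real_inner_smul_left,
    real_inner_smul_right, hsymm (A x) x, real_inner_self_eq_norm_sq] at h1
  nlinarith

/-- Inversion reverses the order of positive operators. -/
theorem inner_inverse_le_mul_inner_inverse {A B A' B' : H →L[ℝ] H} {c : ℝ} (hc : 0 < c)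
    (hsymm : ∀ x y, ⟪A x, y⟫ = ⟪x, A y⟫) (h0 : ∀ x, 0 ≤ ⟪A x, x⟫)
    (hA : ∀ x, A (A' x) = x) (hB : ∀ x, B (B' x) = x)
    (hle : ∀ x, ⟪A x, x⟫ ≤ c * ⟪B x, x⟫) (x : H) : ⟪B' x, x⟫ ≤ c * ⟪A' x, x⟫ := by
  have h1 := h0 (c • A' x - B' x)
  have h2 := hle (B' x)
  simp only [map_sub, map_smul, inner_sub_left, inner_sub_right, real_inner_smul_left,
    real_inner_smul_right, hsymm (B' x) (A' x), hA] at h1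
  rw [hB] at h2
  rw [real_inner_comm x (B' x)] at *
  rw [real_inner_comm x (A' x)] at *
  nlinarith

theorem inner_inverse_comm {A A' : H →L[ℝ] H} (hsymm : ∀ x y, ⟪A x, y⟫ = ⟪x, A y⟫)
    (hA : ∀ x, A (A' x) = x) (x y : H) : ⟪A' x, y⟫ = ⟪x, A' y⟫ := by
  conv_lhs => rw [← hA y]
  rw [← hsymm, hA]

theorem mul_norm_inverse_le {A A' : H →L[ℝ] H} {α : ℝ} (h : ∀ x, α * ‖x‖ ^ 2 ≤ ⟪A x, x⟫)
    (hA : ∀ x, A (A' x) = x) (x : H) : α * ‖A' x‖ ≤ ‖x‖ := by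
  rcases (norm_nonneg (A' x)).eq_or_lt with h0 | h0
  · simp [← h0]
  · have h1 := h (A' x)
    rw [hA] at h1
    have h2 := h1.trans (real_inner_le_norm x (A' x))
    nlinarith

/-- Monotone (up to summable factors) sequences of uniformly bounded positive operators converge
strongly. -/
theorem exists_tendsto_apply_of_le_one_add_mul [CompleteSpace H] {V : ℕ → H →L[ℝ] H} {η : ℕ → ℝ}
    {C : ℝ} (hC : 0 < C) (hη0 : ∀ n, 0 ≤ η n) (hη : Summable η)
    (hsymm : ∀ n x y, ⟪V n x, y⟫ = ⟪x, V n y⟫) (h0 : ∀ n x, 0 ≤ ⟪V n x, x⟫)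
    (hle : ∀ n x, ⟪V n x, x⟫ ≤ C * ‖x‖ ^ 2)
    (hmono : ∀ n x, ⟪V (n + 1) x, x⟫ ≤ (1 + η n) * ⟪V n x, x⟫) (u : H) :
    ∃ v, Tendsto (fun n => V n u) atTop (𝓝 v) := by
  set π : ℕ → ℝ := fun n => ∏ k ∈ Finset.range n, (1 + η k) with hπ
  have hπ1 : ∀ n, 1 ≤ π n := one_le_prod_range_one_add hη0
  have hπ0 : ∀ n, 0 < π n := fun n => one_pos.trans_le (hπ1 n)
  have hπs : ∀ n, π (n + 1) = π n * (1 + η n) := fun n => Finset.prod_range_succ _ _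
  obtain ⟨l, hl⟩ : ∃ l, Tendsto π atTop (𝓝 l) := by
    refine (exists_tendsto_and_summable_of_le_one_add_mul_add (r := π) (E := 0) (B := 0)
      (fun n => (hπ0 n).le) (fun _ => le_rfl) hη0 (fun _ => le_rfl) hη summable_zero
      fun n => ?_).1
    simp [hπs, mul_comm]
  set W : ℕ → H →L[ℝ] H := fun n => (π n)⁻¹ • V n with hW
  have hWV : ∀ n x, W n x = (π n)⁻¹ • V n x := fun n x => rfl
  have hW0 : ∀ n x, 0 ≤ ⟪W n x, x⟫ := fun n x => by
    rw [hWV, real_inner_smul_left]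
    exact mul_nonneg (inv_nonneg.2 (hπ0 n).le) (h0 n x)
  have hWanti : ∀ x, Antitone fun n => ⟪W n x, x⟫ := fun x => by
    refine antitone_nat_of_succ_le fun n => ?_
    simp only [hWV, real_inner_smul_left, hπs, mul_inv]
    have h1 : 0 < 1 + η n := by linarith [hη0 n]
    rw [mul_assoc]
    refine mul_le_mul_of_nonneg_left ?_ (inv_nonneg.2 (hπ0 n).le)
    rw [inv_mul_le_iff₀ h1]
    exact hmono n x
  have hWC : ∀ n x, ⟪W n x, x⟫ ≤ C * ‖x‖ ^ 2 := fun n x =>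
    (hWanti x (Nat.zero_le n)).trans (by simpa [hWV, hπ] using hle 0 x)
  have hdiff : ∀ m n, m ≤ n → ‖W m u - W n u‖ ^ 2 ≤ C * (⟪W m u, u⟫ - ⟪W n u, u⟫) := by
    intro m n hmn
    rw [← inner_sub_left]
    refine norm_sq_le_mul_inner_of_nonneg (A := W m - W n) hC (fun x y => ?_) (fun x => ?_)
      (fun x => ?_) u
    · simp only [sub_apply, inner_sub_left, inner_sub_right, hWV,
        real_inner_smul_left, real_inner_smul_right, hsymm]
    · rw [sub_apply, inner_sub_left]
      exact sub_nonneg.2 (hWanti x hmn)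
    · rw [sub_apply, inner_sub_left]
      linarith [hWC m x, hW0 n x]
  have hconv := tendsto_atTop_ciInf (hWanti u) ⟨0, by rintro _ ⟨n, rfl⟩; exact hW0 n u⟩
  have hcauchy : CauchySeq fun n => W n u := by
    refine Metric.cauchySeq_iff'.2 fun δ hδ => ?_
    obtain ⟨N, hN⟩ := Metric.cauchySeq_iff'.1 hconv.cauchySeq (δ ^ 2 / C) (by positivity)
    refine ⟨N, fun n hn => ?_⟩
    have h1 := hdiff N n hn
    have h2 := hN n hn
    rw [dist_comm, Real.dist_eq] at h2
    have h3 := (lt_div_iff₀' hC).1 ((le_abs_self _).trans_lt h2)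
    rw [dist_comm, dist_eq_norm]
    exact lt_of_pow_lt_pow_left₀ 2 hδ.le (h1.trans_lt h3)
  obtain ⟨v, hv⟩ := cauchySeq_tendsto_of_complete hcauchy
  refine ⟨l • v, (hl.smul hv).congr fun n => ?_⟩
  rw [hWV, smul_inv_smul₀ (hπ0 n).ne']

end Operator

section ForwardBackward

variable {H : Type*} [NormedAddCommGroup H] [InnerProductSpace ℝ H]

theorem exists_pos_forall_quadratic_le {β L : ℝ} (hL : 0 < L) (hLβ : L < 2 * β) :
    ∃ κ > 0, ∀ s D : ℝ, 2 * κ * s ^ 2 + κ * D ^ 2 ≤ s ^ 2 / L - 2 * D * s + 2 * β * D ^ 2 := by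
  set θ := (L + 2 * β) / 2 with hθ
  have hθL : L < θ := by rw [hθ]; linarith
  have hθβ : θ < 2 * β := by rw [hθ]; linarith
  have hθ0 : 0 < θ := hL.trans hθL
  refine ⟨min ((1 / L - 1 / θ) / 2) (2 * β - θ), lt_min ?_ (by linarith), fun s D => ?_⟩
  · linarith [one_div_lt_one_div_of_lt hL hθL]
  · have h1 := min_le_left ((1 / L - 1 / θ) / 2) (2 * β - θ)
    have h2 := min_le_right ((1 / L - 1 / θ) / 2) (2 * β - θ)
    set κ := min ((1 / L - 1 / θ) / 2) (2 * β - θ)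
    have h3 : 2 * D * s ≤ θ * D ^ 2 + 1 / θ * s ^ 2 := by
      have : 0 ≤ 1 / θ * (θ * D - s) ^ 2 := by positivity
      have e : 1 / θ * (θ * D - s) ^ 2 = θ * D ^ 2 + 1 / θ * s ^ 2 - 2 * D * s := by
        field_simp; ring
      linarith
    have h4 := mul_le_mul_of_nonneg_right h1 (sq_nonneg s)
    have h5 := mul_le_mul_of_nonneg_right h2 (sq_nonneg D)
    have h6 : s ^ 2 / L = 1 / L * s ^ 2 := by ring
    linarith

theorem inner_apply_forward_backward_le {V : H →L[ℝ] H} {x p z b d : H} {β L γ c κ : ℝ}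
    (hsymm : ∀ x y, ⟪V x, y⟫ = ⟪x, V y⟫) (hc : 0 < c) (hcV : ∀ x, c * ‖x‖ ^ 2 ≤ ⟪V x, x⟫)
    (hγ : 0 ≤ γ) (hγV : ∀ x, γ * (‖x‖ ^ 2 / L) ≤ ⟪V x, x⟫) (hκ : 0 < κ)
    (hquad : ∀ s D : ℝ, 2 * κ * s ^ 2 + κ * D ^ 2 ≤ s ^ 2 / L - 2 * D * s + 2 * β * D ^ 2)
    (hcoc : β * ‖d‖ ^ 2 ≤ ⟪d, x - z⟫) (hmono : γ * ⟪d + b, p - z⟫ ≤ ⟪V (x - p), p - z⟫) :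
    ⟪V (p - z), p - z⟫ + γ * (κ * (‖x - p‖ ^ 2 + ‖d‖ ^ 2)) ≤
      ⟪V (x - z), x - z⟫ + γ * (‖b‖ * (1 + ⟪V (x - z), x - z⟫ / c) + ‖b‖ ^ 2 / κ) := by
  have hexp : ⟪V (x - z), x - z⟫ =
      ⟪V (x - p), x - p⟫ + 2 * ⟪V (x - p), p - z⟫ + ⟪V (p - z), p - z⟫ := by
    have e : x - z = (x - p) + (p - z) := by abel
    rw [e, map_add, inner_add_left, inner_add_right, inner_add_right, hsymm (p - z),
      real_inner_comm (V (x - p))]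
    ring
  have hd : β * ‖d‖ ^ 2 - ‖d‖ * ‖x - p‖ ≤ ⟪d, p - z⟫ := by
    have e : p - z = (x - z) - (x - p) := by abel
    rw [e, inner_sub_right]
    linarith [real_inner_le_norm d (x - p)]
  have hb : -(‖b‖ * ‖x - z‖) - ‖b‖ * ‖x - p‖ ≤ ⟪b, p - z⟫ := by
    have e : p - z = (x - z) - (x - p) := by abel
    rw [e, inner_sub_right]
    linarith [real_inner_le_norm b (x - p), neg_le_of_abs_le (abs_real_inner_le_norm b (x - z))]
  have hb1 : 2 * (‖b‖ * ‖x - p‖) ≤ κ * ‖x - p‖ ^ 2 + ‖b‖ ^ 2 / κ := by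
    have h : 0 ≤ (κ * ‖x - p‖ - ‖b‖) ^ 2 / κ := by positivity
    have e : (κ * ‖x - p‖ - ‖b‖) ^ 2 / κ =
        κ * ‖x - p‖ ^ 2 + ‖b‖ ^ 2 / κ - 2 * (‖b‖ * ‖x - p‖) := by field_simp; ring
    linarith
  have hb2 : 2 * (‖b‖ * ‖x - z‖) ≤ ‖b‖ * (1 + ⟪V (x - z), x - z⟫ / c) := by
    have h1 : ‖x - z‖ ^ 2 ≤ ⟪V (x - z), x - z⟫ / c := (le_div_iff₀' hc).2 (hcV _)
    have h2 : 2 * ‖x - z‖ ≤ 1 + ⟪V (x - z), x - z⟫ / c := by nlinarith [sq_nonneg (‖x - z‖ - 1)]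
    nlinarith [mul_le_mul_of_nonneg_left h2 (norm_nonneg b)]
  have hq := hquad ‖x - p‖ ‖d‖
  have hδ := hγV (x - p)
  rw [inner_add_left] at hmono
  have hfin : κ * (‖x - p‖ ^ 2 + ‖d‖ ^ 2) ≤ ‖x - p‖ ^ 2 / L + 2 * (⟪d, p - z⟫ + ⟪b, p - z⟫) +
      (‖b‖ * (1 + ⟪V (x - z), x - z⟫ / c) + ‖b‖ ^ 2 / κ) := by linarith
  have := mul_le_mul_of_nonneg_left hfin hγ
  linarith

theorem inner_apply_relaxation_le {V : H →L[ℝ] H} {u v a : H} {c C t : ℝ}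
    (hsymm : ∀ x y, ⟪V x, y⟫ = ⟪x, V y⟫) (hc : 0 < c) (hcV : ∀ x, c * ‖x‖ ^ 2 ≤ ⟪V x, x⟫)
    (hC : 0 ≤ C) (hVC : ∀ x, ‖V x‖ ≤ C * ‖x‖) (ht0 : 0 ≤ t) (ht1 : t ≤ 1) :
    ⟪V (u + t • (v + a - u)), u + t • (v + a - u)⟫ ≤
      (1 + C / c * ‖a‖) * (⟪V u, u⟫ + t * (⟪V v, v⟫ - ⟪V u, u⟫)) + (C * ‖a‖ + C * ‖a‖ ^ 2) := by
  set w := u + t • (v - u) with hw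
  have hwa : u + t • (v + a - u) = w + t • a := by rw [hw]; module
  have hconv : ⟪V w, w⟫ ≤ ⟪V u, u⟫ + t * (⟪V v, v⟫ - ⟪V u, u⟫) := by
    have h1 : 0 ≤ ⟪V (v - u), v - u⟫ := le_trans (by positivity) (hcV (v - u))
    have h2 : 0 ≤ t * (1 - t) := mul_nonneg ht0 (by linarith)
    have h3 := mul_nonneg h2 h1
    have h4 : ⟪V v, u⟫ = ⟪V u, v⟫ := by rw [hsymm, real_inner_comm]
    rw [hw]
    simp only [map_add, map_sub, map_smul, inner_add_left, inner_add_right, inner_sub_left,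
      inner_sub_right, real_inner_smul_left, real_inner_smul_right] at h3 ⊢
    rw [h4] at *
    linarith
  have hexp : ⟪V (w + t • a), w + t • a⟫ =
      ⟪V w, w⟫ + 2 * t * ⟪V w, a⟫ + t ^ 2 * ⟪V a, a⟫ := by
    have h4 : ⟪V a, w⟫ = ⟪V w, a⟫ := by rw [hsymm, real_inner_comm]
    simp only [map_add, map_smul, inner_add_left, inner_add_right, real_inner_smul_left,
      real_inner_smul_right, h4]
    ring
  have hle : ∀ y, ⟪V y, a⟫ ≤ C * ‖y‖ * ‖a‖ := fun y =>
    (real_inner_le_norm _ _).trans (mul_le_mul_of_nonneg_right (hVC y) (norm_nonneg a))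
  have h1 : 2 * t * ⟪V w, a⟫ ≤ C * ‖a‖ * (1 + ⟪V w, w⟫ / c) := by
    have h2 : ‖w‖ ^ 2 ≤ ⟪V w, w⟫ / c := (le_div_iff₀' hc).2 (hcV _)
    have h3 : 2 * ‖w‖ ≤ 1 + ⟪V w, w⟫ / c := by nlinarith [sq_nonneg (‖w‖ - 1)]
    have h4 := mul_le_mul_of_nonneg_left h3 (mul_nonneg hC (norm_nonneg a))
    have h5 : t * ⟪V w, a⟫ ≤ C * ‖w‖ * ‖a‖ :=
      (mul_le_mul_of_nonneg_left (hle w) ht0).trans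
        (mul_le_of_le_one_left (by positivity) ht1)
    linarith
  have h2 : t ^ 2 * ⟪V a, a⟫ ≤ C * ‖a‖ ^ 2 :=
    (mul_le_mul_of_nonneg_left (hle a) (sq_nonneg t)).trans <| by
      rw [mul_assoc C, ← sq]
      exact mul_le_of_le_one_left (by positivity) (pow_le_one₀ ht0 ht1)
  have h3 : (1 + C / c * ‖a‖) * ⟪V w, w⟫ ≤
      (1 + C / c * ‖a‖) * (⟪V u, u⟫ + t * (⟪V v, v⟫ - ⟪V u, u⟫)) :=
    mul_le_mul_of_nonneg_left hconv (by positivity)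
  have e : C / c * ‖a‖ * ⟪V w, w⟫ = C * ‖a‖ * (⟪V w, w⟫ / c) := by ring
  rw [hwa, hexp]
  linarith

/-- Quasi-Fejér monotonicity of the variable metric forward–backward iteration with respect to a
single solution `z`. -/
theorem exists_tendsto_and_summable_of_forward_backward {V : ℕ → H →L[ℝ] H} {x p a b d : ℕ → H}
    {z : H} {γ t η : ℕ → ℝ} {β L G c C ε : ℝ} (hε : 0 < ε)
    (hsymm : ∀ n x y, ⟪V n x, y⟫ = ⟪x, V n y⟫)
    (hc : 0 < c) (hcV : ∀ n x, c * ‖x‖ ^ 2 ≤ ⟪V n x, x⟫)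
    (hC : 0 ≤ C) (hVC : ∀ n x, ‖V n x‖ ≤ C * ‖x‖)
    (hη0 : ∀ n, 0 ≤ η n) (hη : Summable η)
    (hVmono : ∀ n x, ⟪V (n + 1) x, x⟫ ≤ (1 + η n) * ⟪V n x, x⟫)
    (hγ : ∀ n, γ n ∈ Set.Icc ε G) (ht : ∀ n, t n ∈ Set.Icc ε 1)
    (hL : 0 < L) (hLβ : L < 2 * β) (hγV : ∀ n x, γ n * (‖x‖ ^ 2 / L) ≤ ⟪V n x, x⟫)
    (ha : Summable fun n => ‖a n‖) (hb : Summable fun n => ‖b n‖)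
    (hcoc : ∀ n, β * ‖d n‖ ^ 2 ≤ ⟪d n, x n - z⟫)
    (hmono : ∀ n, γ n * ⟪d n + b n, p n - z⟫ ≤ ⟪V n (x n - p n), p n - z⟫)
    (hx : ∀ n, x (n + 1) = x n + t n • (p n + a n - x n)) :
    (∃ l, Tendsto (fun n => ⟪V n (x n - z), x n - z⟫) atTop (𝓝 l)) ∧
      Summable fun n => ‖x n - p n‖ ^ 2 + ‖d n‖ ^ 2 := by
  obtain ⟨κ, hκ, hquad⟩ := exists_pos_forall_quadratic_le hL hLβ
  have hG : 0 ≤ G := hε.le.trans ((hγ 0).1.trans (hγ 0).2)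
  have hV0 : ∀ n y, 0 ≤ ⟪V n y, y⟫ := fun n y => le_trans (by positivity) (hcV n y)
  have hsq : ∀ {u : ℕ → H}, Summable (fun n => ‖u n‖) → Summable fun n => ‖u n‖ ^ 2 := fun {u} hu =>
    Summable.of_nonneg_of_le (fun n => by positivity)
      (fun n => by
        rw [sq]
        exact mul_le_mul_of_nonneg_right (hu.le_tsum n fun k _ => norm_nonneg _) (norm_nonneg _))
      (hu.mul_left (∑' k, ‖u k‖))
  set A₁ : ℕ → ℝ := fun n => G / c * ‖b n‖ with hA₁
  set A₂ : ℕ → ℝ := fun n => C / c * ‖a n‖ with hA₂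
  set B : ℕ → ℝ := fun n =>
    (G * ‖b n‖ + G / κ * ‖b n‖ ^ 2) + (C * ‖a n‖ + C * ‖a n‖ ^ 2) with hB
  have hA₁0 : ∀ n, 0 ≤ A₁ n := fun n => by positivity
  have hA₂0 : ∀ n, 0 ≤ A₂ n := fun n => by positivity
  have hB0 : ∀ n, 0 ≤ B n := fun n => by positivity
  have hBs : Summable B := ((hb.mul_left G).add ((hsq hb).mul_left _)).add
    ((ha.mul_left C).add ((hsq ha).mul_left C))
  set P : ℕ → ℝ := fun n => (1 + η n) * ((1 + A₂ n) * (1 + A₁ n)) with hP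
  have hQ1 : ∀ n, 1 ≤ (1 + A₂ n) * (1 + A₁ n) := fun n =>
    one_le_mul_of_one_le_of_one_le (by linarith [hA₂0 n]) (by linarith [hA₁0 n])
  have hP1 : ∀ n, 1 ≤ P n := fun n =>
    one_le_mul_of_one_le_of_one_le (by linarith [hη0 n]) (hQ1 n)
  have hPs : Summable fun n => P n - 1 := by
    have := summable_one_add_mul_one_add_sub_one hη0 (fun n => sub_nonneg.2 (hQ1 n)) hη
      (summable_one_add_mul_one_add_sub_one hA₂0 hA₁0 (ha.mul_left _) (hb.mul_left _))
    exact this.congr fun n => by simp only [hP]; ring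
  have hPB : Summable fun n => P n * B n := by
    have := summable_one_add_mul_one_add_sub_one (fun n => sub_nonneg.2 (hP1 n)) hB0 hPs hBs
    exact (this.sub hPs).congr fun n => by ring
  obtain ⟨h1, h2⟩ := exists_tendsto_and_summable_of_le_one_add_mul_add
    (r := fun n => ⟪V n (x n - z), x n - z⟫)
    (E := fun n => ε * ε * κ * (‖x n - p n‖ ^ 2 + ‖d n‖ ^ 2)) (A := fun n => P n - 1)
    (B := fun n => P n * B n) (fun n => hV0 n _) (fun n => by positivity)
    (fun n => sub_nonneg.2 (hP1 n)) (fun n => mul_nonneg (by linarith [hP1 n]) (hB0 n)) hPs hPB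
    fun n => by
      have hfb := inner_apply_forward_backward_le (hsymm n) hc (hcV n) (hε.le.trans (hγ n).1)
        (hγV n) hκ hquad (hcoc n) (hmono n)
      have hrel := inner_apply_relaxation_le (u := x n - z) (v := p n - z) (a := a n) (hsymm n) hc
        (hcV n) hC (hVC n) (hε.le.trans (ht n).1) (ht n).2
      have hxz : x n - z + t n • (p n - z + a n - (x n - z)) = x (n + 1) - z := by
        rw [hx]; module
      rw [hxz] at hrel
      have hX := hV0 n (x n - z)
      have hV := hVmono n (x (n + 1) - z)
      have hη' : 0 ≤ 1 + η n := by linarith [hη0 n]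
      have hA₂' : 1 ≤ 1 + A₂ n := by linarith [hA₂0 n]
      set X := ⟪V n (x n - z), x n - z⟫
      set S := ⟪V n (p n - z), p n - z⟫
      set Y := ⟪V n (x (n + 1) - z), x (n + 1) - z⟫
      set e := ‖x n - p n‖ ^ 2 + ‖d n‖ ^ 2 with he
      have he0 : 0 ≤ κ * e := by positivity
      set B₁ := G * ‖b n‖ + G / κ * ‖b n‖ ^ 2 with hB₁
      set B₂ := C * ‖a n‖ + C * ‖a n‖ ^ 2 with hB₂
      have hB₁0 : 0 ≤ B₁ := by positivity
      have hB₂0 : 0 ≤ B₂ := by positivity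
      have hS : S - X ≤ A₁ n * X + B₁ - ε * (κ * e) := by
        have g1 := mul_le_mul_of_nonneg_right (hγ n).1 he0
        have g2 := mul_le_mul_of_nonneg_right (hγ n).2
          (show 0 ≤ ‖b n‖ * (1 + X / c) + ‖b n‖ ^ 2 / κ by positivity)
        have g3 : G * (‖b n‖ * (1 + X / c) + ‖b n‖ ^ 2 / κ) = A₁ n * X + B₁ := by
          simp only [hA₁, hB₁]; ring
        linarith
      have hA₁X : 0 ≤ A₁ n * X + B₁ := add_nonneg (mul_nonneg (hA₁0 n) hX) hB₁0
      have htS : t n * (S - X) ≤ A₁ n * X + B₁ - ε * ε * κ * e := by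
        have g1 := mul_le_mul_of_nonneg_left hS (hε.le.trans (ht n).1)
        have g2 := mul_le_of_le_one_left hA₁X (ht n).2
        have g3 := mul_le_mul_of_nonneg_right (ht n).1 (mul_nonneg hε.le he0)
        linarith
      have hE0 : 0 ≤ ε * ε * κ * e := by positivity
      have hY : Y + ε * ε * κ * e ≤ (1 + A₂ n) * (1 + A₁ n) * (X + (B₁ + B₂)) := by
        have g1 := mul_le_mul_of_nonneg_left htS (zero_le_one.trans hA₂')
        have g2 := mul_le_mul_of_nonneg_right hA₂' hE0
        have g3 : 0 ≤ (1 + A₂ n) * A₁ n * B₁ :=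
          mul_nonneg (mul_nonneg (zero_le_one.trans hA₂') (hA₁0 n)) hB₁0
        have g4 := mul_le_mul_of_nonneg_right (hQ1 n) hB₂0
        have g5 : Y ≤ (1 + A₂ n) * (X + t n * (S - X)) + B₂ := hrel
        linarith
      have g1 := mul_le_mul_of_nonneg_left hY hη'
      have g2 := mul_le_mul_of_nonneg_right (show 1 ≤ 1 + η n by linarith [hη0 n]) hE0
      simp only [hP]
      linarith
  refine ⟨h1, ?_⟩
  have hk : ε * ε * κ ≠ 0 := by positivity
  exact (summable_mul_left_iff hk).1 h2

end ForwardBackward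

section Opial

variable {H : Type*} [NormedAddCommGroup H] [InnerProductSpace ℝ H]

theorem eq_of_tendsto_inner_of_tendsto_variable_metric {V : ℕ → H →L[ℝ] H} {x : ℕ → H}
    {z₁ z₂ v : H} {c R r₁ r₂ : ℝ} {l₁ l₂ : Filter ℕ} [l₁.NeBot] [l₂.NeBot]
    (hl₁ : l₁ ≤ atTop) (hl₂ : l₂ ≤ atTop)
    (hsymm : ∀ n x y, ⟪V n x, y⟫ = ⟪x, V n y⟫)
    (hc : 0 < c) (hcV : ∀ n x, c * ‖x‖ ^ 2 ≤ ⟪V n x, x⟫) (hR : ∀ n, ‖x n‖ ≤ R)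
    (hv : Tendsto (fun n => V n (z₁ - z₂)) atTop (𝓝 v))
    (h₁ : Tendsto (fun n => ⟪V n (x n - z₁), x n - z₁⟫) atTop (𝓝 r₁))
    (h₂ : Tendsto (fun n => ⟪V n (x n - z₂), x n - z₂⟫) atTop (𝓝 r₂))
    (hx₁ : ∀ w, Tendsto (fun n => ⟪x n, w⟫) l₁ (𝓝 ⟪z₁, w⟫))
    (hx₂ : ∀ w, Tendsto (fun n => ⟪x n, w⟫) l₂ (𝓝 ⟪z₂, w⟫)) : z₁ = z₂ := by
  set u := z₁ - z₂ with hu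
  have hvu : Tendsto (fun n => ⟪V n u, u⟫) atTop (𝓝 ⟪v, u⟫) := hv.inner tendsto_const_nhds
  have hexp : ∀ n, ⟪x n, V n u⟫ = (⟪V n (x n - z₂), x n - z₂⟫ - ⟪V n (x n - z₁), x n - z₁⟫
      + ⟪V n u, u⟫) / 2 + ⟪V n u, z₂⟫ := by
    intro n
    have e : x n - z₁ = (x n - z₂) - u := by rw [hu]; abel
    rw [e, inner_apply_sub_self (hsymm n) (x n - z₂), hsymm n (x n - z₂) u,
      inner_sub_left (x n) z₂ (V n u), real_inner_comm z₂ (V n u)]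
    ring
  have hlim := ((((h₂.sub h₁).add hvu).div_const 2).add (hv.inner (tendsto_const_nhds (x := z₂))))
  have herr : Tendsto (fun n => ⟪x n, V n u - v⟫) atTop (𝓝 0) := by
    have h0 : Tendsto (fun n => R * ‖V n u - v‖) atTop (𝓝 0) := by
      simpa using (tendsto_iff_norm_sub_tendsto_zero.1 hv).const_mul R
    refine squeeze_zero_norm (fun n => ?_) h0
    exact (norm_inner_le_norm _ _).trans (mul_le_mul_of_nonneg_right (hR n) (norm_nonneg _))
  have hxv := (hlim.sub herr).congr fun n => by
    rw [← hexp, ← inner_sub_right, sub_sub_cancel]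
  have g₁ := tendsto_nhds_unique (hx₁ v) (hxv.mono_left hl₁)
  have g₂ := tendsto_nhds_unique (hx₂ v) (hxv.mono_left hl₂)
  have huv : ⟪v, u⟫ = 0 := by
    rw [hu, real_inner_comm, inner_sub_left, g₁, g₂, sub_self]
  have h3 : c * ‖u‖ ^ 2 ≤ ⟪v, u⟫ := ge_of_tendsto' hvu fun n => hcV n u
  have h4 : ‖u‖ ^ 2 ≤ 0 := by nlinarith
  rw [← sub_eq_zero, ← hu, ← norm_eq_zero]
  exact pow_eq_zero_iff two_ne_zero |>.1 (le_antisymm h4 (sq_nonneg _))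

/-- The Opial lemma in a variable metric. -/
theorem exists_tendsto_inner_of_tendsto_variable_metric [CompleteSpace H] {V : ℕ → H →L[ℝ] H}
    {x : ℕ → H} {S : Set H} {c R : ℝ} (hsymm : ∀ n x y, ⟪V n x, y⟫ = ⟪x, V n y⟫)
    (hc : 0 < c) (hcV : ∀ n x, c * ‖x‖ ^ 2 ≤ ⟪V n x, x⟫) (hR : ∀ n, ‖x n‖ ≤ R)
    (hV : ∀ u, ∃ v, Tendsto (fun n => V n u) atTop (𝓝 v))
    (hS : ∀ z ∈ S, ∃ r, Tendsto (fun n => ⟪V n (x n - z), x n - z⟫) atTop (𝓝 r))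
    (hcluster : ∀ (l : Ultrafilter ℕ) (z : H), (l : Filter ℕ) ≤ atTop →
      (∀ w, Tendsto (fun n => ⟪x n, w⟫) l (𝓝 ⟪z, w⟫)) → z ∈ S) :
    ∃ z ∈ S, ∀ w, Tendsto (fun n => ⟪x n, w⟫) atTop (𝓝 ⟪z, w⟫) := by
  obtain ⟨z, hz⟩ := exists_tendsto_inner_of_bounded (Ultrafilter.of (atTop : Filter ℕ)) hR
  have hzS := hcluster _ z (Ultrafilter.of_le _) hz
  refine ⟨z, hzS, fun w => (tendsto_iff_ultrafilter _ _ _).2 fun l hl => ?_⟩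
  obtain ⟨z', hz'⟩ := exists_tendsto_inner_of_bounded l hR
  obtain ⟨r, hr⟩ := hS z hzS
  obtain ⟨r', hr'⟩ := hS z' (hcluster l z' hl hz')
  obtain ⟨v, hv⟩ := hV (z' - z)
  rw [← eq_of_tendsto_inner_of_tendsto_variable_metric hl (Ultrafilter.of_le _) hsymm hc hcV hR hv
    hr' hr hz' hz]
  exact hz' w

end Opial

section ExtendedReal

variable {H : Type*} [NormedAddCommGroup H] [InnerProductSpace ℝ H]

theorem EReal.mul_sub_le_of_hasDerivAt_of_forall_le {f : H → EReal} {h : H → ℝ} {c D Fp Fw : ℝ}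
    {p w : H}
    (hfconv : ∀ x y : H, ∀ t : ℝ, t ∈ Set.Icc (0 : ℝ) 1 →
      f (t • x + (1 - t) • y) ≤ (t : EReal) * f x + ((1 - t : ℝ) : EReal) * f y)
    (hc : 0 ≤ c) (hp : f p = Fp) (hw : f w = Fw)
    (hmin : ∀ u, (c : EReal) * f p + (h p : EReal) ≤ (c : EReal) * f u + (h u : EReal))
    (hder : HasDerivAt (fun s : ℝ => h (p + s • (w - p))) D 0) : c * (Fp - Fw) ≤ D := by
  refine le_of_hasDerivAt_of_forall_mul_le_sub hder fun t ht => ?_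
  have h1 := hfconv w p t ⟨ht.1.le, ht.2⟩
  have e : t • w + (1 - t) • p = p + t • (w - p) := by module
  rw [e, hp, hw] at h1
  have h2 := (hmin (p + t • (w - p))).trans
    (add_le_add_left (mul_le_mul_of_nonneg_left h1 (EReal.coe_nonneg.2 hc)) _)
  rw [hp] at h2
  have h3 : c * Fp + h p ≤ c * (t * Fw + (1 - t) * Fp) + h (p + t • (w - p)) := by
    exact_mod_cast h2
  simp only [zero_smul, add_zero]
  linarith

theorem convex_setOf_le_coe_sub {f : H → EReal} {g : H → ℝ}
    (hfconv : ∀ x y : H, ∀ t : ℝ, t ∈ Set.Icc (0 : ℝ) 1 →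
      f (t • x + (1 - t) • y) ≤ (t : EReal) * f x + ((1 - t : ℝ) : EReal) * f y)
    (hg : ConvexOn ℝ Set.univ g) (m : ℝ) : Convex ℝ {x | f x ≤ ((m - g x : ℝ) : EReal)} := by
  intro x hx y hy s t hs ht hst
  obtain rfl : t = 1 - s := by linarith
  have h1 := hfconv x y s ⟨hs, by linarith⟩
  have h2 := add_le_add (mul_le_mul_of_nonneg_left hx (EReal.coe_nonneg.2 hs))
    (mul_le_mul_of_nonneg_left hy (EReal.coe_nonneg.2 ht))
  have h3 := hg.2 (Set.mem_univ x) (Set.mem_univ y) hs ht hst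
  refine (h1.trans h2).trans ?_
  rw [← EReal.coe_mul, ← EReal.coe_mul, ← EReal.coe_add, EReal.coe_le_coe_iff]
  simp only [smul_eq_mul] at h3
  linarith

theorem LowerSemicontinuous.isClosed_setOf_le_coe {X : Type*} [TopologicalSpace X] {f : X → EReal}
    {h : X → ℝ} (hf : LowerSemicontinuous f) (hh : Continuous h) :
    IsClosed {x | f x ≤ (h x : EReal)} :=
  hf.isClosed_epigraph.preimage (continuous_id.prodMk (continuous_coe_real_ereal.comp hh))

theorem HasDerivAt.half_inner_apply_sub_add_smul {V : H →L[ℝ] H}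
    (hsymm : ∀ x y, ⟪V x, y⟫ = ⟪x, V y⟫) (y p w : H) :
    HasDerivAt (fun s : ℝ => 1 / 2 * ⟪V (y - (p + s • (w - p))), y - (p + s • (w - p))⟫)
      (-⟪V (y - p), w - p⟫) 0 := by
  have hexp : (fun s : ℝ => 1 / 2 * ⟪V (y - (p + s • (w - p))), y - (p + s • (w - p))⟫) =
      fun s : ℝ => (1 / 2 * ⟪V (y - p), y - p⟫ + s * (-⟪V (y - p), w - p⟫)) +
        s ^ 2 * (1 / 2 * ⟪V (w - p), w - p⟫) := by
    funext s
    have e : y - (p + s • (w - p)) = (y - p) - s • (w - p) := by abel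
    rw [e, inner_apply_sub_self hsymm (y - p), map_smul, real_inner_smul_left,
      real_inner_smul_right, real_inner_smul_right]
    ring
  rw [hexp]
  have h1 := (((hasDerivAt_id (0 : ℝ)).mul_const (-⟪V (y - p), w - p⟫)).const_add
    (1 / 2 * ⟪V (y - p), y - p⟫)).add
      ((hasDerivAt_pow 2 (0 : ℝ)).mul_const (1 / 2 * ⟪V (w - p), w - p⟫))
  exact h1.congr_deriv (by simp)

end ExtendedReal

/-- **Variable metric forward–backward splitting for minimization of `f + g`.**
With `f ∈ Γ₀(H)` and `g` convex differentiable with `1/β`-Lipschitz gradient `g'`,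
the variable metric forward–backward iterates (with proximal steps in the metrics
`U n⁻¹`) converge weakly to a minimizer `xb` of `f + g`, and
`∑ ‖g' (x n) − g' xb‖² < ∞`. -/
theorem variable_metric_forward_backward_minimization
    {H : Type*} [NormedAddCommGroup H] [InnerProductSpace ℝ H] [CompleteSpace H]
    (f : H → EReal)
    (hfbot : ∀ x : H, f x ≠ ⊥)
    (hfproper : ∃ x : H, f x ≠ ⊤)
    (hflsc : LowerSemicontinuous f)
    (hfconv : ∀ x y : H, ∀ t : ℝ, t ∈ Set.Icc (0:ℝ) 1 →
      f (t • x + (1 - t) • y) ≤ (t : EReal) * f x + ((1 - t : ℝ) : EReal) * f y)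
    (β : ℝ) (hβ : 0 < β)
    (g : H → ℝ) (g' : H → H)
    (hgconv : ConvexOn ℝ Set.univ g)
    (hgdiff : ∀ x : H, HasGradientAt g (g' x) x)
    (hglip : ∀ x y : H, ‖g' x - g' y‖ ≤ (1 / β) * ‖x - y‖)
    (η : ℕ → ℝ) (hη0 : ∀ n, 0 ≤ η n) (hηsum : Summable η)
    (α : ℝ) (hα : 0 < α)
    (U Uinv : ℕ → H →L[ℝ] H) (hUsa : ∀ n, IsSelfAdjoint (U n))
    (hUα : ∀ n (x : H), ⟪U n x, x⟫ ≥ α * ‖x‖ ^ 2)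
    (hUinv₁ : ∀ n (x : H), Uinv n (U n x) = x) (hUinv₂ : ∀ n (x : H), U n (Uinv n x) = x)
    (μ : ℝ) (hμ : IsLUB (Set.range fun n => ‖U n‖) μ)
    (hUmono : ∀ n (x : H), (1 + η n) * ⟪U (n + 1) x, x⟫ ≥ ⟪U n x, x⟫)
    (ε : ℝ) (hε : ε ∈ Set.Ioc 0 (min 1 (2 * β / (μ + 1))))
    (lam : ℕ → ℝ) (hlam : ∀ n, lam n ∈ Set.Icc ε 1)
    (gam : ℕ → ℝ) (hgam : ∀ n, gam n ∈ Set.Icc ε ((2 * β - ε) / μ))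
    (a b : ℕ → H) (ha : Summable fun n => ‖a n‖) (hb : Summable fun n => ‖b n‖)
    (Argmin : Set H)
    (hArgmin : Argmin = {x : H | ∀ w : H, f x + ((g x : ℝ) : EReal) ≤ f w + ((g w : ℝ) : EReal)})
    (hArgminNe : Argmin.Nonempty)
    (x y p : ℕ → H)
    (hy : ∀ n, y n = x n - gam n • U n (g' (x n) + b n))
    (hp : ∀ n, ∀ w : H,
      (gam n : EReal) * f (p n) + (((1/2) * ⟪Uinv n (y n - p n), y n - p n⟫ : ℝ) : EReal) ≤
      (gam n : EReal) * f w + (((1/2) * ⟪Uinv n (y n - w), y n - w⟫ : ℝ) : EReal))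
    (hx : ∀ n, x (n + 1) = x n + lam n • (p n + a n - x n)) :
    ∃ xb ∈ Argmin,
      (∀ w : H, Tendsto (fun n => ⟪x n, w⟫) atTop (𝓝 ⟪xb, w⟫)) ∧
      Summable (fun n => ‖g' (x n) - g' xb‖ ^ 2) := by
  obtain ⟨hε0, -⟩ := hε
  have hUμ : ∀ n, ‖U n‖ ≤ μ := fun n => hμ.1 ⟨n, rfl⟩
  have hμ0 : 0 < μ := by
    refine lt_of_le_of_ne ((norm_nonneg _).trans (hUμ 0)) fun h => ?_
    have h1 := hε0.trans_le ((hgam 0).1.trans (hgam 0).2)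
    simp [← h] at h1
  set L := 2 * β - ε with hLdef
  have hL : 0 < L := by
    have h1 := hε0.trans_le ((hgam 0).1.trans (hgam 0).2)
    simpa [hμ0] using (div_pos_iff_of_pos_right hμ0).1 h1
  have hUsymm : ∀ n x y, ⟪U n x, y⟫ = ⟪x, U n y⟫ := fun n x y =>
    (ContinuousLinearMap.isSelfAdjoint_iff_isSymmetric.1 (hUsa n)) x y
  have hU0 : ∀ n x, 0 ≤ ⟪U n x, x⟫ := fun n x => le_trans (by positivity) (hUα n x)
  have hUle : ∀ n x, ⟪U n x, x⟫ ≤ μ * ‖x‖ ^ 2 := fun n x => by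
    rw [sq, ← mul_assoc]
    exact (real_inner_le_norm _ _).trans (mul_le_mul_of_nonneg_right
      ((U n).le_of_opNorm_le (hUμ n) x) (norm_nonneg x))
  have hVsymm : ∀ n x y, ⟪Uinv n x, y⟫ = ⟪x, Uinv n y⟫ := fun n =>
    inner_inverse_comm (hUsymm n) (hUinv₂ n)
  have hVlow : ∀ n x, 1 / μ * ‖x‖ ^ 2 ≤ ⟪Uinv n x, x⟫ := fun n x => by
    have h1 := norm_sq_le_mul_inner_of_nonneg hμ0 (hUsymm n) (hU0 n) (hUle n) (Uinv n x)
    rw [hUinv₂, real_inner_comm] at h1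
    rw [one_div, inv_mul_le_iff₀ hμ0]
    exact h1
  have hVnorm : ∀ n x, ‖Uinv n x‖ ≤ 1 / α * ‖x‖ := fun n x => by
    rw [one_div, le_inv_mul_iff₀ hα]
    exact mul_norm_inverse_le (hUα n) (hUinv₂ n) x
  have hV0 : ∀ n x, 0 ≤ ⟪Uinv n x, x⟫ := fun n x => le_trans (by positivity) (hVlow n x)
  have hVle : ∀ n x, ⟪Uinv n x, x⟫ ≤ 1 / α * ‖x‖ ^ 2 := fun n x => by
    rw [sq, ← mul_assoc]
    exact (real_inner_le_norm _ _).trans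
      (mul_le_mul_of_nonneg_right (hVnorm n x) (norm_nonneg x))
  have hVmono : ∀ n x, ⟪Uinv (n + 1) x, x⟫ ≤ (1 + η n) * ⟪Uinv n x, x⟫ := fun n =>
    inner_inverse_le_mul_inner_inverse (by linarith [hη0 n]) (hUsymm n) (hU0 n) (hUinv₂ n)
      (hUinv₂ (n + 1)) fun x => hUmono n x
  have hgam0 : ∀ n, 0 < gam n := fun n => hε0.trans_le (hgam n).1
  have hgamV : ∀ n x, gam n * (‖x‖ ^ 2 / L) ≤ ⟪Uinv n x, x⟫ := fun n x => by
    refine le_trans ?_ (hVlow n x)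
    have h1 := mul_le_mul_of_nonneg_right (hgam n).2 (show 0 ≤ ‖x‖ ^ 2 / L by positivity)
    have e : L / μ * (‖x‖ ^ 2 / L) = 1 / μ * ‖x‖ ^ 2 := by field_simp
    linarith
  -- finiteness and optimality conditions
  have hArgmin' : ∀ z ∈ Argmin, ∀ w, f z + ((g z : ℝ) : EReal) ≤ f w + ((g w : ℝ) : EReal) := by
    intro z hz
    rwa [hArgmin] at hz
  have hfin : ∀ z, f z ≠ ⊤ → f z = ((f z).toReal : EReal) := fun z hz =>
    (EReal.coe_toReal hz (hfbot z)).symm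
  have hzfin : ∀ z ∈ Argmin, f z = ((f z).toReal : EReal) := by
    intro z hz
    obtain ⟨w, hw⟩ := hfproper
    refine hfin z fun htop => ?_
    have h1 := hArgmin' z hz w
    rw [htop, EReal.top_add_coe, hfin w hw, ← EReal.coe_add, top_le_iff] at h1
    exact EReal.coe_ne_top _ h1
  obtain ⟨z₀, hz₀⟩ := hArgminNe
  have hpfin : ∀ n, f (p n) = ((f (p n)).toReal : EReal) := by
    intro n
    refine hfin _ fun htop => ?_
    have h1 := hp n z₀
    rw [htop, EReal.coe_mul_top_of_pos (hgam0 n), EReal.top_add_coe, hzfin z₀ hz₀,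
      ← EReal.coe_mul, ← EReal.coe_add, top_le_iff] at h1
    exact EReal.coe_ne_top _ h1
  have hprox : ∀ n, ∀ z ∈ Argmin, gam n * ((f (p n)).toReal - (f z).toReal) ≤
      ⟪Uinv n (x n - p n), p n - z⟫ - gam n * ⟪g' (x n) + b n, p n - z⟫ := by
    intro n z hz
    have h1 := EReal.mul_sub_le_of_hasDerivAt_of_forall_le
      (h := fun u => 1 / 2 * ⟪Uinv n (y n - u), y n - u⟫) hfconv (hgam0 n).le (hpfin n)
      (hzfin z hz) (hp n) (HasDerivAt.half_inner_apply_sub_add_smul (hVsymm n) (y n) (p n) z)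
    have e : y n - p n = (x n - p n) - gam n • U n (g' (x n) + b n) := by rw [hy]; abel
    rw [e, map_sub, map_smul, hUinv₁, ← neg_sub (p n) z, inner_neg_right, neg_neg, inner_sub_left,
      real_inner_smul_left] at h1
    exact h1
  have hopt : ∀ z ∈ Argmin, ∀ n, (f z).toReal - (f (p n)).toReal ≤ ⟪g' z, p n - z⟫ := by
    intro z hz n
    have h1 := EReal.mul_sub_le_of_hasDerivAt_of_forall_le (h := g) (c := 1) hfconv zero_le_one
      (hzfin z hz) (hpfin n) (by simpa using hArgmin' z hz)
      (HasGradientAt.hasDerivAt_add_smul (d := p n - z) (t := 0) (by simpa using hgdiff z))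
    rwa [one_mul] at h1
  have hfejer := fun z (hz : z ∈ Argmin) =>
    exists_tendsto_and_summable_of_forward_backward (V := Uinv) (d := fun n => g' (x n) - g' z)
      (z := z) (p := p) (c := 1 / μ) (C := 1 / α) (β := β) (L := L) hε0 hVsymm (by positivity) hVlow
      (by positivity) hVnorm hη0 hηsum hVmono hgam hlam hL (by rw [hLdef]; linarith) hgamV ha hb
      (fun n => hgconv.cocoercive_gradient hβ hgdiff hglip (x n) z)
      (fun n => by
        have h1 := hprox n z hz
        have h2 := mul_le_mul_of_nonneg_left (hopt z hz n) (hgam0 n).le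
        have e : g' (x n) - g' z + b n = (g' (x n) + b n) - g' z := by abel
        rw [e, inner_sub_left]
        linarith) hx
  obtain ⟨⟨r₀, hr₀⟩, hsum₀⟩ := hfejer z₀ hz₀
  -- boundedness and asymptotic regularity
  obtain ⟨R, hR⟩ : ∃ R, ∀ n, ‖x n - z₀‖ ≤ R := by
    obtain ⟨K, hK⟩ := hr₀.bddAbove_range
    refine ⟨Real.sqrt (μ * K), fun n => Real.le_sqrt_of_sq_le ?_⟩
    have h1 := (hVlow n (x n - z₀)).trans (hK ⟨n, rfl⟩)
    rwa [one_div, inv_mul_le_iff₀ hμ0] at h1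
  have hxR : ∀ n, ‖x n‖ ≤ R + ‖z₀‖ := fun n => by
    linarith [hR n, norm_sub_norm_le (x n) z₀]
  have hxp : Tendsto (fun n => ‖x n - p n‖) atTop (𝓝 0) := by
    have h1 : Tendsto (fun n => ‖x n - p n‖ ^ 2) atTop (𝓝 0) :=
      squeeze_zero (fun n => by positivity) (fun n => le_add_of_nonneg_right (by positivity))
        hsum₀.tendsto_atTop_zero
    simpa [Real.sqrt_sq] using h1.sqrt
  have hcluster : ∀ (l : Ultrafilter ℕ) (z : H), (l : Filter ℕ) ≤ atTop →
      (∀ w, Tendsto (fun n => ⟪x n, w⟫) l (𝓝 ⟪z, w⟫)) → z ∈ Argmin := by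
    intro l z hl hz
    set m := (f z₀).toReal + g z₀ with hm
    set δ : ℕ → ℝ := fun n =>
      ((1 / (ε * α) + 1 / β) * ‖x n - p n‖ + ‖b n‖) * (‖x n - p n‖ + R) with hδ
    have hδ0 : Tendsto δ atTop (𝓝 0) := by
      have h1 := ((hxp.const_mul (1 / (ε * α) + 1 / β)).add hb.tendsto_atTop_zero).mul
        (hxp.add_const R)
      rwa [mul_zero, add_zero, zero_mul] at h1
    have hval : ∀ n, (f (p n)).toReal ≤ m + δ n - g (p n) := by
      intro n
      have h1 := hprox n z₀ hz₀
      have h2 := mul_le_mul_of_nonneg_left (hgconv.add_inner_gradient_le (hgdiff (p n)) z₀)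
        (hgam0 n).le
      rw [← neg_sub (p n) z₀, inner_neg_right] at h2
      have h3 : ‖p n - z₀‖ ≤ ‖x n - p n‖ + R := by
        have := norm_sub_le_norm_sub_add_norm_sub (p n) (x n) z₀
        rw [norm_sub_rev (p n) (x n)] at this
        linarith [hR n]
      have h4 : ⟪Uinv n (x n - p n), p n - z₀⟫ ≤
          gam n * (1 / (ε * α) * ‖x n - p n‖ * ‖p n - z₀‖) := by
        have g1 := (real_inner_le_norm (Uinv n (x n - p n)) (p n - z₀)).trans
          (mul_le_mul_of_nonneg_right (hVnorm n (x n - p n)) (norm_nonneg _))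
        have g2 := mul_le_mul_of_nonneg_right (hgam n).1
          (show 0 ≤ 1 / (ε * α) * ‖x n - p n‖ * ‖p n - z₀‖ by positivity)
        have e : ε * (1 / (ε * α) * ‖x n - p n‖ * ‖p n - z₀‖) =
          1 / α * ‖x n - p n‖ * ‖p n - z₀‖ := by field_simp
        linarith
      have h5 : ⟪g' (p n), p n - z₀⟫ - ⟪g' (x n) + b n, p n - z₀⟫ ≤
          (1 / β * ‖x n - p n‖ + ‖b n‖) * ‖p n - z₀‖ := by
        rw [← inner_sub_left]
        refine (real_inner_le_norm _ _).trans (mul_le_mul_of_nonneg_right ?_ (norm_nonneg _))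
        have g1 := hglip (p n) (x n)
        rw [norm_sub_rev (p n) (x n)] at g1
        have g2 := norm_sub_le (g' (p n) - g' (x n)) (b n)
        rw [sub_sub] at g2
        linarith
      have h6 := mul_le_mul_of_nonneg_left h5 (hgam0 n).le
      have h7 : gam n * ((f (p n)).toReal + g (p n) - m) ≤ gam n *
          (((1 / (ε * α) + 1 / β) * ‖x n - p n‖ + ‖b n‖) * ‖p n - z₀‖) := by
        rw [hm]
        linarith
      have h8 := le_of_mul_le_mul_left h7 (hgam0 n)
      have h9 := h8.trans (mul_le_mul_of_nonneg_left h3 (by positivity))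
      simp only [hδ]
      linarith
    have hpz : ∀ w, Tendsto (fun n => ⟪p n, w⟫) l (𝓝 ⟪z, w⟫) := by
      intro w
      have h1 : Tendsto (fun n => ⟪x n - p n, w⟫) atTop (𝓝 0) := by
        refine squeeze_zero_norm (fun n => norm_inner_le_norm _ _) ?_
        simpa using hxp.mul_const ‖w‖
      simpa using ((hz w).sub (h1.mono_left hl)).congr fun n => by
        rw [← inner_sub_left, sub_sub_cancel]
    have hgcont : Continuous g :=
      continuous_iff_continuousAt.2 fun u => (hgdiff u).differentiableAt.continuousAt
    have hzle : ∀ τ > 0, f z ≤ ((m + τ - g z : ℝ) : EReal) := by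
      intro τ hτ
      refine mem_of_tendsto_inner (l := (l : Filter ℕ)) (x := p)
        (convex_setOf_le_coe_sub hfconv hgconv (m + τ))
        (hflsc.isClosed_setOf_le_coe (continuous_const.sub hgcont)) ?_ hpz
      refine hl ?_
      filter_upwards [hδ0.eventually_lt_const hτ] with n hn
      rw [hpfin n, EReal.coe_le_coe_iff]
      linarith [hval n]
    have hzf : f z = ((f z).toReal : EReal) :=
      hfin z ((hzle 1 one_pos).trans_lt (EReal.coe_lt_top _)).ne
    have hzm : (f z).toReal + g z ≤ m := by
      refine le_of_forall_pos_le_add fun τ hτ => ?_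
      have h1 := hzle τ hτ
      rw [hzf, EReal.coe_le_coe_iff] at h1
      linarith
    rw [hArgmin]
    intro w
    refine le_trans ?_ (hArgmin' z₀ hz₀ w)
    rw [hzf, hzfin z₀ hz₀]
    exact_mod_cast hzm
  obtain ⟨xb, hxb, hweak⟩ := exists_tendsto_inner_of_tendsto_variable_metric hVsymm
    (one_div_pos.2 hμ0) hVlow hxR
    (exists_tendsto_apply_of_le_one_add_mul (one_div_pos.2 hα) hη0 hηsum hVsymm hV0 hVle hVmono)
    (fun z hz => (hfejer z hz).1) hcluster
  refine ⟨xb, hxb, hweak, ?_⟩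
  exact Summable.of_nonneg_of_le (fun n => by positivity)
    (fun n => le_add_of_nonneg_left (by positivity)) (hfejer xb hxb).2
end

section
/- Let H be a real Hilbert space, f ∈ Γ₀(H), β > 0, and let B : H → H be β-cocoercive. Let (η_n) be a summable sequence in [0,∞), α > 0, and (U_n) a sequence in P_α(H) with μ := sup_n ‖U_n‖ < ∞ and (1+η_n)⟪U_{n+1}x, x⟫ ≥ ⟪U_n x, x⟫ for all n, x. Let ε ∈ (0, min{1, 2β/(μ+1)}], let (λ_n) be a sequence in [ε,1], (γ_n) a sequence in [ε,(2β−ε)/μ], and let (a_n), (b_n) be sequences in H with Σ‖a_n‖ < ∞ and Σ‖b_n‖ < ∞. Assume the variational inequality 'find x ∈ H such that for all y ∈ H, ⟪x−y, Bx⟫ + f(x) ≤ f(y) (in EReal)' admits at least one solution, and let sequences (x_n), (y_n), (p_n) in H satisfy, for every n: y_n = x_n − γ_n U_n(Bx_n + b_n); p_n = prox^{U_n⁻¹}_{γ_n f}(y_n), i.e. γ_n·f(p_n) + (1/2)⟪U_n⁻¹(y_n−p_n), y_n−p_n⟫ ≤ γ_n·f(y) + (1/2)⟪U_n⁻¹(y_n−y),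 y_n−y⟫ for all y ∈ H; and x_{n+1} = x_n + λ_n(p_n + a_n − x_n). Then (x_n) converges weakly to some solution x̄ of the variational inequality. -/
open RealInnerProductSpace Filter Topology

section PositiveOperators

variable {H : Type*} [NormedAddCommGroup H] [InnerProductSpace ℝ H]

/-- A symmetric operator with `0 ≤ A ≤ C` satisfies `A² ≤ C A`. -/
lemma norm_sq_apply_le_of_form_le (A : H →L[ℝ] H) (hsym : ∀ u v, ⟪A u, v⟫ = ⟪u, A v⟫)
    (hpos : ∀ u, 0 ≤ ⟪A u, u⟫) {C : ℝ} (hC : 0 < C) (hle : ∀ u, ⟪A u, u⟫ ≤ C * ‖u‖ ^ 2)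
    (d : H) : ‖A d‖ ^ 2 ≤ C * ⟪A d, d⟫ := by
  have h0 := hpos (d - C⁻¹ • A d)
  have h1 := hle (A d)
  have hexp : ⟪A (d - C⁻¹ • A d), d - C⁻¹ • A d⟫
      = ⟪A d, d⟫ - 2 * C⁻¹ * ‖A d‖ ^ 2 + C⁻¹ ^ 2 * ⟪A (A d), A d⟫ := by
    have := hsym (A d) d
    rw [← real_inner_self_eq_norm_sq]
    simp only [map_sub, map_smul, inner_sub_left, inner_sub_right, real_inner_smul_left,
      real_inner_smul_right, this]
    ring
  have h2 : C⁻¹ ^ 2 * ⟪A (A d), A d⟫ ≤ C⁻¹ * ‖A d‖ ^ 2 := by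
    calc _ ≤ C⁻¹ ^ 2 * (C * ‖A d‖ ^ 2) := by gcongr
      _ = _ := by field_simp
  have h3 : C⁻¹ * ‖A d‖ ^ 2 ≤ ⟪A d, d⟫ := by linarith
  rwa [inv_mul_le_iff₀ hC] at h3

/-- Inversion reverses the Loewner order. -/
lemma form_inverse_le {U U' V V' : H →L[ℝ] H} (hUsym : ∀ u v, ⟪U u, v⟫ = ⟪u, U v⟫)
    (hUpos : ∀ u, 0 ≤ ⟪U u, u⟫) (hV : ∀ u, U (V u) = u) (hV' : ∀ u, U' (V' u) = u)
    {k : ℝ} (hk : 0 < k) (hle : ∀ u, ⟪U u, u⟫ ≤ k * ⟪U' u, u⟫) (v : H) :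
    ⟪V' v, v⟫ ≤ k * ⟪V v, v⟫ := by
  have h0 := hUpos (V v - k⁻¹ • V' v)
  have h1 := hle (V' v)
  rw [hV', real_inner_comm (V' v) v] at h1
  have hexp : ⟪U (V v - k⁻¹ • V' v), V v - k⁻¹ • V' v⟫
      = ⟪V v, v⟫ - 2 * k⁻¹ * ⟪V' v, v⟫ + k⁻¹ ^ 2 * ⟪U (V' v), V' v⟫ := by
    have := hUsym (V' v) (V v)
    rw [hV] at this
    simp only [map_sub, map_smul, inner_sub_left, inner_sub_right, real_inner_smul_left,
      real_inner_smul_right, this, hV, real_inner_comm v]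
    ring
  have h2 : k⁻¹ ^ 2 * ⟪U (V' v), V' v⟫ ≤ k⁻¹ * ⟪V' v, v⟫ := by
    calc _ ≤ k⁻¹ ^ 2 * (k * ⟪V' v, v⟫) := by
          gcongr
      _ = _ := by field_simp
  have h3 : k⁻¹ * ⟪V' v, v⟫ ≤ ⟪V v, v⟫ := by linarith
  rwa [inv_mul_le_iff₀ hk] at h3

end PositiveOperators

section QuasiMonotone

/-- A nonnegative sequence that decreases up to summable exponential factors converges, and the
decrements tend to zero. -/
lemma tendsto_of_add_le_exp_mul {ψ θ s : ℕ → ℝ} (hψ : ∀ n, 0 ≤ ψ n) (hθ : ∀ n, 0 ≤ θ n)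
    (hs : Summable s) (h : ∀ n, ψ (n + 1) + θ n ≤ Real.exp (s n) * ψ n) :
    (∃ l, Tendsto ψ atTop (𝓝 l)) ∧ Tendsto θ atTop (𝓝 0) := by
  set S : ℕ → ℝ := fun n => ∑ i ∈ Finset.range n, s i with hS
  have hSlim : Tendsto S atTop (𝓝 (∑' i, s i)) := hs.hasSum.tendsto_sum_nat
  have hanti : Antitone fun n => Real.exp (-S n) * ψ n := by
    refine antitone_nat_of_succ_le fun n => ?_
    have h1 : ψ (n + 1) ≤ Real.exp (s n) * ψ n := by linarith [h n, hθ n]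
    calc Real.exp (-S (n + 1)) * ψ (n + 1) ≤ Real.exp (-S (n + 1)) * (Real.exp (s n) * ψ n) := by
          gcongr
      _ = Real.exp (-S n) * ψ n := by
          rw [← mul_assoc, ← Real.exp_add]
          congr 2
          simp [hS, Finset.sum_range_succ]
  have hlim := tendsto_atTop_ciInf hanti ⟨0, by
    rintro _ ⟨n, rfl⟩
    exact mul_nonneg (Real.exp_pos _).le (hψ n)⟩
  have hψlim := ((Real.continuous_exp.tendsto _).comp hSlim).mul hlim
  have hfun : (fun n => (Real.exp ∘ S) n * (Real.exp (-S n) * ψ n)) = ψ := by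
    funext n
    simp [← mul_assoc, ← Real.exp_add]
  rw [hfun] at hψlim
  refine ⟨⟨_, hψlim⟩, ?_⟩
  have hup := (((Real.continuous_exp.tendsto _).comp hs.tendsto_atTop_zero).mul hψlim).sub
    (hψlim.comp (tendsto_add_atTop_nat 1))
  rw [Real.exp_zero, one_mul, sub_self] at hup
  exact squeeze_zero hθ (fun n => by simpa using by linarith [h n]) hup

variable {H : Type*} [NormedAddCommGroup H] [InnerProductSpace ℝ H] [CompleteSpace H]

/-- A bounded sequence of positive symmetric operators that decreases up to summable exponential
factors converges pointwise in norm. -/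
lemma exists_tendsto_apply_of_form_le_exp_mul {V : ℕ → H →L[ℝ] H} {s : ℕ → ℝ} {C : ℝ}
    (hsym : ∀ n u v, ⟪V n u, v⟫ = ⟪u, V n v⟫) (hpos : ∀ n u, 0 ≤ ⟪V n u, u⟫) (hC : 0 < C)
    (hle : ∀ u, ⟪V 0 u, u⟫ ≤ C * ‖u‖ ^ 2) (hs : Summable s)
    (hmono : ∀ n u, ⟪V (n + 1) u, u⟫ ≤ Real.exp (s n) * ⟪V n u, u⟫) (d : H) :
    ∃ g, Tendsto (fun n => V n d) atTop (𝓝 g) := by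
  set S : ℕ → ℝ := fun n => ∑ i ∈ Finset.range n, s i with hS
  have hSlim : Tendsto S atTop (𝓝 (∑' i, s i)) := hs.hasSum.tendsto_sum_nat
  set W : ℕ → H →L[ℝ] H := fun n => Real.exp (-S n) • V n with hW
  have hWform : ∀ n u, ⟪W n u, u⟫ = Real.exp (-S n) * ⟪V n u, u⟫ := fun n u => by
    simp [hW, real_inner_smul_left]
  have hWanti : ∀ u, Antitone fun n => ⟪W n u, u⟫ := by
    refine fun u => antitone_nat_of_succ_le fun n => ?_
    rw [hWform, hWform]
    calc Real.exp (-S (n + 1)) * ⟪V (n + 1) u, u⟫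
        ≤ Real.exp (-S (n + 1)) * (Real.exp (s n) * ⟪V n u, u⟫) := by
          gcongr
          exact hmono n u
      _ = Real.exp (-S n) * ⟪V n u, u⟫ := by
          rw [← mul_assoc, ← Real.exp_add]
          congr 2
          simp [hS, Finset.sum_range_succ]
  have hWpos : ∀ n u, 0 ≤ ⟪W n u, u⟫ := fun n u => by
    rw [hWform]
    exact mul_nonneg (Real.exp_pos _).le (hpos n u)
  have hWle : ∀ n u, ⟪W n u, u⟫ ≤ C * ‖u‖ ^ 2 := fun n u => by
    refine (hWanti u (Nat.zero_le n)).trans ?_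
    simpa [hW, hS] using hle u
  have hdiff : ∀ m n, m ≤ n → ‖W m d - W n d‖ ^ 2 ≤ C * (⟪W m d, d⟫ - ⟪W n d, d⟫) := by
    intro m n hmn
    have := norm_sq_apply_le_of_form_le (W m - W n)
      (fun u v => by
        simp [hW, inner_sub_left, inner_sub_right, real_inner_smul_left, real_inner_smul_right,
          hsym])
      (fun u => by
        simpa [inner_sub_left] using hWanti u hmn) hC
      (fun u => by
        have h1 := hWle m u
        have h2 := hWpos n u
        rw [sub_apply, inner_sub_left]
        linarith) d
    simpa [inner_sub_left] using this
  have hform := (tendsto_atTop_ciInf (hWanti d) ⟨0, by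
    rintro _ ⟨n, rfl⟩
    exact hWpos n d⟩).cauchySeq
  have hcauchy : CauchySeq fun n => W n d := by
    rw [Metric.cauchySeq_iff'] at hform ⊢
    intro e he
    obtain ⟨N, hN⟩ := hform (e ^ 2 / C) (by positivity)
    refine ⟨N, fun n hn => ?_⟩
    have h1 := hdiff N n hn
    have h2 := hN n hn
    rw [dist_comm, Real.dist_eq] at h2
    have h3 := (le_abs_self _).trans_lt h2
    rw [lt_div_iff₀ hC] at h3
    rw [dist_comm, dist_eq_norm]
    exact lt_of_pow_lt_pow_left₀ 2 he.le (by linarith)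
  obtain ⟨g, hg⟩ := cauchySeq_tendsto_of_complete hcauchy
  refine ⟨_, (((Real.continuous_exp.tendsto _).comp hSlim).smul hg).congr fun n => ?_⟩
  simp [hW, smul_smul, ← Real.exp_add]

end QuasiMonotone

section WeakConvergence

variable {H : Type*} [NormedAddCommGroup H] [InnerProductSpace ℝ H]

/-- A bounded family in a Hilbert space has a weak limit along every ultrafilter. -/
lemma exists_weak_limit_of_norm_le [CompleteSpace H] {ι : Type*} (F : Ultrafilter ι) {x : ι → H}
    {R : ℝ} (hR : ∀ i, ‖x i‖ ≤ R) :
    ∃ xb : H, ∀ w, Tendsto (fun i => ⟪x i, w⟫) F (𝓝 ⟪xb, w⟫) := by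
  have hcomp := WeakDual.isCompact_closedBall (𝕜 := ℝ) (0 : StrongDual ℝ H) R
  let T : ι → WeakDual ℝ H := fun i => StrongDual.toWeakDual (InnerProductSpace.toDual ℝ H (x i))
  obtain ⟨l, -, hl⟩ := hcomp.ultrafilter_le_nhds (F.map T) (by
    rw [le_principal_iff, Ultrafilter.coe_map, mem_map]
    exact Filter.univ_mem' fun i => by simpa [T] using hR i)
  refine ⟨(InnerProductSpace.toDual ℝ H).symm (WeakDual.toStrongDual l), fun w => ?_⟩
  have h2 : Tendsto (fun i => T i w) F (𝓝 (l w)) :=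
    ((WeakDual.eval_continuous w).tendsto l).comp hl
  simpa [T] using h2

/-- Closed convex sets are closed under weak limits. -/
lemma Convex.mem_of_weak_limit [CompleteSpace H] {ι : Type*} {F : Filter ι} [F.NeBot] {s : Set H}
    (hs : Convex ℝ s) (hcl : IsClosed s) {q : ι → H} (hq : ∀ᶠ i in F, q i ∈ s) {xb : H}
    (hlim : ∀ w, Tendsto (fun i => ⟪q i, w⟫) F (𝓝 ⟪xb, w⟫)) : xb ∈ s := by
  by_contra hx
  obtain ⟨l, u, hlu, hul⟩ := geometric_hahn_banach_closed_point hs hcl hx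
  set v := (InnerProductSpace.toDual ℝ H).symm l with hv
  have hl : ∀ w, l w = ⟪w, v⟫ := fun w => by
    rw [real_inner_comm, hv, InnerProductSpace.toDual_symm_apply]
  rw [hl] at hul
  refine absurd (le_of_tendsto (hlim v) (hq.mono fun i hi => ?_)) (not_le.mpr hul)
  exact (hl (q i) ▸ hlu _ hi).le

/-- Inner products of a norm convergent family with a bounded weakly convergent one converge. -/
lemma tendsto_inner_of_weak_limit {ι : Type*} {F : Filter ι} {u v : ι → H} {ub vb : H}
    {R : ℝ} (hR : ∀ i, ‖v i‖ ≤ R) (hu : Tendsto u F (𝓝 ub))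
    (hv : ∀ w, Tendsto (fun i => ⟪v i, w⟫) F (𝓝 ⟪vb, w⟫)) :
    Tendsto (fun i => ⟪v i, u i⟫) F (𝓝 ⟪vb, ub⟫) := by
  have h0 : Tendsto (fun i => ⟪v i, u i - ub⟫) F (𝓝 0) := by
    have h1 : Tendsto (fun i => R * ‖u i - ub‖) F (𝓝 0) := by
      simpa using (tendsto_iff_norm_sub_tendsto_zero.mp hu).const_mul R
    refine squeeze_zero_norm (fun i => ?_) h1
    exact (norm_inner_le_norm _ _).trans (by gcongr; exact hR i)
  simpa [inner_sub_right] using h0.add (hv ub)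

end WeakConvergence

section ConvexFunctions

variable {H : Type*} [NormedAddCommGroup H] [InnerProductSpace ℝ H]

/-- The sublevel sets of a convex lower semicontinuous function are weakly closed. -/
lemma le_of_weak_limit [CompleteSpace H] {f : H → EReal} (hflsc : LowerSemicontinuous f)
    (hfconv : ∀ x y : H, ∀ t : ℝ, t ∈ Set.Icc (0:ℝ) 1 →
      f (t • x + (1 - t) • y) ≤ (t : EReal) * f x + ((1 - t : ℝ) : EReal) * f y)
    {ι : Type*} {F : Filter ι} [F.NeBot] {q : ι → H} {c : ℝ} (hq : ∀ᶠ i in F, f (q i) ≤ c)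
    {xb : H} (hlim : ∀ w, Tendsto (fun i => ⟪q i, w⟫) F (𝓝 ⟪xb, w⟫)) : f xb ≤ c := by
  refine Convex.mem_of_weak_limit (s := {z | f z ≤ c}) ?_
    (hflsc.isClosed_preimage (c : EReal)) hq hlim
  intro u hu v hv s t hs ht hst
  obtain rfl : t = 1 - s := by linarith
  refine (hfconv u v s ⟨hs, by linarith⟩).trans ?_
  calc (s : EReal) * f u + ((1 - s : ℝ) : EReal) * f v
      ≤ (s : EReal) * c + ((1 - s : ℝ) : EReal) * c := by
        gcongr
        · exact hu
        · exact hv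
    _ = c := by
        norm_cast
        ring_nf

/-- The variational inequality characterizing proximal points in the metric of `V`. -/
lemma prox_variational_inequality {f : H → EReal} (hfbot : ∀ x : H, f x ≠ ⊥)
    (hfproper : ∃ x : H, f x ≠ ⊤)
    (hfconv : ∀ x y : H, ∀ t : ℝ, t ∈ Set.Icc (0:ℝ) 1 →
      f (t • x + (1 - t) • y) ≤ (t : EReal) * f x + ((1 - t : ℝ) : EReal) * f y)
    {V : H →L[ℝ] H} (hsym : ∀ u v, ⟪V u, v⟫ = ⟪u, V v⟫) {γ : ℝ} (hγ : 0 < γ) {y p : H}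
    (hp : ∀ w : H,
      (γ : EReal) * f p + (((1/2) * ⟪V (y - p), y - p⟫ : ℝ) : EReal) ≤
      (γ : EReal) * f w + (((1/2) * ⟪V (y - w), y - w⟫ : ℝ) : EReal)) :
    f p ≠ ⊤ ∧ ∀ w, f w ≠ ⊤ →
      ⟪V (y - p), w - p⟫ + γ * (f p).toReal ≤ γ * (f w).toReal := by
  have hfp : f p ≠ ⊤ := by
    obtain ⟨w, hw⟩ := hfproper
    intro h
    have h1 := hp w
    rw [h, EReal.coe_mul_top_of_pos hγ, EReal.top_add_coe, top_le_iff,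
      ← EReal.coe_toReal hw (hfbot w)] at h1
    norm_cast at h1
    exact EReal.coe_ne_top _ h1
  refine ⟨hfp, fun w hw => ?_⟩
  set D := γ * (f p).toReal - γ * (f w).toReal + ⟪V (y - p), w - p⟫ with hD
  have key : ∀ t : ℝ, 0 < t → t ≤ 1 → D ≤ t * ((1/2) * ⟪V (w - p), w - p⟫) := by
    intro t ht ht1
    have hc := hfconv w p t ⟨ht.le, ht1⟩
    rw [← EReal.coe_toReal hw (hfbot w), ← EReal.coe_toReal hfp (hfbot p)] at hc
    norm_cast at hc
    have hwt : f (t • w + (1 - t) • p) ≠ ⊤ := (hc.trans_lt (EReal.coe_lt_top _)).ne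
    have h1 := hp (t • w + (1 - t) • p)
    rw [← EReal.coe_toReal hwt (hfbot _)] at hc h1
    rw [← EReal.coe_toReal hfp (hfbot p)] at h1
    norm_cast at hc h1
    have he : y - (t • w + (1 - t) • p) = (y - p) - t • (w - p) := by module
    have hexp : ⟪V (y - (t • w + (1 - t) • p)), y - (t • w + (1 - t) • p)⟫
        = ⟪V (y - p), y - p⟫ - 2 * t * ⟪V (y - p), w - p⟫ + t ^ 2 * ⟪V (w - p), w - p⟫ := by
      have := (hsym (w - p) (y - p)).trans (real_inner_comm _ _)
      rw [he]
      simp only [map_sub V (y - p), map_smul, inner_sub_left (V (y - p)),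
        inner_sub_right _ (y - p), real_inner_smul_left, real_inner_smul_right, this]
      ring
    rw [hexp] at h1
    have h2 := mul_le_mul_of_nonneg_left hc hγ.le
    have h3 : t * D ≤ t * (t * ((1/2) * ⟪V (w - p), w - p⟫)) := by
      rw [hD]
      linarith
    exact le_of_mul_le_mul_left h3 ht
  have hlim : Tendsto (fun t : ℝ => t * ((1/2) * ⟪V (w - p), w - p⟫)) (𝓝[>] 0) (𝓝 0) := by
    refine tendsto_nhdsWithin_of_tendsto_nhds ?_
    simpa using (tendsto_id (x := 𝓝 (0 : ℝ))).mul_const ((1/2) * ⟪V (w - p), w - p⟫)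
  have hD0 : D ≤ 0 := by
    refine ge_of_tendsto hlim ?_
    filter_upwards [Ioc_mem_nhdsGT (zero_lt_one' ℝ)] with t ht
    exact key t ht.1 ht.2
  rw [hD] at hD0
  linarith

end ConvexFunctions

section ForwardBackward

/-- Uniform coercivity of the quadratic form in the forward-backward estimate. -/
lemma exists_pos_forward_backward_form_le {β μ ε : ℝ} (hβ : 0 < β) (hμ : 0 < μ) (hε : 0 < ε)
    (hεβ : ε < 2 * β) :
    ∃ c > 0, ∀ γ r d : ℝ, ε ≤ γ → γ ≤ (2 * β - ε) / μ →
      c * (r ^ 2 + d ^ 2) ≤ r ^ 2 / μ + 2 * γ * (β * d ^ 2 - d * r) := by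
  have hκ : 0 < 2 * β - ε := by linarith
  set κ := 2 * β - ε with hκdef
  have hκβ : 2 * β = κ + ε := by rw [hκdef]; ring
  refine ⟨ε * min (ε / 2) (ε / (4 * β * κ)), by positivity, fun γ r d h1 h2 => ?_⟩
  have hA : ε * d ^ 2 ≤ r ^ 2 / κ + 2 * β * d ^ 2 - 2 * d * r := by
    have h : r ^ 2 / κ + 2 * β * d ^ 2 - 2 * d * r - ε * d ^ 2 = (r - κ * d) ^ 2 / κ := by
      rw [hκβ]; field_simp; ring
    have : 0 ≤ (r - κ * d) ^ 2 / κ := by positivity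
    linarith
  have hB : ε / (2 * β * κ) * r ^ 2 ≤ r ^ 2 / κ + 2 * β * d ^ 2 - 2 * d * r := by
    have h : r ^ 2 / κ + 2 * β * d ^ 2 - 2 * d * r - ε / (2 * β * κ) * r ^ 2
        = (r - 2 * β * d) ^ 2 / (2 * β) := by
      have : ε = 2 * β - κ := by linarith
      rw [this]; field_simp; ring
    have : 0 ≤ (r - 2 * β * d) ^ 2 / (2 * β) := by positivity
    linarith
  set X := r ^ 2 / κ + 2 * β * d ^ 2 - 2 * d * r with hX
  have hmin : min (ε / 2) (ε / (4 * β * κ)) * (r ^ 2 + d ^ 2) ≤ X := by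
    have h3 : min (ε / 2) (ε / (4 * β * κ)) * d ^ 2 ≤ ε / 2 * d ^ 2 := by
      gcongr; exact min_le_left _ _
    have h4 : min (ε / 2) (ε / (4 * β * κ)) * r ^ 2 ≤ ε / (4 * β * κ) * r ^ 2 := by
      gcongr; exact min_le_right _ _
    have h5 : ε / (2 * β * κ) = 2 * (ε / (4 * β * κ)) := by field_simp; ring
    rw [h5] at hB
    linarith
  have hX0 : 0 ≤ X := le_trans (by positivity) hA
  have hγ : γ * (r ^ 2 / κ) ≤ r ^ 2 / μ := by
    calc γ * (r ^ 2 / κ) ≤ κ / μ * (r ^ 2 / κ) := by gcongr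
      _ = r ^ 2 / μ := by field_simp
  calc ε * min (ε / 2) (ε / (4 * β * κ)) * (r ^ 2 + d ^ 2)
      = ε * (min (ε / 2) (ε / (4 * β * κ)) * (r ^ 2 + d ^ 2)) := by ring
    _ ≤ ε * X := by gcongr
    _ ≤ γ * X := by gcongr
    _ ≤ r ^ 2 / μ + 2 * γ * (β * d ^ 2 - d * r) := by
        rw [hX]; linarith

variable {H : Type*} [NormedAddCommGroup H] [InnerProductSpace ℝ H]

/-- One inexact forward-backward step in the metric `V` is quasi-Fejér monotone. Here `e` is
`x - z`, `q` is `p - z`, `D` is `B x - B z`, and `b` is the error on `B x`. -/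
lemma forward_backward_form_le {V : H →L[ℝ] H} (hsym : ∀ u v, ⟪V u, v⟫ = ⟪u, V v⟫)
    {μ β c γ : ℝ} (hμ : 0 < μ) (hlow : ∀ u, ‖u‖ ^ 2 ≤ μ * ⟪V u, u⟫) (hγ : 0 < γ) (hc : 0 < c)
    {e q D b : H} (hD : β * ‖D‖ ^ 2 ≤ ⟪e, D⟫)
    (hform : c * (‖e - q‖ ^ 2 + ‖D‖ ^ 2) ≤
      ‖e - q‖ ^ 2 / μ + 2 * γ * (β * ‖D‖ ^ 2 - ‖D‖ * ‖e - q‖))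
    (hvi : γ * ⟪D + b, q⟫ ≤ ⟪V (e - q), q⟫) :
    ⟪V q, q⟫ + c / 2 * (‖e - q‖ ^ 2 + ‖D‖ ^ 2) ≤
      ⟪V e, e⟫ + γ * ‖b‖ * (1 + μ * ⟪V e, e⟫) + 2 * γ ^ 2 / c * ‖b‖ ^ 2 := by
  have hpyth : ⟪V e, e⟫ = ⟪V (e - q), e - q⟫ + ⟪V q, q⟫ + 2 * ⟪V (e - q), q⟫ := by
    have := (hsym q e).trans (real_inner_comm _ _)
    simp only [map_sub, inner_sub_left, inner_sub_right, this]
    ring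
  have hQ : ‖e - q‖ ^ 2 / μ ≤ ⟪V (e - q), e - q⟫ := by
    rw [div_le_iff₀' hμ]
    exact hlow _
  have hDq : ⟪D, q⟫ = ⟪e, D⟫ - ⟪D, e - q⟫ := by
    rw [inner_sub_right, real_inner_comm D e]; ring
  have hDr : ⟪D, e - q⟫ ≤ ‖D‖ * ‖e - q‖ := real_inner_le_norm _ _
  have hbq : ⟪b, q⟫ = ⟪b, e⟫ - ⟪b, e - q⟫ := by rw [inner_sub_right]; ring
  have hbe : -(‖b‖ * ‖e‖) ≤ ⟪b, e⟫ := neg_le_of_abs_le (abs_real_inner_le_norm _ _)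
  have hbr : ⟪b, e - q⟫ ≤ ‖b‖ * ‖e - q‖ := real_inner_le_norm _ _
  have hy1 : 2 * ‖e‖ ≤ 1 + μ * ⟪V e, e⟫ := by nlinarith [hlow e, sq_nonneg (‖e‖ - 1)]
  have hy2 : 2 * γ * (‖b‖ * ‖e - q‖) ≤ c / 2 * ‖e - q‖ ^ 2 + 2 * γ ^ 2 / c * ‖b‖ ^ 2 := by
    have h : c / 2 * ‖e - q‖ ^ 2 + 2 * γ ^ 2 / c * ‖b‖ ^ 2 - 2 * γ * (‖b‖ * ‖e - q‖)
        = (c * ‖e - q‖ - 2 * γ * ‖b‖) ^ 2 / (2 * c) := by field_simp; ring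
    have : 0 ≤ (c * ‖e - q‖ - 2 * γ * ‖b‖) ^ 2 / (2 * c) := by positivity
    linarith
  have hy3 : γ * ‖b‖ * (2 * ‖e‖) ≤ γ * ‖b‖ * (1 + μ * ⟪V e, e⟫) := by gcongr
  have hlast : γ * (β * ‖D‖ ^ 2 - ‖D‖ * ‖e - q‖ - ‖b‖ * ‖e‖ - ‖b‖ * ‖e - q‖) ≤
      γ * ⟪D + b, q⟫ := by
    gcongr
    rw [inner_add_left]
    linarith
  have hD2 : 0 ≤ c * ‖D‖ ^ 2 := by positivity
  linarith

/-- A relaxation step with error `a`, measured in the metric `V`. -/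
lemma relaxation_form_le {V : H →L[ℝ] H} (hsym : ∀ u v, ⟪V u, v⟫ = ⟪u, V v⟫)
    {μ C l : ℝ} (hμ : 0 < μ) (hlow : ∀ u, ‖u‖ ^ 2 ≤ μ * ⟪V u, u⟫) (hC : 0 ≤ C)
    (hup : ∀ u, ‖V u‖ ≤ C * ‖u‖) (hl0 : 0 ≤ l) (hl1 : l ≤ 1) (e q a : H) :
    ⟪V (e + l • (q + a - e)), e + l • (q + a - e)⟫ + 1 ≤
      (1 + C * (1 + μ + ‖a‖) * ‖a‖) * ((1 - l) * ⟪V e, e⟫ + l * ⟪V q, q⟫ + 1) := by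
  have hpos : ∀ u, 0 ≤ ⟪V u, u⟫ := fun u =>
    nonneg_of_mul_nonneg_right ((sq_nonneg ‖u‖).trans (hlow u)) hμ
  set w := (1 - l) • e + l • q with hw
  have he : e + l • (q + a - e) = w + l • a := by rw [hw]; module
  have hwle : ⟪V w, w⟫ ≤ (1 - l) * ⟪V e, e⟫ + l * ⟪V q, q⟫ := by
    have h1 := hpos (e - q)
    have h2 := (hsym q e).trans (real_inner_comm _ _)
    have h3 : (1 - l) * ⟪V e, e⟫ + l * ⟪V q, q⟫ - ⟪V w, w⟫
        = l * (1 - l) * ⟪V (e - q), e - q⟫ := by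
      simp only [hw, map_sub, map_add, map_smul, inner_sub_left, inner_sub_right, inner_add_left,
        inner_add_right, real_inner_smul_left, real_inner_smul_right, h2]
      ring
    have h4 : 0 ≤ l * (1 - l) * ⟪V (e - q), e - q⟫ :=
      mul_nonneg (mul_nonneg hl0 (by linarith)) h1
    linarith
  have hexp : ⟪V (w + l • a), w + l • a⟫ = ⟪V w, w⟫ + 2 * l * ⟪V a, w⟫ + l ^ 2 * ⟪V a, a⟫ := by
    have := (hsym w a).trans (real_inner_comm _ _)
    simp only [map_add, map_smul, inner_add_left, inner_add_right, real_inner_smul_left,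
      real_inner_smul_right, this]
    ring
  have h1 : ⟪V a, w⟫ ≤ C * ‖a‖ * ‖w‖ := (real_inner_le_norm _ _).trans (by gcongr; exact hup a)
  have h2 : ⟪V a, a⟫ ≤ C * ‖a‖ * ‖a‖ := (real_inner_le_norm _ _).trans (by gcongr; exact hup a)
  have hy1 : 2 * ‖w‖ ≤ 1 + μ * ⟪V w, w⟫ := by nlinarith [hlow w, sq_nonneg (‖w‖ - 1)]
  have hQw := hpos w
  have h3 : 2 * l * ⟪V a, w⟫ ≤ C * ‖a‖ * (1 + μ * ⟪V w, w⟫) := by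
    calc 2 * l * ⟪V a, w⟫ ≤ 2 * l * (C * ‖a‖ * ‖w‖) := by gcongr
      _ = l * (C * ‖a‖ * (2 * ‖w‖)) := by ring
      _ ≤ 1 * (C * ‖a‖ * (1 + μ * ⟪V w, w⟫)) := by gcongr
      _ = _ := one_mul _
  have h4 : l ^ 2 * ⟪V a, a⟫ ≤ C * ‖a‖ * ‖a‖ := by
    calc l ^ 2 * ⟪V a, a⟫ ≤ 1 * (C * ‖a‖ * ‖a‖) := by
          gcongr
          · exact hpos a
          · exact pow_le_one₀ hl0 hl1
      _ = _ := one_mul _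
  rw [he, hexp]
  calc ⟪V w, w⟫ + 2 * l * ⟪V a, w⟫ + l ^ 2 * ⟪V a, a⟫ + 1
      ≤ ⟪V w, w⟫ + 1 + C * ‖a‖ * (1 + μ * ⟪V w, w⟫) + C * ‖a‖ * ‖a‖ := by linarith
    _ ≤ (1 + C * (1 + μ + ‖a‖) * ‖a‖) * (⟪V w, w⟫ + 1) := by
        have h5 : 0 ≤ C * ‖a‖ * (⟪V w, w⟫ + μ + ‖a‖ * ⟪V w, w⟫) := by positivity
        linarith
    _ ≤ _ := by gcongr

end ForwardBackward

section WeakLimits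

variable {H : Type*} [NormedAddCommGroup H] [InnerProductSpace ℝ H]

/-- Opial's argument in a variable metric: weak cluster points to which the variable distances
converge coincide. -/
lemma weak_limit_unique_of_tendsto_form {V : ℕ → H →L[ℝ] H}
    (hsym : ∀ n u v, ⟪V n u, v⟫ = ⟪u, V n v⟫) {μ : ℝ}
    (hlow : ∀ n u, ‖u‖ ^ 2 ≤ μ * ⟪V n u, u⟫)
    (hV : ∀ d, ∃ g, Tendsto (fun n => V n d) atTop (𝓝 g)) {x : ℕ → H} {R : ℝ}
    (hR : ∀ n, ‖x n‖ ≤ R) {z₁ z₂ : H}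
    (h₁ : ∃ l, Tendsto (fun n => ⟪V n (x n - z₁), x n - z₁⟫) atTop (𝓝 l))
    (h₂ : ∃ l, Tendsto (fun n => ⟪V n (x n - z₂), x n - z₂⟫) atTop (𝓝 l))
    {F₁ F₂ : Filter ℕ} [F₁.NeBot] [F₂.NeBot] (hF₁ : F₁ ≤ atTop) (hF₂ : F₂ ≤ atTop)
    (hx₁ : ∀ w, Tendsto (fun n => ⟪x n, w⟫) F₁ (𝓝 ⟪z₁, w⟫))
    (hx₂ : ∀ w, Tendsto (fun n => ⟪x n, w⟫) F₂ (𝓝 ⟪z₂, w⟫)) : z₁ = z₂ := by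
  obtain ⟨l₁, h₁⟩ := h₁
  obtain ⟨l₂, h₂⟩ := h₂
  obtain ⟨g₁, hg₁⟩ := hV z₁
  obtain ⟨g₂, hg₂⟩ := hV z₂
  obtain ⟨g, hg⟩ := hV (z₁ - z₂)
  have hlim := (((h₂.sub h₁).add (hg₁.inner (tendsto_const_nhds (x := z₁)))).sub
    (hg₂.inner (tendsto_const_nhds (x := z₂)))).div_const 2
  have hfun : ∀ n, (⟪V n (x n - z₂), x n - z₂⟫ - ⟪V n (x n - z₁), x n - z₁⟫ + ⟪V n z₁, z₁⟫
      - ⟪V n z₂, z₂⟫) / 2 = ⟪x n, V n (z₁ - z₂)⟫ := fun n => by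
    have e₁ := (hsym n z₁ (x n)).trans (real_inner_comm _ _)
    have e₂ := (hsym n z₂ (x n)).trans (real_inner_comm _ _)
    rw [← hsym]
    simp only [map_sub, inner_sub_left, inner_sub_right, e₁, e₂]
    ring
  have hlim' := hlim.congr hfun
  have hz₁ := tendsto_nhds_unique (hlim'.mono_left hF₁)
    (tendsto_inner_of_weak_limit hR (hg.mono_left hF₁) hx₁)
  have hz₂ := tendsto_nhds_unique (hlim'.mono_left hF₂)
    (tendsto_inner_of_weak_limit hR (hg.mono_left hF₂) hx₂)
  have hzero : ⟪g, z₁ - z₂⟫ = 0 := by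
    rw [real_inner_comm, inner_sub_left, ← hz₁, ← hz₂, sub_self]
  have hle : ‖z₁ - z₂‖ ^ 2 ≤ μ * ⟪g, z₁ - z₂⟫ :=
    ge_of_tendsto' ((hg.inner (tendsto_const_nhds (x := z₁ - z₂))).const_mul μ)
      fun n => hlow n (z₁ - z₂)
  rw [hzero, mul_zero] at hle
  exact sub_eq_zero.mp (norm_eq_zero.mp (pow_eq_zero_iff two_ne_zero |>.mp
    (le_antisymm hle (sq_nonneg _))))

/-- A cocoercive operator is demiclosed. -/
lemma eq_of_weak_limit_of_cocoercive {B : H → H} {β : ℝ} (hβ : 0 < β)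
    (hB : ∀ x y : H, ⟪x - y, B x - B y⟫ ≥ β * ‖B x - B y‖ ^ 2) {ι : Type*} {F : Filter ι}
    [F.NeBot] {x : ι → H} {R : ℝ} (hR : ∀ i, ‖x i‖ ≤ R) {xb u : H}
    (hx : ∀ w, Tendsto (fun i => ⟪x i, w⟫) F (𝓝 ⟪xb, w⟫))
    (hBx : Tendsto (fun i => B (x i)) F (𝓝 u)) : B xb = u := by
  have h1 : Tendsto (fun i => ⟪x i - xb, B (x i) - B xb⟫) F (𝓝 0) := by
    have := (tendsto_inner_of_weak_limit hR (hBx.sub_const (B xb)) hx).sub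
      ((tendsto_const_nhds (x := xb)).inner (hBx.sub_const (B xb)))
    simpa [inner_sub_left] using this
  have h2 := ((hBx.sub_const (B xb)).norm.pow 2).const_mul β
  have h3 := le_of_tendsto_of_tendsto' h2 h1 fun i => hB (x i) xb
  have h4 : ‖u - B xb‖ ^ 2 ≤ 0 := by
    by_contra! h
    exact absurd h3 (not_le.mpr (mul_pos hβ h))
  exact (sub_eq_zero.mp (norm_eq_zero.mp (pow_eq_zero_iff two_ne_zero |>.mp
    (le_antisymm h4 (sq_nonneg _))))).symm

end WeakLimits

/-- **Variable metric forward–backward splitting for variational inequalities.**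
With `f ∈ Γ₀(H)` and `B` a `β`-cocoercive operator, the variable metric
forward–backward iterates (with proximal steps in the metrics `U n⁻¹`) converge weakly
to a solution `xb` of the variational inequality
`∀ y, ⟪xb − y, B xb⟫ + f xb ≤ f y`. -/
theorem variable_metric_forward_backward_variational_inequality
    {H : Type*} [NormedAddCommGroup H] [InnerProductSpace ℝ H] [CompleteSpace H]
    (f : H → EReal)
    (hfbot : ∀ x : H, f x ≠ ⊥)
    (hfproper : ∃ x : H, f x ≠ ⊤)
    (hflsc : LowerSemicontinuous f)
    (hfconv : ∀ x y : H, ∀ t : ℝ, t ∈ Set.Icc (0:ℝ) 1 →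
      f (t • x + (1 - t) • y) ≤ (t : EReal) * f x + ((1 - t : ℝ) : EReal) * f y)
    (β : ℝ) (hβ : 0 < β)
    (B : H → H)
    (hB : ∀ x y : H, ⟪x - y, B x - B y⟫ ≥ β * ‖B x - B y‖ ^ 2)
    (η : ℕ → ℝ) (hη0 : ∀ n, 0 ≤ η n) (hηsum : Summable η)
    (α : ℝ) (hα : 0 < α)
    (U Uinv : ℕ → H →L[ℝ] H) (hUsa : ∀ n, IsSelfAdjoint (U n))
    (hUα : ∀ n (x : H), ⟪U n x, x⟫ ≥ α * ‖x‖ ^ 2)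
    (hUinv₁ : ∀ n (x : H), Uinv n (U n x) = x) (hUinv₂ : ∀ n (x : H), U n (Uinv n x) = x)
    (μ : ℝ) (hμ : IsLUB (Set.range fun n => ‖U n‖) μ)
    (hUmono : ∀ n (x : H), (1 + η n) * ⟪U (n + 1) x, x⟫ ≥ ⟪U n x, x⟫)
    (ε : ℝ) (hε : ε ∈ Set.Ioc 0 (min 1 (2 * β / (μ + 1))))
    (lam : ℕ → ℝ) (hlam : ∀ n, lam n ∈ Set.Icc ε 1)
    (gam : ℕ → ℝ) (hgam : ∀ n, gam n ∈ Set.Icc ε ((2 * β - ε) / μ))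
    (a b : ℕ → H) (ha : Summable fun n => ‖a n‖) (hb : Summable fun n => ‖b n‖)
    (Sol : Set H)
    (hSol : Sol = {x : H | ∀ w : H, ((⟪x - w, B x⟫ : ℝ) : EReal) + f x ≤ f w})
    (hSolNe : Sol.Nonempty)
    (x y p : ℕ → H)
    (hy : ∀ n, y n = x n - gam n • U n (B (x n) + b n))
    (hp : ∀ n, ∀ w : H,
      (gam n : EReal) * f (p n) + (((1/2) * ⟪Uinv n (y n - p n), y n - p n⟫ : ℝ) : EReal) ≤
      (gam n : EReal) * f w + (((1/2) * ⟪Uinv n (y n - w), y n - w⟫ : ℝ) : EReal))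
    (hx : ∀ n, x (n + 1) = x n + lam n • (p n + a n - x n)) :
    ∃ xb ∈ Sol, ∀ w : H, Tendsto (fun n => ⟪x n, w⟫) atTop (𝓝 ⟪xb, w⟫) := by
  have hε0 : 0 < ε := hε.1
  have hμ0 : 0 < μ := by
    have h1 : 0 ≤ μ := (norm_nonneg (U 0)).trans (hμ.1 ⟨0, rfl⟩)
    refine h1.lt_of_ne fun h => ?_
    have h2 := (hgam 0).1.trans (hgam 0).2
    rw [← h, div_zero] at h2
    linarith
  have hεβ : ε < 2 * β := by
    have h1 := hε.2.trans (min_le_right _ _)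
    rw [le_div_iff₀ (by linarith)] at h1
    have : 0 < ε * μ := mul_pos hε0 hμ0
    linarith
  have hγ0 : ∀ n, 0 < gam n := fun n => hε0.trans_le (hgam n).1
  have hUsym : ∀ n u v, ⟪U n u, v⟫ = ⟪u, U n v⟫ := fun n =>
    ContinuousLinearMap.isSelfAdjoint_iff_isSymmetric.mp (hUsa n)
  have hUpos : ∀ n u, 0 ≤ ⟪U n u, u⟫ := fun n u => le_trans (by positivity) (hUα n u)
  have hVsym : ∀ n u v, ⟪Uinv n u, v⟫ = ⟪u, Uinv n v⟫ := fun n u v => by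
    have := hUsym n (Uinv n u) (Uinv n v)
    rw [hUinv₂, hUinv₂] at this
    exact this.symm
  have hVlow : ∀ n u, ‖u‖ ^ 2 ≤ μ * ⟪Uinv n u, u⟫ := fun n u => by
    have := norm_sq_apply_le_of_form_le (U n) (hUsym n) (hUpos n) hμ0 (fun v => by
      calc ⟪U n v, v⟫ ≤ ‖U n v‖ * ‖v‖ := real_inner_le_norm _ _
        _ ≤ μ * ‖v‖ * ‖v‖ := by
          gcongr
          exact (U n).le_of_opNorm_le (hμ.1 ⟨n, rfl⟩) v
        _ = μ * ‖v‖ ^ 2 := by ring) (Uinv n u)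
    rwa [hUinv₂, real_inner_comm] at this
  have hVpos : ∀ n u, 0 ≤ ⟪Uinv n u, u⟫ := fun n u =>
    nonneg_of_mul_nonneg_right ((sq_nonneg ‖u‖).trans (hVlow n u)) hμ0
  have hVup : ∀ n u, ‖Uinv n u‖ ≤ α⁻¹ * ‖u‖ := fun n u => by
    have h1 := hUα n (Uinv n u)
    rw [hUinv₂] at h1
    have h2 := real_inner_le_norm u (Uinv n u)
    rw [le_inv_mul_iff₀ hα]
    by_contra! h
    have h3 : 0 < ‖Uinv n u‖ := by
      refine (norm_nonneg _).lt_of_ne fun h0 => ?_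
      rw [← h0, mul_zero] at h
      exact absurd h (not_lt.mpr (norm_nonneg u))
    have := mul_lt_mul_of_pos_right h h3
    linarith
  have hVmono : ∀ n u, ⟪Uinv (n + 1) u, u⟫ ≤ (1 + η n) * ⟪Uinv n u, u⟫ := fun n =>
    form_inverse_le (hUsym n) (hUpos n) (hUinv₂ n) (hUinv₂ (n + 1))
      (by linarith [hη0 n]) (hUmono n)
  have hVlim : ∀ d, ∃ g, Tendsto (fun n => Uinv n d) atTop (𝓝 g) :=
    exists_tendsto_apply_of_form_le_exp_mul hVsym hVpos (inv_pos.mpr hα) (fun u => by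
      calc ⟪Uinv 0 u, u⟫ ≤ ‖Uinv 0 u‖ * ‖u‖ := real_inner_le_norm _ _
        _ ≤ α⁻¹ * ‖u‖ * ‖u‖ := by gcongr; exact hVup 0 u
        _ = α⁻¹ * ‖u‖ ^ 2 := by ring) hηsum (fun n u => by
      refine (hVmono n u).trans ?_
      gcongr
      · exact hVpos n u
      · linarith [Real.add_one_le_exp (η n)])
  have hprox : ∀ n, f (p n) ≠ ⊤ ∧ ∀ w, f w ≠ ⊤ →
      ⟪Uinv n (x n - p n), w - p n⟫ + gam n * (f (p n)).toReal ≤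
        gam n * (f w).toReal + gam n * ⟪B (x n) + b n, w - p n⟫ := fun n => by
    obtain ⟨h1, h2⟩ := prox_variational_inequality hfbot hfproper hfconv (hVsym n) (hγ0 n) (hp n)
    refine ⟨h1, fun w hw => ?_⟩
    have h3 := h2 w hw
    have h4 : Uinv n (y n - p n) = Uinv n (x n - p n) - gam n • (B (x n) + b n) := by
      rw [hy, sub_right_comm, map_sub, map_smul, hUinv₁]
    rw [h4, inner_sub_left, real_inner_smul_left] at h3
    linarith
  have hSolfin : ∀ z ∈ Sol, f z ≠ ⊤ := fun z hz h => by
    obtain ⟨w, hw⟩ := hfproper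
    rw [hSol] at hz
    have := hz w
    rw [h, EReal.coe_add_top, top_le_iff] at this
    exact hw this
  have hvi : ∀ z ∈ Sol, ∀ n, gam n * ⟪B (x n) - B z + b n, p n - z⟫ ≤
      ⟪Uinv n (x n - p n), p n - z⟫ := fun z hz n => by
    obtain ⟨h1, h2⟩ := hprox n
    have h3 := h2 z (hSolfin z hz)
    have h4 : ((⟪z - p n, B z⟫ : ℝ) : EReal) + f z ≤ f (p n) := by
      rw [hSol] at hz
      exact hz (p n)
    rw [← EReal.coe_toReal h1 (hfbot _), ← EReal.coe_toReal (hSolfin z hz) (hfbot _)] at h4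
    norm_cast at h4
    have h5 := mul_le_mul_of_nonneg_left h4 (hγ0 n).le
    rw [← neg_sub (p n) z] at h3 h5
    rw [inner_neg_right, inner_neg_right] at h3
    rw [inner_neg_left, real_inner_comm] at h5
    rw [sub_add_eq_add_sub, inner_sub_left]
    linarith
  obtain ⟨c, hc, hform⟩ := exists_pos_forward_backward_form_le hβ hμ0 hε0 hεβ
  have hfejer : ∀ z ∈ Sol,
      (∃ l, Tendsto (fun n => ⟪Uinv n (x n - z), x n - z⟫ + 1) atTop (𝓝 l)) ∧
      Tendsto (fun n => ε * (c / 2 * (‖x n - p n‖ ^ 2 + ‖B (x n) - B z‖ ^ 2))) atTop (𝓝 0) := by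
    intro z hz
    set G := (2 * β - ε) / μ with hG
    have hG0 : 0 < G := div_pos (by linarith) hμ0
    set K₁ := G * (1 + μ) + 2 * G ^ 2 / c * ∑' n, ‖b n‖ with hK₁
    set K₂ := α⁻¹ * (1 + μ + ∑' n, ‖a n‖) with hK₂
    have hbsum : 0 ≤ ∑' n, ‖b n‖ := tsum_nonneg fun n => norm_nonneg _
    have hasum : 0 ≤ ∑' n, ‖a n‖ := tsum_nonneg fun n => norm_nonneg _
    have hK₁0 : 0 ≤ K₁ := by positivity
    have hK₂0 : 0 ≤ K₂ := by positivity
    refine tendsto_of_add_le_exp_mul (s := fun n => η n + K₂ * ‖a n‖ + K₁ * ‖b n‖)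
      (fun n => by linarith [hVpos n (x n - z)]) (fun n => by positivity)
      ((hηsum.add (ha.mul_left K₂)).add (hb.mul_left K₁)) fun n => ?_
    set φ := ⟪Uinv n (x n - z), x n - z⟫ with hφ
    have hφ0 : 0 ≤ φ := hVpos n _
    set θ := c / 2 * (‖x n - p n‖ ^ 2 + ‖B (x n) - B z‖ ^ 2) with hθ
    have hθ0 : 0 ≤ θ := by positivity
    obtain ⟨hl0, hl1⟩ := hlam n
    have hbn : ‖b n‖ ≤ ∑' n, ‖b n‖ := hb.le_tsum n fun _ _ => norm_nonneg _
    have han : ‖a n‖ ≤ ∑' n, ‖a n‖ := ha.le_tsum n fun _ _ => norm_nonneg _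
    have hstep : ⟪Uinv n (p n - z), p n - z⟫ + 1 + θ ≤ (1 + K₁ * ‖b n‖) * (φ + 1) := by
      have h1 := forward_backward_form_le (hVsym n) hμ0 (hVlow n) (hγ0 n) hc (e := x n - z)
        (q := p n - z) (D := B (x n) - B z) (b := b n) (hB _ _)
        (hform _ _ _ (hgam n).1 (hgam n).2)
        (by rw [sub_sub_sub_cancel_right]; exact hvi z hz n)
      rw [sub_sub_sub_cancel_right] at h1
      have h2 : gam n * ‖b n‖ * (1 + μ * φ) ≤ G * (1 + μ) * ‖b n‖ * (φ + 1) := by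
        calc gam n * ‖b n‖ * (1 + μ * φ) ≤ G * ‖b n‖ * ((1 + μ) * (φ + 1)) := by
              gcongr
              · exact (hgam n).2
              · linarith
          _ = _ := by ring
      have h3 : 2 * gam n ^ 2 / c * ‖b n‖ ^ 2 ≤
          2 * G ^ 2 / c * (∑' n, ‖b n‖) * ‖b n‖ * (φ + 1) := by
        calc 2 * gam n ^ 2 / c * ‖b n‖ ^ 2
            = 2 * gam n ^ 2 / c * ‖b n‖ * ‖b n‖ * 1 := by ring
          _ ≤ _ := by
              have := (hγ0 n).le
              gcongr
              · exact (hgam n).2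
              · linarith
      rw [hK₁]
      linarith
    have hrelax := relaxation_form_le (hVsym n) hμ0 (hVlow n) (inv_pos.mpr hα).le (hVup n)
      (hε0.le.trans hl0) hl1 (x n - z) (p n - z) (a n)
    have hxz : x n - z + lam n • (p n - z + a n - (x n - z)) = x (n + 1) - z := by
      rw [hx]; module
    rw [hxz] at hrelax
    have hK₁b : 0 ≤ K₁ * ‖b n‖ := by positivity
    have hK₂a : 0 ≤ K₂ * ‖a n‖ := by positivity
    have hconv : (1 - lam n) * φ + lam n * ⟪Uinv n (p n - z), p n - z⟫ + 1 ≤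
        (1 + K₁ * ‖b n‖) * (φ + 1) - ε * θ := by
      have h1 := mul_le_mul_of_nonneg_left hstep (hε0.le.trans hl0)
      have h2 : ε * θ ≤ lam n * θ := by gcongr
      have h3 : 0 ≤ (1 - lam n) * (K₁ * ‖b n‖ * (φ + 1)) :=
        mul_nonneg (by linarith) (by positivity)
      linarith
    have hrelax' : ⟪Uinv n (x (n + 1) - z), x (n + 1) - z⟫ + 1 ≤
        (1 + K₂ * ‖a n‖) * ((1 + K₁ * ‖b n‖) * (φ + 1) - ε * θ) := by
      have hnn : 0 ≤ (1 - lam n) * φ + lam n * ⟪Uinv n (p n - z), p n - z⟫ + 1 := by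
        have h1 : 0 ≤ (1 - lam n) * φ := mul_nonneg (by linarith) hφ0
        have h2 := mul_nonneg (hε0.le.trans hl0) (hVpos n (p n - z))
        linarith
      refine hrelax.trans (mul_le_mul ?_ hconv hnn (by linarith))
      rw [hK₂]
      gcongr
    have hmetric : ⟪Uinv (n + 1) (x (n + 1) - z), x (n + 1) - z⟫ + 1 ≤
        (1 + η n) * ((1 + K₂ * ‖a n‖) * ((1 + K₁ * ‖b n‖) * (φ + 1) - ε * θ)) := by
      have h1 := hVmono n (x (n + 1) - z)
      have h2 := mul_le_mul_of_nonneg_left hrelax' (by linarith [hη0 n] : 0 ≤ 1 + η n)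
      linarith [hη0 n]
    have habsorb : ε * θ ≤ (1 + η n) * (1 + K₂ * ‖a n‖) * (ε * θ) :=
      le_mul_of_one_le_left (by positivity)
        (one_le_mul_of_one_le_of_one_le (by linarith [hη0 n]) (by linarith))
    have hη1 : 0 ≤ 1 + η n := by linarith [hη0 n]
    calc ⟪Uinv (n + 1) (x (n + 1) - z), x (n + 1) - z⟫ + 1 + ε * θ
        ≤ (1 + η n) * (1 + K₂ * ‖a n‖) * (1 + K₁ * ‖b n‖) * (φ + 1) := by linarith
      _ ≤ Real.exp (η n) * Real.exp (K₂ * ‖a n‖) * Real.exp (K₁ * ‖b n‖) * (φ + 1) := by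
          gcongr
          · linarith [Real.add_one_le_exp (η n)]
          · linarith [Real.add_one_le_exp (K₂ * ‖a n‖)]
          · linarith [Real.add_one_le_exp (K₁ * ‖b n‖)]
      _ = Real.exp (η n + K₂ * ‖a n‖ + K₁ * ‖b n‖) * (φ + 1) := by
          rw [Real.exp_add, Real.exp_add]
  have hdist : ∀ z ∈ Sol, ∃ l, Tendsto (fun n => ⟪Uinv n (x n - z), x n - z⟫) atTop (𝓝 l) := by
    intro z hz
    obtain ⟨l, hl⟩ := (hfejer z hz).1
    exact ⟨l - 1, by simpa using hl.sub_const 1⟩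
  obtain ⟨z, hz⟩ := hSolNe
  obtain ⟨R, hR⟩ : ∃ R, ∀ n, ‖x n‖ ≤ R := by
    obtain ⟨l, hl⟩ := hdist z hz
    obtain ⟨M, hM⟩ := hl.bddAbove_range
    refine ⟨√(μ * M) + ‖z‖, fun n => ?_⟩
    have h1 : ‖x n - z‖ ≤ √(μ * M) := by
      refine Real.le_sqrt_of_sq_le ((hVlow n _).trans ?_)
      gcongr
      exact hM ⟨n, rfl⟩
    linarith [norm_sub_norm_le (x n) z]
  have hsq : Tendsto (fun n => ‖x n - p n‖ ^ 2 + ‖B (x n) - B z‖ ^ 2) atTop (𝓝 0) := by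
    have := (hfejer z hz).2.const_mul (ε * (c / 2))⁻¹
    rw [mul_zero] at this
    refine this.congr fun n => ?_
    field_simp
  have hxp : Tendsto (fun n => ‖x n - p n‖) atTop (𝓝 0) := by
    have h1 := squeeze_zero (fun n => sq_nonneg ‖x n - p n‖)
      (fun n => le_add_of_nonneg_right (sq_nonneg ‖B (x n) - B z‖)) hsq
    simpa using h1.sqrt
  have hBx : Tendsto (fun n => B (x n)) atTop (𝓝 (B z)) := by
    have h1 := squeeze_zero (fun n => sq_nonneg ‖B (x n) - B z‖)
      (fun n => le_add_of_nonneg_left (sq_nonneg ‖x n - p n‖)) hsq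
    rw [tendsto_iff_norm_sub_tendsto_zero]
    simpa using h1.sqrt
  obtain ⟨R', hR'⟩ : ∃ R', ∀ n, ‖p n‖ ≤ R' := by
    obtain ⟨M, hM⟩ := hxp.bddAbove_range
    refine ⟨R + M, fun n => ?_⟩
    have h1 : ‖x n - p n‖ ≤ M := hM ⟨n, rfl⟩
    have h2 := norm_sub_norm_le (p n) (x n)
    rw [norm_sub_rev] at h2
    linarith [hR n]
  have hcluster : ∀ (F : Filter ℕ) [F.NeBot], F ≤ atTop → ∀ xb : H,
      (∀ w, Tendsto (fun n => ⟪x n, w⟫) F (𝓝 ⟪xb, w⟫)) → xb ∈ Sol := by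
    intro F _ hF xb hxb
    have hBxb : B xb = B z := eq_of_weak_limit_of_cocoercive hβ hB hR hxb (hBx.mono_left hF)
    have hpb : ∀ w, Tendsto (fun n => ⟪p n, w⟫) F (𝓝 ⟪xb, w⟫) := fun w => by
      have h1 := (tendsto_zero_iff_norm_tendsto_zero.mpr (hxp.mono_left hF)).inner (𝕜 := ℝ)
        (tendsto_const_nhds (x := w))
      simpa [inner_sub_left] using (hxb w).sub h1
    rw [hSol]
    intro w
    by_cases hw : f w = ⊤
    · rw [hw]
      exact le_top
    have hBb : Tendsto (fun n => B (x n) + b n) F (𝓝 (B xb)) := by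
      have h1 := (hBx.add (tendsto_zero_iff_norm_tendsto_zero.mpr
        hb.tendsto_atTop_zero)).mono_left hF
      rwa [add_zero, ← hBxb] at h1
    have hmain : Tendsto (fun n => ⟪w - p n, B (x n) + b n⟫) F (𝓝 ⟪w - xb, B xb⟫) := by
      have := ((tendsto_const_nhds (x := w)).inner hBb).sub
        (tendsto_inner_of_weak_limit hR' hBb hpb)
      simpa [inner_sub_left] using this
    have herr : Tendsto (fun n => (gam n)⁻¹ * ⟪Uinv n (x n - p n), w - p n⟫) F (𝓝 0) := by
      have h1 := (hxp.mono_left hF).const_mul (ε⁻¹ * α⁻¹ * (‖w‖ + R'))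
      rw [mul_zero] at h1
      refine squeeze_zero_norm (fun n => ?_) h1
      rw [norm_mul, norm_inv, Real.norm_of_nonneg (hγ0 n).le]
      calc (gam n)⁻¹ * ‖⟪Uinv n (x n - p n), w - p n⟫‖
          ≤ ε⁻¹ * (α⁻¹ * ‖x n - p n‖ * (‖w‖ + R')) := by
            gcongr
            · exact (hgam n).1
            · refine (norm_inner_le_norm _ _).trans ?_
              gcongr
              · exact hVup n _
              · exact (norm_sub_le _ _).trans (by gcongr; exact hR' n)
        _ = _ := by ring
    have hlim := (hmain.sub herr).const_add (f w).toReal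
    rw [sub_zero] at hlim
    have hle : ∀ n, (f (p n)).toReal ≤ (f w).toReal + (⟪w - p n, B (x n) + b n⟫
        - (gam n)⁻¹ * ⟪Uinv n (x n - p n), w - p n⟫) := fun n => by
      have h1 := (hprox n).2 w hw
      rw [real_inner_comm (w - p n) (B (x n) + b n)] at h1
      refine le_of_mul_le_mul_left ?_ (hγ0 n)
      rw [mul_add, mul_sub, mul_inv_cancel_left₀ (hγ0 n).ne']
      linarith
    have hfxb : f xb ≤ (((f w).toReal + ⟪w - xb, B xb⟫ : ℝ) : EReal) := by
      by_contra! h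
      obtain ⟨r, hr1, hr2⟩ := EReal.lt_iff_exists_real_btwn.mp h
      refine absurd (le_of_weak_limit hflsc hfconv (c := r) ?_ hpb) (not_le.mpr hr2)
      filter_upwards [hlim.eventually_lt_const (EReal.coe_lt_coe_iff.mp hr1)] with n hn
      rw [← EReal.coe_toReal (hprox n).1 (hfbot _)]
      exact_mod_cast (hle n).trans hn.le
    have hxbtop : f xb ≠ ⊤ := (hfxb.trans_lt (EReal.coe_lt_top _)).ne
    rw [← EReal.coe_toReal hxbtop (hfbot _)] at hfxb ⊢
    rw [← EReal.coe_toReal hw (hfbot _)]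
    norm_cast at hfxb ⊢
    rw [← neg_sub w xb, inner_neg_left]
    linarith
  obtain ⟨xb, hxb⟩ := exists_weak_limit_of_norm_le (hyperfilter ℕ) hR
  have hhyper : (hyperfilter ℕ : Filter ℕ) ≤ atTop := Nat.hyperfilter_le_atTop
  have hxbSol := hcluster _ hhyper xb hxb
  refine ⟨xb, hxbSol, fun w => ?_⟩
  rw [tendsto_iff_ultrafilter]
  intro F hF
  obtain ⟨xb', hxb'⟩ := exists_weak_limit_of_norm_le F hR
  have heq := weak_limit_unique_of_tendsto_form hVsym hVlow hVlim hR
    (hdist xb' (hcluster F hF xb' hxb')) (hdist xb hxbSol) hF hhyper hxb' hxb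
  exact heq ▸ hxb' w
end

section
/- Under the strongly monotone composite setup with the range condition, the dual inclusion admits at least one solution; moreover, if (v̄_1,…,v̄_m) is any solution of the dual inclusion and x̂ ∈ H satisfies z − Σ_{j=1}^m L_j* v̄_j − ρ x̂ ∈ A x̂, then x̂ is the unique solution of the primal inclusion. -/
open RealInnerProductSpace

/-- If `A` is monotone, `x` and `y` solve `z ∈ A · + s + ρ ·` with additive terms `s`, `t` that are
monotone along `x - y`, and `ρ > 0`, then `x = y`. -/
theorem eq_of_monotone_add_smul {H : Type*} [NormedAddCommGroup H] [InnerProductSpace ℝ H]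
    {A : H → Set H} (hA : ∀ x y u v : H, u ∈ A x → v ∈ A y → ⟪x - y, u - v⟫ ≥ 0)
    {ρ : ℝ} (hρ : 0 < ρ) {z x y s t : H} (hx : z - s - ρ • x ∈ A x) (hy : z - t - ρ • y ∈ A y)
    (hst : 0 ≤ ⟪x - y, s - t⟫) : x = y := by
  have h := hA _ _ _ _ hx hy
  rw [show z - s - ρ • x - (z - t - ρ • y) = -(s - t) - ρ • (x - y) by
    rw [smul_sub]; abel, inner_sub_right, inner_neg_right, inner_smul_right,
    real_inner_self_eq_norm_sq] at h
  have hsq : ‖x - y‖ ^ 2 = 0 := by nlinarith [sq_nonneg ‖x - y‖]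
  exact sub_eq_zero.mp (norm_eq_zero.mp (pow_eq_zero_iff two_ne_zero |>.mp hsq))

/-- Dual variables lying in parallel sums of monotone operators give a term that is monotone
after composition with the operators `L i` and their adjoints. -/
theorem inner_sum_adjoint_sub_nonneg {ι H : Type*} [Fintype ι]
    [NormedAddCommGroup H] [InnerProductSpace ℝ H] [CompleteSpace H]
    {G : ι → Type*} [∀ i, NormedAddCommGroup (G i)] [∀ i, InnerProductSpace ℝ (G i)]
    [∀ i, CompleteSpace (G i)] {r : ∀ i, G i} {B D : ∀ i, G i → Set (G i)}
    (hB : ∀ i, ∀ x y u v : G i, u ∈ B i x → v ∈ B i y → ⟪x - y, u - v⟫ ≥ 0)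
    (hD : ∀ i, ∀ x y u v : G i, u ∈ D i x → v ∈ D i y → ⟪x - y, u - v⟫ ≥ 0)
    (L : ∀ i, H →L[ℝ] G i) {x y : H} {v w : ∀ i, G i}
    (hv : ∀ i, ∃ p q : G i, v i ∈ B i p ∧ v i ∈ D i q ∧ L i x - r i = p + q)
    (hw : ∀ i, ∃ p q : G i, w i ∈ B i p ∧ w i ∈ D i q ∧ L i y - r i = p + q) :
    0 ≤ ⟪x - y, ∑ i, (ContinuousLinearMap.adjoint (L i)) (v i) -
      ∑ i, (ContinuousLinearMap.adjoint (L i)) (w i)⟫ := by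
  rw [← Finset.sum_sub_distrib, inner_sum]
  refine Finset.sum_nonneg fun i _ => ?_
  obtain ⟨p, q, hp, hq, hpq⟩ := hv i
  obtain ⟨p', q', hp', hq', hpq'⟩ := hw i
  rw [← map_sub, ContinuousLinearMap.adjoint_inner_right, map_sub,
    ← sub_sub_sub_cancel_right (L i x) (L i y) (r i), hpq, hpq', add_sub_add_comm, inner_add_left]
  exact add_nonneg (hB i _ _ _ _ hp hp') (hD i _ _ _ _ hq hq')

/-- **Existence of dual solutions and recovery of the primal solution.**
Under the strongly monotone composite setup with the range condition, the dual
inclusion has at least one solution; and if `(v̄ᵢ)` is any dual solution and `x̂`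
satisfies `z − ∑ⱼ Lⱼ* v̄ⱼ − ρ x̂ ∈ A x̂`, then `x̂` is the unique primal solution. -/
theorem strongly_monotone_dual_exists_primal_recovery
    {H : Type*} [NormedAddCommGroup H] [InnerProductSpace ℝ H] [CompleteSpace H]
    {m : ℕ} (hm : 0 < m)
    (G : Fin m → Type*) [∀ i, NormedAddCommGroup (G i)] [∀ i, InnerProductSpace ℝ (G i)]
    [∀ i, CompleteSpace (G i)]
    (z : H) (ρ : ℝ) (hρ : 0 < ρ)
    (A : H → Set H)
    (hAmono : ∀ x y u v : H, u ∈ A x → v ∈ A y → ⟪x - y, u - v⟫ ≥ 0)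
    (hAmax : ∀ y v : H, (∀ x u : H, u ∈ A x → ⟪x - y, u - v⟫ ≥ 0) → v ∈ A y)
    (r : ∀ i, G i)
    (Bop : ∀ i, G i → Set (G i))
    (hBmono : ∀ i, ∀ x y u v : G i, u ∈ Bop i x → v ∈ Bop i y → ⟪x - y, u - v⟫ ≥ 0)
    (hBmax : ∀ i, ∀ y v : G i, (∀ x u : G i, u ∈ Bop i x → ⟪x - y, u - v⟫ ≥ 0) → v ∈ Bop i y)
    (ν : Fin m → ℝ) (hν : ∀ i, 0 < ν i)
    (D : ∀ i, G i → Set (G i))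
    (hDstrong : ∀ i, ∀ x y u v : G i, u ∈ D i x → v ∈ D i y →
      ⟪x - y, u - v⟫ ≥ ν i * ‖x - y‖ ^ 2)
    (hDmax : ∀ i, ∀ y v : G i, (∀ x u : G i, u ∈ D i x → ⟪x - y, u - v⟫ ≥ 0) → v ∈ D i y)
    (L : ∀ i, H →L[ℝ] G i) (hL : ∀ i, L i ≠ 0)
    (PrimalSol : H → Prop)
    (hPrimal : ∀ xb : H, PrimalSol xb ↔
      ∃ a ∈ A xb, ∃ w : (i : Fin m) → G i,
        (∀ i, ∃ p q : G i, w i ∈ Bop i p ∧ w i ∈ D i q ∧ L i xb - r i = p + q) ∧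
        z = a + ∑ i, (ContinuousLinearMap.adjoint (L i)) (w i) + ρ • xb)
    (hrange : ∃ xb : H, PrimalSol xb)
    (DualSol : ((i : Fin m) → G i) → Prop)
    (hDual : ∀ v : (i : Fin m) → G i, DualSol v ↔
      ∃ x : H, (z - ∑ j, (ContinuousLinearMap.adjoint (L j)) (v j) - ρ • x ∈ A x) ∧
        ∀ i, ∃ p q : G i, v i ∈ Bop i p ∧ v i ∈ D i q ∧ r i = L i x - p - q) :
    (∃ v : (i : Fin m) → G i, DualSol v) ∧
    ∀ v : (i : Fin m) → G i, DualSol v →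
      ∀ xh : H, z - ∑ j, (ContinuousLinearMap.adjoint (L j)) (v j) - ρ • xh ∈ A xh →
        PrimalSol xh ∧ ∀ x' : H, PrimalSol x' → x' = xh := by
  have hDmono : ∀ i, ∀ x y u v : G i, u ∈ D i x → v ∈ D i y → ⟪x - y, u - v⟫ ≥ 0 :=
    fun i x y u v hu hv =>
      (mul_nonneg (hν i).le (sq_nonneg ‖x - y‖)).trans (hDstrong i x y u v hu hv)
  constructor
  · obtain ⟨xb, hxb⟩ := hrange
    obtain ⟨a, ha, w, hw, hz⟩ := (hPrimal xb).mp hxb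
    refine ⟨w, (hDual w).mpr ⟨xb, ?_, fun i => ?_⟩⟩
    · convert ha using 1
      rw [hz]
      abel
    · obtain ⟨p, q, hp, hq, hpq⟩ := hw i
      exact ⟨p, q, hp, hq, by rw [sub_sub, ← hpq, sub_sub_cancel]⟩
  · intro v hv xh hxh
    obtain ⟨x, hx, hpq⟩ := (hDual v).mp hv
    obtain rfl : x = xh := eq_of_monotone_add_smul hAmono hρ hx hxh (by simp)
    have hvx : ∀ i, ∃ p q : G i, v i ∈ Bop i p ∧ v i ∈ D i q ∧ L i x - r i = p + q := fun i => by
      obtain ⟨p, q, hp, hq, h⟩ := hpq i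
      exact ⟨p, q, hp, hq, by rw [h]; abel⟩
    refine ⟨(hPrimal x).mpr ⟨_, hx, v, hvx, by abel⟩, fun x' hx' => ?_⟩
    obtain ⟨a, ha, w, hw, hz⟩ := (hPrimal x').mp hx'
    refine eq_of_monotone_add_smul hAmono hρ ?_ hx
      (inner_sum_adjoint_sub_nonneg hBmono hDmono L hw hvx)
    convert ha using 1
    rw [hz]
    abel
end

section
/- Under the strongly monotone composite setup with the range condition, suppose: β := 1/(max_{1≤i≤m}(1/ν_i) + ρ⁻¹ Σ_{i=1}^m ‖L_i‖²); (a_n) is a sequence in H with Σ‖a_n‖ < ∞; α > 0; (η_n) is a summable sequence in [0,∞); for each i, (b_{i,n}) and (d_{i,n}) are sequences in G_i with Σ‖b_{i,n}‖ < ∞ and Σ‖d_{i,n}‖ < ∞, and (U_{i,n})_n is a sequence in P_α(G_i) with μ := max_i sup_n ‖U_{i,n}‖ < ∞ and (1+η_n)⟪U_{i,n+1}v, v⟫ ≥ ⟪U_{i,n}v, v⟫ for all n, v; ε ∈ (0, min{1, 2β/(μ+1)}]; (λ_n) is a sequence in [ε,1]; (γ_n) is a sequence in [ε,(2β−ε)/μ].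 Suppose the sequences (x_n) in H and (v_{i,n}) in G_i satisfy, for every n: with s_n := z − Σ_i L_i* v_{i,n}, x_n = c_n + a_n where c_n is the point with s_n − ρ c_n ∈ A c_n; for each i: t_{i,n} is a point with v_{i,n} ∈ D_i t_{i,n}; w_{i,n} = v_{i,n} + γ_n U_{i,n}(L_i x_n − r_i − t_{i,n} − d_{i,n}); and v_{i,n+1} = v_{i,n} + λ_n(e_{i,n} + b_{i,n} − v_{i,n}) where e_{i,n} satisfies: there exists u with e_{i,n} ∈ B_i u and w_{i,n} − e_{i,n} = γ_n U_{i,n} u. Then: the primal inclusion has a unique solution x̄; there exists a solution (v̄_1,…,v̄_m) of the dual inclusion such that v_{i,n} ⇀ v̄_i weakly for every i; x̄ satisfies z − Σ_i L_i* v̄_i − ρ x̄ ∈ A x̄; and x_n → x̄ strongly. -/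
open RealInnerProductSpace Filter Topology

theorem summable_mul_of_nonneg {f g : ℕ → ℝ} (hf : Summable f) (hg : Summable g)
    (hf0 : ∀ n, 0 ≤ f n) (hg0 : ∀ n, 0 ≤ g n) : Summable fun n => f n * g n :=
  Summable.of_nonneg_of_le (fun n => mul_nonneg (hf0 n) (hg0 n))
    (fun n => mul_le_mul_of_nonneg_left (hg.le_tsum n fun k _ => hg0 k) (hf0 n))
    (hf.mul_right (∑' k, g k))

theorem one_le_prod_one_add {ζ : ℕ → ℝ} (hζ0 : ∀ n, 0 ≤ ζ n) (n : ℕ) :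
    1 ≤ ∏ k ∈ Finset.range n, (1 + ζ k) :=
  Finset.one_le_prod fun k _ => by linarith [hζ0 k]

theorem exists_tendsto_prod_one_add {ζ : ℕ → ℝ} (hζ0 : ∀ n, 0 ≤ ζ n) (hζ : Summable ζ) :
    ∃ P : ℝ, 1 ≤ P ∧ Tendsto (fun n => ∏ k ∈ Finset.range n, (1 + ζ k)) atTop (𝓝 P) := by
  have h := (Real.multipliable_one_add_of_summable hζ).hasProd.tendsto_prod_nat
  exact ⟨_, ge_of_tendsto' h (one_le_prod_one_add hζ0), h⟩

/-- A deterministic Robbins–Siegmund lemma. -/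
theorem exists_tendsto_of_add_le_one_add_mul_add {a s ζ θ : ℕ → ℝ} (ha : ∀ n, 0 ≤ a n)
    (hs : ∀ n, 0 ≤ s n) (hζ0 : ∀ n, 0 ≤ ζ n) (hθ0 : ∀ n, 0 ≤ θ n) (hζ : Summable ζ)
    (hθ : Summable θ) (h : ∀ n, a (n + 1) + s n ≤ (1 + ζ n) * a n + θ n) :
    (∃ l, Tendsto a atTop (𝓝 l)) ∧ Tendsto s atTop (𝓝 0) := by
  obtain ⟨P, -, hP⟩ := exists_tendsto_prod_one_add hζ0 hζ
  set p : ℕ → ℝ := fun n => ∏ k ∈ Finset.range n, (1 + ζ k) with hp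
  have hp1 : ∀ n, 1 ≤ p n := one_le_prod_one_add hζ0
  have hp0 : ∀ n, 0 < p n := fun n => by linarith [hp1 n]
  have hps : ∀ n, p (n + 1) = p n * (1 + ζ n) := fun n => Finset.prod_range_succ _ _
  have hanti : Antitone fun n => a n / p n - ∑ k ∈ Finset.range n, θ k := by
    refine antitone_nat_of_succ_le fun n => ?_
    have h2 : a (n + 1) / p (n + 1) ≤ a n / p n + θ n := by
      rw [div_le_iff₀ (hp0 _)]
      have h3 : (a n / p n + θ n) * p (n + 1) = (1 + ζ n) * a n + θ n * p (n + 1) := by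
        rw [hps]; field_simp [(hp0 n).ne']
      rw [h3]
      nlinarith [h n, hs n, mul_le_mul_of_nonneg_left (hp1 (n + 1)) (hθ0 n)]
    rw [Finset.sum_range_succ]
    linarith
  have hbdd : BddBelow (Set.range fun n => a n / p n - ∑ k ∈ Finset.range n, θ k) := by
    refine ⟨-∑' k, θ k, ?_⟩
    rintro _ ⟨n, rfl⟩
    have := hθ.sum_le_tsum (Finset.range n) (fun k _ => hθ0 k)
    have := div_nonneg (ha n) (hp0 n).le
    linarith
  have hl : ∃ l, Tendsto a atTop (𝓝 l) := by
    have := ((tendsto_atTop_ciInf hanti hbdd).add hθ.hasSum.tendsto_sum_nat).mul hP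
    refine ⟨_, this.congr fun n => ?_⟩
    have := (hp0 n).ne'
    field_simp
    ring
  refine ⟨hl, ?_⟩
  obtain ⟨l, hl⟩ := hl
  have h4 : Tendsto (fun n => (1 + ζ n) * a n + θ n - a (n + 1)) atTop (𝓝 0) := by
    have := (((hζ.tendsto_atTop_zero.const_add 1).mul hl).add hθ.tendsto_atTop_zero).sub
      ((tendsto_add_atTop_iff_nat 1).2 hl)
    simpa using this
  exact squeeze_zero hs (fun n => by linarith [h n]) h4

section Metric

variable {K : Type*} [NormedAddCommGroup K] [InnerProductSpace ℝ K]

theorem norm_sq_le_mul_inner_of_form_le {R : K →L[ℝ] K} (hsym : ∀ x y, ⟪R x, y⟫ = ⟪x, R y⟫)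
    (h0 : ∀ x, 0 ≤ ⟪R x, x⟫) {C : ℝ} (hC : 0 < C) (h : ∀ x, ⟪R x, x⟫ ≤ C * ‖x‖ ^ 2) (x : K) :
    ‖R x‖ ^ 2 ≤ C * ⟪R x, x⟫ := by
  have h1 := h0 (C • x - R x)
  have h2 := h (R x)
  simp only [map_sub, map_smul, inner_sub_left, inner_sub_right, real_inner_smul_left,
    real_inner_smul_right, hsym (R x) x, real_inner_self_eq_norm_sq] at h1
  have h3 : 0 ≤ C * (C * ⟪R x, x⟫ - ‖R x‖ ^ 2) := by nlinarith
  have := nonneg_of_mul_nonneg_right h3 hC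
  linarith

theorem exists_inverse_of_form_bounds [CompleteSpace K] {U : K →L[ℝ] K}
    (hsym : ∀ x y, ⟪U x, y⟫ = ⟪x, U y⟫) {α μ : ℝ} (hα : 0 < α) (hμ : 0 < μ)
    (hlow : ∀ x, α * ‖x‖ ^ 2 ≤ ⟪U x, x⟫) (hup : ∀ x, ⟪U x, x⟫ ≤ μ * ‖x‖ ^ 2) :
    ∃ W : K →L[ℝ] K, (∀ x, U (W x) = x) ∧ (∀ x, W (U x) = x) ∧
      (∀ x y, ⟪W x, y⟫ = ⟪x, W y⟫) ∧ (∀ x, ‖x‖ ^ 2 ≤ μ * ⟪W x, x⟫) ∧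
      (∀ x, ⟪W x, x⟫ ≤ α⁻¹ * ‖x‖ ^ 2) := by
  have h0 : ∀ x, 0 ≤ ⟪U x, x⟫ := fun x => le_trans (by positivity) (hlow x)
  have hu : IsUnit U := by
    refine ContinuousLinearMap.isUnit_of_forall_le_norm_inner_map U (c := ⟨α, hα.le⟩)
      (by exact_mod_cast hα) fun x => ?_
    rw [Real.norm_eq_abs, abs_of_nonneg (h0 x), mul_comm]
    exact hlow x
  obtain ⟨u, rfl⟩ := hu
  have hUW : ∀ x, (u : K →L[ℝ] K) ((↑u⁻¹ : K →L[ℝ] K) x) = x := fun x => by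
    rw [← mul_apply_eq_comp, Units.mul_inv]; rfl
  have hWU : ∀ x, (↑u⁻¹ : K →L[ℝ] K) ((u : K →L[ℝ] K) x) = x := fun x => by
    rw [← mul_apply_eq_comp, Units.inv_mul]; rfl
  refine ⟨(↑u⁻¹ : K →L[ℝ] K), hUW, hWU, fun x y => ?_, fun x => ?_, fun x => ?_⟩
  · conv_lhs => rw [← hUW y, ← hsym, hUW]
  · have := norm_sq_le_mul_inner_of_form_le hsym h0 hμ hup ((↑u⁻¹ : K →L[ℝ] K) x)
    rwa [hUW, real_inner_comm] at this
  · set y := (↑u⁻¹ : K →L[ℝ] K) x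
    have h1 := hlow y
    have h2 : ⟪(u : K →L[ℝ] K) y, y⟫ ≤ ‖x‖ * ‖y‖ := by
      rw [hUW]; exact real_inner_le_norm _ _
    rw [hUW, real_inner_comm] at h1 h2
    rw [inv_mul_eq_div, le_div_iff₀ hα]
    nlinarith [sq_nonneg (‖x‖ - α * ‖y‖)]

theorem inverse_form_le {U V W W' : K →L[ℝ] K} (hsym : ∀ x y, ⟪U x, y⟫ = ⟪x, U y⟫)
    (h0 : ∀ x, 0 ≤ ⟪U x, x⟫) (hUW : ∀ x, U (W x) = x) (hVW : ∀ x, V (W' x) = x) {c : ℝ}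
    (hc : 0 < c) (h : ∀ x, ⟪U x, x⟫ ≤ c * ⟪V x, x⟫) (x : K) :
    ⟪W' x, x⟫ ≤ c * ⟪W x, x⟫ := by
  have h1 := h0 (c • W x - W' x)
  have h2 := h (W' x)
  have h3 : ⟪U (W' x), W x⟫ = ⟪W' x, x⟫ := by rw [hsym, hUW]
  simp only [map_sub, map_smul, hUW, inner_sub_left, inner_sub_right, real_inner_smul_left,
    real_inner_smul_right, h3] at h1
  rw [hVW] at h2
  rw [real_inner_comm (W x), real_inner_comm (W' x)] at *
  have h3 : 0 ≤ c * (c * ⟪W x, x⟫ - ⟪W' x, x⟫) := by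
    simp only [real_inner_comm] at *
    nlinarith
  have := nonneg_of_mul_nonneg_right h3 hc
  linarith

theorem exists_tendsto_apply_of_form_succ_le [CompleteSpace K] {W : ℕ → K →L[ℝ] K} {η : ℕ → ℝ}
    (hη0 : ∀ n, 0 ≤ η n) (hη : Summable η) (hsym : ∀ n x y, ⟪W n x, y⟫ = ⟪x, W n y⟫)
    (h0 : ∀ n x, 0 ≤ ⟪W n x, x⟫) {C : ℝ} (hC : 0 < C) (hup : ∀ n x, ⟪W n x, x⟫ ≤ C * ‖x‖ ^ 2)
    (h : ∀ n x, ⟪W (n + 1) x, x⟫ ≤ (1 + η n) * ⟪W n x, x⟫) (x : K) :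
    ∃ y, Tendsto (fun n => W n x) atTop (𝓝 y) := by
  obtain ⟨P, -, hP⟩ := exists_tendsto_prod_one_add hη0 hη
  set p : ℕ → ℝ := fun n => ∏ k ∈ Finset.range n, (1 + η k) with hp
  have hp1 : ∀ n, 1 ≤ p n := one_le_prod_one_add hη0
  have hp0 : ∀ n, 0 < p n := fun n => by linarith [hp1 n]
  have hps : ∀ n, p (n + 1) = p n * (1 + η n) := fun n => Finset.prod_range_succ _ _
  set T : ℕ → K →L[ℝ] K := fun n => (p n)⁻¹ • W n with hT
  have hTf : ∀ n x, ⟪T n x, x⟫ = (p n)⁻¹ * ⟪W n x, x⟫ := fun n x => by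
    simp [hT, real_inner_smul_left]
  have hT0 : ∀ n x, 0 ≤ ⟪T n x, x⟫ := fun n x => by
    rw [hTf]; exact mul_nonneg (inv_nonneg.2 (hp0 n).le) (h0 n x)
  have hanti : ∀ x, Antitone fun n => ⟪T n x, x⟫ := fun x => by
    refine antitone_nat_of_succ_le fun n => ?_
    rw [hTf, hTf, hps, inv_mul_eq_div, inv_mul_eq_div,
      div_le_div_iff₀ (mul_pos (hp0 n) (by linarith [hη0 n])) (hp0 n)]
    nlinarith [mul_le_mul_of_nonneg_left (h n x) (hp0 n).le]
  have hTC : ∀ n x, ⟪T n x, x⟫ ≤ C * ‖x‖ ^ 2 := fun n x => by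
    refine le_trans ?_ (hup n x)
    rw [hTf]
    exact mul_le_of_le_one_left (h0 n x) (inv_le_one_of_one_le₀ (hp1 n))
  have hdiff : ∀ n k, n ≤ k → ‖T n x - T k x‖ ^ 2 ≤ C * (⟪T n x, x⟫ - ⟪T k x, x⟫) := by
    intro n k hnk
    have := norm_sq_le_mul_inner_of_form_le (R := T n - T k) (C := C)
      (fun x y => by simp [hT, inner_sub_left, inner_sub_right, real_inner_smul_left,
        real_inner_smul_right, hsym])
      (fun x => by
        rw [sub_apply, inner_sub_left]; linarith [hanti x hnk]) hC
      (fun x => by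
        rw [sub_apply, inner_sub_left]; linarith [hTC n x, hT0 k x]) x
    simpa [inner_sub_left] using this
  have hcau : CauchySeq fun n => T n x := by
    have hlim := tendsto_atTop_ciInf (hanti x) ⟨0, by rintro _ ⟨n, rfl⟩; exact hT0 n x⟩
    set l := ⨅ n, ⟪T n x, x⟫
    have hle : ∀ n, l ≤ ⟪T n x, x⟫ := fun n =>
      (hanti x).le_of_tendsto hlim n
    refine cauchySeq_of_le_tendsto_0' (fun n => √(C * (⟪T n x, x⟫ - l))) (fun n k hnk => ?_) ?_
    · rw [dist_eq_norm]
      refine Real.le_sqrt_of_sq_le ((hdiff n k hnk).trans ?_)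
      exact mul_le_mul_of_nonneg_left (by linarith [hle k]) hC.le
    · have := ((hlim.sub_const l).const_mul C).sqrt
      simpa using this
  obtain ⟨y, hy⟩ := cauchySeq_tendsto_of_complete hcau
  refine ⟨P • y, (hP.smul hy).congr fun n => ?_⟩
  simp [hT, smul_smul, mul_inv_cancel₀ (hp0 n).ne']

theorem exists_weak_limit_of_bounded [CompleteSpace K] {v : ℕ → K} {C : ℝ}
    (hv : ∀ n, ‖v n‖ ≤ C) (F : Ultrafilter ℕ) :
    ∃ y, ∀ w, Tendsto (fun n => ⟪v n, w⟫) F (𝓝 ⟪y, w⟫) := by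
  set f : ℕ → WeakDual ℝ K := fun n => StrongDual.toWeakDual (InnerProductSpace.toDual ℝ K (v n))
  have hc := WeakDual.isCompact_closedBall (𝕜 := ℝ) (0 : StrongDual ℝ K) C
  obtain ⟨φ, -, hφ⟩ := hc.ultrafilter_le_nhds (F.map f) (by
    rw [le_principal_iff, Ultrafilter.mem_coe, Ultrafilter.mem_map]
    refine Filter.univ_mem' fun n => ?_
    simpa [f] using hv n)
  refine ⟨(InnerProductSpace.toDual ℝ K).symm (WeakDual.toStrongDual φ), fun w => ?_⟩
  have h1 : Tendsto f F (𝓝 φ) := hφ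
  have := ((WeakDual.eval_continuous w).tendsto φ).comp h1
  rw [InnerProductSpace.toDual_symm_apply]
  exact this

theorem tendsto_inner_const_of_tendsto {F : Filter ℕ} {x : ℕ → K} {x' : K}
    (hx : Tendsto x F (𝓝 x')) (w : K) : Tendsto (fun n => ⟪x n, w⟫) F (𝓝 ⟪x', w⟫) :=
  Filter.Tendsto.inner hx tendsto_const_nhds

theorem tendsto_inner_of_strong_weak {F : Filter ℕ} {x u : ℕ → K} {x' u' : K} {C : ℝ}
    (hx : Tendsto x F (𝓝 x')) (hu : ∀ w, Tendsto (fun n => ⟪u n, w⟫) F (𝓝 ⟪u', w⟫))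
    (hb : ∀ n, ‖u n‖ ≤ C) : Tendsto (fun n => ⟪x n, u n⟫) F (𝓝 ⟪x', u'⟫) := by
  have h1 : Tendsto (fun n => ⟪x n - x', u n⟫) F (𝓝 0) := by
    have h2 : Tendsto (fun n => ‖x n - x'‖ * C) F (𝓝 0) := by
      simpa using (tendsto_iff_norm_sub_tendsto_zero.1 hx).mul_const C
    refine squeeze_zero_norm (fun n => ?_) h2
    exact (norm_inner_le_norm _ _).trans (mul_le_mul_of_nonneg_left (hb n) (norm_nonneg _))
  have h3 := h1.add (hu x')
  rw [zero_add] at h3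
  rw [real_inner_comm]
  refine h3.congr fun n => ?_
  rw [inner_sub_left, real_inner_comm x' (u n)]
  ring

theorem mem_of_strong_weak_limit {F : Filter ℕ} [F.NeBot] {M : K → Set K}
    (hmono : ∀ x y u v : K, u ∈ M x → v ∈ M y → ⟪x - y, u - v⟫ ≥ 0)
    (hmax : ∀ y v : K, (∀ x u : K, u ∈ M x → ⟪x - y, u - v⟫ ≥ 0) → v ∈ M y)
    {x u : ℕ → K} {x' u' : K} {C : ℝ}
    (hx : Tendsto x F (𝓝 x')) (hu : ∀ w, Tendsto (fun n => ⟪u n, w⟫) F (𝓝 ⟪u', w⟫))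
    (hb : ∀ n, ‖u n‖ ≤ C) (hmem : ∀ n, u n ∈ M (x n)) : u' ∈ M x' := by
  refine hmax _ _ fun y w hw => ?_
  have h1 := tendsto_inner_of_strong_weak hx hu hb
  have h2 : Tendsto (fun n => ⟪y - x n, w - u n⟫) F (𝓝 ⟪y - x', w - u'⟫) := by
    have h3 := ((h1.sub (hu y)).sub (tendsto_inner_const_of_tendsto hx w)).add_const ⟪y, w⟫
    have e : ∀ p q : K, ⟪y - p, w - q⟫ = ⟪p, q⟫ - ⟪q, y⟫ - ⟪p, w⟫ + ⟪y, w⟫ := fun p q => by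
      rw [inner_sub_left, inner_sub_right, inner_sub_right, real_inner_comm y q]; ring
    simp only [e]
    exact h3
  exact ge_of_tendsto' h2 fun n => hmono _ _ _ _ hw (hmem n)

/-- Opial's lemma with respect to a convergent sequence of metrics. -/
theorem exists_weak_limit_of_variable_metric [CompleteSpace K] {W : ℕ → K →L[ℝ] K}
    (hsym : ∀ n x y, ⟪W n x, y⟫ = ⟪x, W n y⟫) {μ : ℝ}
    (hlow : ∀ n x, ‖x‖ ^ 2 ≤ μ * ⟪W n x, x⟫)
    (hW : ∀ x, ∃ y, Tendsto (fun n => W n x) atTop (𝓝 y)) {v : ℕ → K} {C : ℝ}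
    (hv : ∀ n, ‖v n‖ ≤ C) {S : Set K}
    (hS : ∀ y ∈ S, ∃ l, Tendsto (fun n => ⟪W n (v n - y), v n - y⟫) atTop (𝓝 l))
    (hcl : ∀ F : Ultrafilter ℕ, (F : Filter ℕ) ≤ atTop → ∀ y,
      (∀ w, Tendsto (fun n => ⟪v n, w⟫) F (𝓝 ⟪y, w⟫)) → y ∈ S) :
    ∃ y ∈ S, ∀ w, Tendsto (fun n => ⟪v n, w⟫) atTop (𝓝 ⟪y, w⟫) := by
  obtain ⟨y, hy⟩ := exists_weak_limit_of_bounded hv (Ultrafilter.of atTop)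
  have hyS := hcl _ (Ultrafilter.of_le _) y hy
  refine ⟨y, hyS, fun w => ?_⟩
  refine (tendsto_iff_ultrafilter _ _ _).2 fun F hF => ?_
  obtain ⟨y', hy'⟩ := exists_weak_limit_of_bounded hv F
  have hyS' := hcl _ hF y' hy'
  suffices hyy : y' = y by rw [← hyy]; exact hy' w
  obtain ⟨l, hl⟩ := hS y hyS
  obtain ⟨l', hl'⟩ := hS y' hyS'
  obtain ⟨q, hq⟩ := hW (y' - y)
  obtain ⟨o, ho⟩ := hW y
  obtain ⟨o', ho'⟩ := hW y'
  have hlim : Tendsto (fun n => ⟪W n (y' - y), v n⟫) atTop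
      (𝓝 ((l - l' - ⟪o, y⟫ + ⟪o', y'⟫) / 2)) := by
    have := ((((hl.sub hl').sub (tendsto_inner_const_of_tendsto ho y)).add
      (tendsto_inner_const_of_tendsto ho' y')).div_const 2)
    refine this.congr fun n => ?_
    have e1 : ⟪W n (v n), y⟫ = ⟪W n y, v n⟫ := by rw [hsym, real_inner_comm]
    have e2 : ⟪W n (v n), y'⟫ = ⟪W n y', v n⟫ := by rw [hsym, real_inner_comm]
    simp only [map_sub, inner_sub_left, inner_sub_right, e1, e2]
    ring
  have k1 := tendsto_nhds_unique (hlim.mono_left (Ultrafilter.of_le _))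
    (tendsto_inner_of_strong_weak (hq.mono_left (Ultrafilter.of_le _)) hy hv)
  have k2 := tendsto_nhds_unique (hlim.mono_left hF)
    (tendsto_inner_of_strong_weak (hq.mono_left hF) hy' hv)
  have k3 : ⟪q, y' - y⟫ = 0 := by rw [inner_sub_right]; linarith
  have k4 : ‖y' - y‖ ^ 2 ≤ μ * ⟪q, y' - y⟫ :=
    ge_of_tendsto' ((tendsto_inner_const_of_tendsto hq (y' - y)).const_mul μ)
      fun n => hlow n _
  rw [k3, mul_zero] at k4
  have : ‖y' - y‖ = 0 := by nlinarith [norm_nonneg (y' - y)]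
  exact sub_eq_zero.1 (norm_eq_zero.1 this)

theorem forward_backward_form_le_s16 {U W : K →L[ℝ] K}
    (hWsym : ∀ x y, ⟪W x, y⟫ = ⟪x, W y⟫) (hWU : ∀ x, W (U x) = x)
    {μ β ε γ : ℝ} (hup : ∀ x, ⟪U x, x⟫ ≤ μ * ‖x‖ ^ 2)
    (hlow : ∀ x, ‖x‖ ^ 2 ≤ μ * ⟪W x, x⟫) (hμ : 0 < μ) (hε : 0 < ε) (hγ : ε ≤ γ)
    (hγμ : γ * μ ≤ 2 * β - ε) {y f δ k err : K} (hf : f = γ • U k)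
    (hmono : 0 ≤ ⟪y - f, k - err - δ⟫) (hcoc : β * ‖δ‖ ^ 2 ≤ ⟪y, δ⟫) :
    ⟪W (y - f), y - f⟫ + (⟪W (f - γ • U δ), f - γ • U δ⟫ + ε ^ 2 * ‖δ‖ ^ 2) ≤
      (1 + μ * (γ * ‖err‖)) * ⟪W y, y⟫ +
        (γ * ‖err‖ + μ ^ 2 * (γ * ‖err‖) ^ 3 + 2 * μ * (γ * ‖err‖) ^ 2) := by
  have hγ0 : 0 < γ := hε.trans_le hγ
  set h := ‖y - f‖ with hh
  set τ := γ * ‖err‖ with hτ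
  have hτ0 : 0 ≤ τ := by positivity
  have hWf : W f = γ • k := by rw [hf, map_smul, hWU]
  have e1 : ⟪W (y - f), y - f⟫ = ⟪W y, y⟫ - 2 * γ * ⟪y - f, k⟫ - ⟪W f, f⟫ := by
    have : ⟪W y, f⟫ = γ * ⟪y, k⟫ := by rw [hWsym, hWf, real_inner_smul_right]
    simp only [map_sub, inner_sub_left, inner_sub_right, this, hWf, real_inner_smul_left,
      real_inner_comm y k, real_inner_comm f k]
    ring
  have e2 : ⟪W (f - γ • U δ), f - γ • U δ⟫ =
      ⟪W f, f⟫ - 2 * γ * ⟪f, δ⟫ + γ ^ 2 * ⟪U δ, δ⟫ := by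
    have : ⟪W f, U δ⟫ = ⟪f, δ⟫ := by rw [hWsym, hWU]
    simp only [map_sub, map_smul, hWU, inner_sub_left, inner_sub_right, real_inner_smul_left,
      real_inner_smul_right, this, real_inner_comm f δ, real_inner_comm (U δ) δ]
    ring
  have e3 : ⟪y - f, k - err - δ⟫ = ⟪y - f, k⟫ - ⟪y - f, err⟫ - (⟪y, δ⟫ - ⟪f, δ⟫) := by
    rw [inner_sub_right, inner_sub_right, inner_sub_left y f δ]
  have e4 : -⟪y - f, err⟫ ≤ h * ‖err‖ := by
    have := abs_real_inner_le_norm (y - f) err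
    linarith [neg_abs_le ⟪y - f, err⟫]
  have e5 : γ ^ 2 * ⟪U δ, δ⟫ ≤ 2 * γ * (β * ‖δ‖ ^ 2) - ε ^ 2 * ‖δ‖ ^ 2 := by
    have h1 : γ ^ 2 * ⟪U δ, δ⟫ ≤ γ ^ 2 * (μ * ‖δ‖ ^ 2) :=
      mul_le_mul_of_nonneg_left (hup δ) (sq_nonneg _)
    have h2 : γ * (γ * μ) * ‖δ‖ ^ 2 ≤ γ * (2 * β - ε) * ‖δ‖ ^ 2 := by gcongr
    have h3 : ε * ε * ‖δ‖ ^ 2 ≤ γ * ε * ‖δ‖ ^ 2 := by gcongr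
    linarith
  have e6 : ⟪W (y - f), y - f⟫ + (⟪W (f - γ • U δ), f - γ • U δ⟫ + ε ^ 2 * ‖δ‖ ^ 2) ≤
      ⟪W y, y⟫ + 2 * τ * h := by
    rw [e3] at hmono
    have h1 := mul_nonneg hγ0.le hmono
    have h2 := mul_le_mul_of_nonneg_left e4 hγ0.le
    have h3 := mul_le_mul_of_nonneg_left hcoc hγ0.le
    rw [e1, e2, hτ]
    linarith
  have hpos : 0 ≤ ⟪W (f - γ • U δ), f - γ • U δ⟫ :=
    nonneg_of_mul_nonneg_right ((sq_nonneg _).trans (hlow _)) hμ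
  have e7 : h ^ 2 ≤ μ * (⟪W y, y⟫ + 2 * τ * h) :=
    (hlow _).trans (mul_le_mul_of_nonneg_left (by nlinarith [sq_nonneg (ε * ‖δ‖)]) hμ.le)
  have e8 : 2 * (h - μ * τ) ≤ 1 + (μ * ⟪W y, y⟫ + μ ^ 2 * τ ^ 2) := by
    nlinarith [sq_nonneg (h - μ * τ - 1)]
  nlinarith [mul_le_mul_of_nonneg_left e8 hτ0]

theorem relaxed_form_le {W : K →L[ℝ] K} (hsym : ∀ x y, ⟪W x, y⟫ = ⟪x, W y⟫)
    (h0 : ∀ x, 0 ≤ ⟪W x, x⟫) {C : ℝ} (hup : ∀ x, ⟪W x, x⟫ ≤ C * ‖x‖ ^ 2) {l : ℝ}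
    (hl0 : 0 ≤ l) (hl1 : l ≤ 1) (y f b : K) :
    ⟪W (y + l • (b - f)), y + l • (b - f)⟫ ≤
      (1 + ‖b‖) * ((1 - l) * ⟪W y, y⟫ + l * ⟪W (y - f), y - f⟫) + C * (‖b‖ + ‖b‖ ^ 2) := by
  set q := y - l • f with hq
  have e0 : y + l • (b - f) = q + l • b := by rw [hq, smul_sub]; abel
  have e1 : ⟪W q, q⟫ ≤ (1 - l) * ⟪W y, y⟫ + l * ⟪W (y - f), y - f⟫ := by
    have h1 : ⟪W f, y⟫ = ⟪W y, f⟫ := by rw [hsym, real_inner_comm]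
    have h2 := mul_nonneg (mul_nonneg hl0 (sub_nonneg.2 hl1)) (h0 f)
    simp only [hq, map_sub, map_smul, inner_sub_left, inner_sub_right, real_inner_smul_left,
      real_inner_smul_right, h1]
    nlinarith
  have hb : l ^ 2 * ⟪W b, b⟫ ≤ C * ‖b‖ ^ 2 := by
    have h1 : l ^ 2 ≤ 1 := by nlinarith
    exact (mul_le_of_le_one_left (h0 b) h1).trans (hup b)
  have e2 : 2 * l * ⟪W q, b⟫ ≤ ‖b‖ * ⟪W q, q⟫ + C * ‖b‖ := by
    rcases (norm_nonneg b).eq_or_lt with h | h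
    · have : b = 0 := norm_eq_zero.1 h.symm
      simp [this]
    · have h1 := h0 (‖b‖ • q - l • b)
      have h2 : ⟪W b, q⟫ = ⟪W q, b⟫ := by rw [hsym, real_inner_comm]
      simp only [map_sub, map_smul, inner_sub_left, inner_sub_right, real_inner_smul_left,
        real_inner_smul_right, h2] at h1
      have h3 : 0 ≤ ‖b‖ * (‖b‖ * ⟪W q, q⟫ + C * ‖b‖ - 2 * l * ⟪W q, b⟫) := by nlinarith
      linarith [nonneg_of_mul_nonneg_right h3 h]
  have e3 : ⟪W (q + l • b), q + l • b⟫ =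
      ⟪W q, q⟫ + 2 * l * ⟪W q, b⟫ + l ^ 2 * ⟪W b, b⟫ := by
    have h2 : ⟪W b, q⟫ = ⟪W q, b⟫ := by rw [hsym, real_inner_comm]
    simp only [map_add, map_smul, inner_add_left, inner_add_right, real_inner_smul_left,
      real_inner_smul_right, h2]
    ring
  rw [e0, e3]
  nlinarith [mul_le_mul_of_nonneg_left e1 (norm_nonneg b)]

theorem summable_one_add_mul_one_add_sub_one_s16 {f g : ℕ → ℝ} (hf : Summable f) (hg : Summable g)
    (hf0 : ∀ n, 0 ≤ f n) (hg0 : ∀ n, 0 ≤ g n) :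
    Summable fun n => (1 + f n) * (1 + g n) - 1 :=
  ((hf.add hg).add (summable_mul_of_nonneg hf hg hf0 hg0)).congr fun n => by ring

theorem summable_one_add_mul {f g : ℕ → ℝ} (hf : Summable f) (hg : Summable g)
    (hf0 : ∀ n, 0 ≤ f n) (hg0 : ∀ n, 0 ≤ g n) : Summable fun n => (1 + f n) * g n :=
  (hg.add (summable_mul_of_nonneg hf hg hf0 hg0)).congr fun n => by ring

/-- Quasi-Fejér monotonicity of the inexact relaxed variable metric forward–backward iteration,
relative to a zero `v'` of the sum at which the forward operator takes the value `g'`. -/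
theorem variable_metric_forward_backward {U W : ℕ → K →L[ℝ] K}
    (hWsym : ∀ n x y, ⟪W n x, y⟫ = ⟪x, W n y⟫) (hWU : ∀ n x, W n (U n x) = x)
    {α μ β ε : ℝ} {η γ l : ℕ → ℝ} (hα : 0 < α) (hμ : 0 < μ) (hε : 0 < ε)
    (hU : ∀ n x, ⟪U n x, x⟫ ≤ μ * ‖x‖ ^ 2) (hlow : ∀ n x, ‖x‖ ^ 2 ≤ μ * ⟪W n x, x⟫)
    (hup : ∀ n x, ⟪W n x, x⟫ ≤ α⁻¹ * ‖x‖ ^ 2)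
    (hη0 : ∀ n, 0 ≤ η n) (hη : Summable η)
    (hW : ∀ n x, ⟪W (n + 1) x, x⟫ ≤ (1 + η n) * ⟪W n x, x⟫)
    (hγ : ∀ n, ε ≤ γ n) (hγμ : ∀ n, γ n * μ ≤ 2 * β - ε) (hl : ∀ n, ε ≤ l n) (hl1 : ∀ n, l n ≤ 1)
    {v e u g err b : ℕ → K} {v' g' : K} (herr : Summable fun n => ‖err n‖)
    (hb : Summable fun n => ‖b n‖)
    (hf : ∀ n, v n - e n = γ n • U n (u n + g n + err n))
    (hmono : ∀ n, 0 ≤ ⟪e n - v', u n + g'⟫)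
    (hcoc : ∀ n, β * ‖g n - g'‖ ^ 2 ≤ ⟪v n - v', g n - g'⟫)
    (hv : ∀ n, v (n + 1) = v n + l n • (e n + b n - v n)) :
    (∃ c, Tendsto (fun n => ⟪W n (v n - v'), v n - v'⟫) atTop (𝓝 c)) ∧
      Tendsto g atTop (𝓝 g') ∧ Tendsto (fun n => v n - e n) atTop (𝓝 0) := by
  have h0 : ∀ n x, 0 ≤ ⟪W n x, x⟫ := fun n x =>
    nonneg_of_mul_nonneg_right ((sq_nonneg _).trans (hlow n x)) hμ
  have hγ0 : ∀ n, 0 < γ n := fun n => hε.trans_le (hγ n)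
  have hγC : ∀ n, γ n ≤ (2 * β - ε) / μ := fun n => (le_div_iff₀ hμ).2 (hγμ n)
  set τ : ℕ → ℝ := fun n => γ n * ‖err n‖ with hτ
  have hτ0 : ∀ n, 0 ≤ τ n := fun n => mul_nonneg (hγ0 n).le (norm_nonneg _)
  have hτs : Summable τ := Summable.of_nonneg_of_le hτ0
    (fun n => mul_le_mul_of_nonneg_right (hγC n) (norm_nonneg _)) (herr.mul_left _)
  have hτs2 : Summable fun n => τ n ^ 2 :=
    (summable_mul_of_nonneg hτs hτs hτ0 hτ0).congr fun n => by ring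
  have hτs3 : Summable fun n => τ n ^ 3 :=
    (summable_mul_of_nonneg hτs hτs2 hτ0 fun n => sq_nonneg _).congr fun n => by ring
  set θ : ℕ → ℝ := fun n => τ n + μ ^ 2 * τ n ^ 3 + 2 * μ * τ n ^ 2 with hθ
  have hθ0 : ∀ n, 0 ≤ θ n := fun n => by have := hτ0 n; positivity
  have hθs : Summable θ := (hτs.add (hτs3.mul_left _)).add (hτs2.mul_left _)
  have hbs2 : Summable fun n => ‖b n‖ ^ 2 :=
    (summable_mul_of_nonneg hb hb (fun n => norm_nonneg _) fun n => norm_nonneg _).congr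
      fun n => by ring
  set ζ : ℕ → ℝ := fun n => (1 + ((1 + η n) * (1 + ‖b n‖) - 1)) * (1 + μ * τ n) - 1 with hζ
  have hη1 : ∀ n, 0 ≤ (1 + η n) * (1 + ‖b n‖) - 1 := fun n => by
    nlinarith [hη0 n, norm_nonneg (b n), mul_nonneg (hη0 n) (norm_nonneg (b n))]
  have hζ0 : ∀ n, 0 ≤ ζ n := fun n => by
    have := mul_nonneg hμ.le (hτ0 n)
    nlinarith [hη1 n, mul_nonneg (hη1 n) this]
  have hζs : Summable ζ := summable_one_add_mul_one_add_sub_one_s16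
    (summable_one_add_mul_one_add_sub_one_s16 hη hb hη0 fun n => norm_nonneg _) (hτs.mul_left μ)
    hη1 (fun n => mul_nonneg hμ.le (hτ0 n))
  set κ : ℕ → ℝ := fun n => (1 + ‖b n‖) * θ n + α⁻¹ * (‖b n‖ + ‖b n‖ ^ 2) with hκ
  have hκ0 : ∀ n, 0 ≤ κ n := fun n => by have := hθ0 n; positivity
  have hκs : Summable κ := (summable_one_add_mul hb hθs (fun n => norm_nonneg _) hθ0).add
    ((hb.add hbs2).mul_left _)
  set f : ℕ → K := fun n => v n - e n with hfd
  set δ : ℕ → K := fun n => g n - g' with hδ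
  set N : ℕ → ℝ := fun n => ⟪W n (f n - γ n • U n (δ n)), f n - γ n • U n (δ n)⟫ with hN
  have hN0 : ∀ n, 0 ≤ N n := fun n => h0 n _
  have key : ∀ n, ⟪W (n + 1) (v (n + 1) - v'), v (n + 1) - v'⟫ +
      ε * (N n + ε ^ 2 * ‖δ n‖ ^ 2) ≤
      (1 + ζ n) * ⟪W n (v n - v'), v n - v'⟫ + (1 + η n) * κ n := by
    intro n
    have hyf : v n - v' - f n = e n - v' := by simp only [hfd]; abel
    have h1 := forward_backward_form_le_s16 (hWsym n) (hWU n) (hU n) (hlow n) hμ hε (hγ n) (hγμ n)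
      (y := v n - v') (δ := δ n) (err := err n) (hf n)
      (by
        have : u n + g n + err n - err n - δ n = u n + g' := by simp only [hδ]; abel
        rw [this]; change 0 ≤ ⟪v n - v' - f n, _⟫; rw [hyf]; exact hmono n) (hcoc n)
    have h2 := relaxed_form_le (hWsym n) (h0 n) (hup n)
      (hε.le.trans (hl n)) (hl1 n) (v n - v') (f n) (b n)
    have h3 := hW n (v (n + 1) - v')
    have e1 : v (n + 1) - v' = v n - v' + l n • (b n - f n) := by
      rw [hv]
      have : e n + b n - v n = b n - f n := by simp only [hfd]; abel
      rw [this]; abel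
    rw [← e1] at h2
    set a := ⟪W n (v n - v'), v n - v'⟫
    have ha : 0 ≤ a := h0 n _
    set S := N n + ε ^ 2 * ‖δ n‖ ^ 2 with hS
    have hS0 : 0 ≤ S := by have := hN0 n; positivity
    have h4 : (1 - l n) * a + l n * ⟪W n (v n - v' - f n), v n - v' - f n⟫ ≤
        (1 + μ * τ n) * a + θ n - ε * S := by
      have i1 : l n * (⟪W n (v n - v' - f n), v n - v' - f n⟫ + S) ≤
        l n * ((1 + μ * τ n) * a + θ n) :=
        mul_le_mul_of_nonneg_left h1 (hε.le.trans (hl n))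
      have i2 : 0 ≤ (1 - l n) * (μ * τ n * a + θ n) := by
        refine mul_nonneg (sub_nonneg.2 (hl1 n)) (add_nonneg ?_ (hθ0 n))
        exact mul_nonneg (mul_nonneg hμ.le (hτ0 n)) ha
      have i3 : ε * S ≤ l n * S := mul_le_mul_of_nonneg_right (hl n) hS0
      nlinarith
    have h5 := mul_le_mul_of_nonneg_left h4 (by positivity : 0 ≤ 1 + ‖b n‖)
    have h6 : (1 + ‖b n‖) * (ε * S) ≥ ε * S := by
      nlinarith [norm_nonneg (b n), mul_nonneg (norm_nonneg (b n)) (mul_nonneg hε.le hS0)]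
    have h7 : ⟪W n (v (n + 1) - v'), v (n + 1) - v'⟫ ≤
      (1 + ‖b n‖) * ((1 + μ * τ n) * a) + κ n - ε * S := by
      simp only [hκ]; linarith
    have h8 := mul_le_mul_of_nonneg_left h7 (by linarith [hη0 n] : 0 ≤ 1 + η n)
    have h9 : 0 ≤ η n * (ε * S) := mul_nonneg (hη0 n) (mul_nonneg hε.le hS0)
    simp only [hζ]
    linarith
  obtain ⟨hc, hS⟩ := exists_tendsto_of_add_le_one_add_mul_add
    (a := fun n => ⟪W n (v n - v'), v n - v'⟫) (fun n => h0 n _)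
    (fun n => mul_nonneg hε.le (add_nonneg (hN0 n) (by positivity))) hζ0
    (fun n => mul_nonneg (by linarith [hη0 n]) (hκ0 n)) hζs
    (summable_one_add_mul hη hκs hη0 hκ0) key
  have hδ0 : Tendsto (fun n => ‖δ n‖) atTop (𝓝 0) := by
    have h1 := (hS.const_mul (ε ^ 3)⁻¹).sqrt
    rw [mul_zero, Real.sqrt_zero] at h1
    refine squeeze_zero (fun n => norm_nonneg _) (fun n => Real.le_sqrt_of_sq_le ?_) h1
    rw [inv_mul_eq_div, le_div_iff₀ (by positivity)]
    nlinarith [mul_nonneg hε.le (hN0 n)]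
  have hR0 : Tendsto (fun n => ‖f n - γ n • U n (δ n)‖) atTop (𝓝 0) := by
    have h1 := (hS.const_mul (μ / ε)).sqrt
    rw [mul_zero, Real.sqrt_zero] at h1
    refine squeeze_zero (fun n => norm_nonneg _) (fun n => Real.le_sqrt_of_sq_le ?_) h1
    have h2 : μ / ε * (ε * (N n + ε ^ 2 * ‖δ n‖ ^ 2)) = μ * (N n + ε ^ 2 * ‖δ n‖ ^ 2) := by
      field_simp
    rw [h2]
    exact (hlow n _).trans (mul_le_mul_of_nonneg_left (le_add_of_nonneg_right (by positivity))
      hμ.le)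
  have hUδ : Tendsto (fun n => γ n • U n (δ n)) atTop (𝓝 0) := by
    have h1 := hδ0.const_mul (2 * β - ε)
    rw [mul_zero] at h1
    refine squeeze_zero_norm (fun n => ?_) h1
    have h2 : ‖U n (δ n)‖ ≤ μ * ‖δ n‖ := by
      have h3 := hlow n (U n (δ n))
      rw [hWU, real_inner_comm] at h3
      refine le_of_sq_le_sq ?_ (by positivity)
      nlinarith [mul_le_mul_of_nonneg_left (hU n (δ n)) hμ.le]
    rw [norm_smul, Real.norm_of_nonneg (hγ0 n).le]
    calc γ n * ‖U n (δ n)‖ ≤ γ n * (μ * ‖δ n‖) := mul_le_mul_of_nonneg_left h2 (hγ0 n).le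
      _ = γ n * μ * ‖δ n‖ := by ring
      _ ≤ _ := mul_le_mul_of_nonneg_right (hγμ n) (norm_nonneg _)
  refine ⟨hc, tendsto_iff_norm_sub_tendsto_zero.2 hδ0, ?_⟩
  have h1 := (tendsto_zero_iff_norm_tendsto_zero.2 hR0).add hUδ
  simpa using h1

end Metric

theorem norm_piLp_le_sum {m : ℕ} {G : Fin m → Type*} [∀ i, NormedAddCommGroup (G i)]
    (x : PiLp 2 G) : ‖x‖ ≤ ∑ i, ‖x i‖ := by
  refine le_of_sq_le_sq ?_ (Finset.sum_nonneg fun i _ => norm_nonneg _)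
  rw [PiLp.norm_sq_eq_of_L2]
  exact Finset.sum_sq_le_sq_sum_of_nonneg fun i _ => norm_nonneg _

section Product

variable {m : ℕ} {G : Fin m → Type*} [∀ i, NormedAddCommGroup (G i)]
  [∀ i, InnerProductSpace ℝ (G i)]

/-- The block-diagonal operator on a finite Hilbert direct sum. -/
noncomputable def piLpDiagonal (T : ∀ i, G i →L[ℝ] G i) : PiLp 2 G →L[ℝ] PiLp 2 G :=
  (PiLp.continuousLinearEquiv 2 ℝ G).symm.toContinuousLinearMap ∘L
    (ContinuousLinearMap.pi fun i => T i ∘L ContinuousLinearMap.proj i) ∘L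
      (PiLp.continuousLinearEquiv 2 ℝ G).toContinuousLinearMap

theorem piLpDiagonal_apply (T : ∀ i, G i →L[ℝ] G i) (x : PiLp 2 G) (i : Fin m) :
    piLpDiagonal T x i = T i (x i) := rfl

theorem inner_piLpDiagonal (T : ∀ i, G i →L[ℝ] G i) (x y : PiLp 2 G) :
    ⟪piLpDiagonal T x, y⟫ = ∑ i, ⟪T i (x i), y i⟫ := by
  simp only [PiLp.inner_apply, piLpDiagonal_apply]

theorem tendsto_inner_piLp_apply {F : Filter ℕ} {v : ℕ → PiLp 2 G} {y : PiLp 2 G}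
    (h : ∀ w, Tendsto (fun n => ⟪v n, w⟫) F (𝓝 ⟪y, w⟫)) (i : Fin m) (w : G i) :
    Tendsto (fun n => ⟪v n i, w⟫) F (𝓝 ⟪y i, w⟫) := by
  have h1 : ∀ x : PiLp 2 G, ⟪x, WithLp.toLp 2 (Pi.single i w)⟫ = ⟪x i, w⟫ := fun x => by
    rw [PiLp.inner_apply, Finset.sum_eq_single i]
    · simp
    · intro j _ hj
      simp [Pi.single_eq_of_ne hj]
    · simp
  simpa only [h1] using h (WithLp.toLp 2 (Pi.single i w))

variable {H : Type*} [NormedAddCommGroup H] [InnerProductSpace ℝ H]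

theorem sum_norm_sub_apply_sq_le (L : ∀ i, H →L[ℝ] G i) {ρ M : ℝ} (hρ : 0 < ρ) (hM : 0 < M)
    (hL : 0 < ∑ i, ‖L i‖ ^ 2) {ν : Fin m → ℝ} (hν : ∀ i, 0 < ν i) (hνM : ∀ i, 1 / ν i ≤ M)
    (t : ∀ i, G i) (c : H) :
    ∑ i, ‖t i - L i c‖ ^ 2 ≤
      (M + ρ⁻¹ * ∑ i, ‖L i‖ ^ 2) * (∑ i, ν i * ‖t i‖ ^ 2 + ρ * ‖c‖ ^ 2) := by
  set σ := ∑ i, ‖L i‖ ^ 2 with hσ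
  set T := M + ρ⁻¹ * σ with hT
  have hT0 : 0 < T := by positivity
  have h1 : ∀ i, ‖t i - L i c‖ ^ 2 ≤
      T * (ν i * ‖t i‖ ^ 2) + T * ρ / σ * ‖c‖ ^ 2 * ‖L i‖ ^ 2 := by
    intro i
    have h2 : ‖t i - L i c‖ ≤ ‖t i‖ + ‖L i‖ * ‖c‖ :=
      (norm_sub_le _ _).trans (by gcongr; exact (L i).le_opNorm c)
    have h3 : ‖t i - L i c‖ ^ 2 ≤ (‖t i‖ + ‖L i‖ * ‖c‖) ^ 2 := by gcongr
    have h4 : (‖t i‖ + ‖L i‖ * ‖c‖) ^ 2 ≤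
        T / M * ‖t i‖ ^ 2 + T * ρ / σ * (‖L i‖ * ‖c‖) ^ 2 := by
      have e1 : T / M = 1 + σ / (ρ * M) := by rw [hT]; field_simp
      have e2 : T * ρ / σ = 1 + (σ / (ρ * M))⁻¹ := by rw [hT]; field_simp; ring
      rw [e1, e2]
      set s := σ / (ρ * M)
      have hs : 0 < s := by positivity
      have h5 : 0 ≤ s⁻¹ * (s * ‖t i‖ - ‖L i‖ * ‖c‖) ^ 2 := by positivity
      have h6 : s⁻¹ * (s * ‖t i‖ - ‖L i‖ * ‖c‖) ^ 2 =
          s * ‖t i‖ ^ 2 - 2 * ‖t i‖ * (‖L i‖ * ‖c‖) + s⁻¹ * (‖L i‖ * ‖c‖) ^ 2 := by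
        field_simp; ring
      nlinarith
    have h7 : T / M * ‖t i‖ ^ 2 ≤ T * (ν i * ‖t i‖ ^ 2) := by
      have : 1 / M ≤ ν i := by
        rw [div_le_iff₀ hM]
        have := hνM i
        rwa [div_le_iff₀ (hν i), mul_comm] at this
      calc T / M * ‖t i‖ ^ 2 = T * (1 / M * ‖t i‖ ^ 2) := by ring
        _ ≤ _ := by gcongr
    calc _ ≤ _ := h3
      _ ≤ _ := h4
      _ ≤ T * (ν i * ‖t i‖ ^ 2) + T * ρ / σ * (‖L i‖ * ‖c‖) ^ 2 := by gcongr
      _ = _ := by ring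
  refine (Finset.sum_le_sum fun i _ => h1 i).trans (le_of_eq ?_)
  rw [Finset.sum_add_distrib, ← Finset.mul_sum, ← Finset.mul_sum, ← hσ]
  field_simp

theorem le_sum_inner_sub_apply [CompleteSpace H] [∀ i, CompleteSpace (G i)]
    (L : ∀ i, H →L[ℝ] G i) {ρ : ℝ} {ν : Fin m → ℝ} {t v : ∀ i, G i} {c : H}
    (ht : ∀ i, ν i * ‖t i‖ ^ 2 ≤ ⟪t i, v i⟫)
    (hc : 0 ≤ ⟪c, -∑ i, ContinuousLinearMap.adjoint (L i) (v i) - ρ • c⟫) :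
    ∑ i, ν i * ‖t i‖ ^ 2 + ρ * ‖c‖ ^ 2 ≤ ∑ i, ⟪v i, t i - L i c⟫ := by
  have h1 : ∑ i, ⟪v i, t i - L i c⟫ = ∑ i, ⟪t i, v i⟫ - ∑ i, ⟪L i c, v i⟫ := by
    rw [← Finset.sum_sub_distrib]
    refine Finset.sum_congr rfl fun i _ => ?_
    rw [inner_sub_right, real_inner_comm, real_inner_comm (L i c)]
  rw [inner_sub_right, inner_neg_right, inner_sum, real_inner_smul_right,
    real_inner_self_eq_norm_sq] at hc
  simp only [ContinuousLinearMap.adjoint_inner_right] at hc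
  rw [h1]
  have := Finset.sum_le_sum fun i (_ : i ∈ Finset.univ) => ht i
  linarith

end Product

theorem tendsto_of_mul_norm_sub_sq_le {E : Type*} [NormedAddCommGroup E] {x : ℕ → E} {y : E}
    {Q : ℕ → ℝ} {κ : ℝ} (hκ : 0 < κ) (hQ : Tendsto Q atTop (𝓝 0))
    (h : ∀ n, κ * ‖x n - y‖ ^ 2 ≤ Q n) : Tendsto x atTop (𝓝 y) := by
  rw [tendsto_iff_norm_sub_tendsto_zero]
  have h1 := (hQ.const_mul κ⁻¹).sqrt
  rw [mul_zero, Real.sqrt_zero] at h1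
  refine squeeze_zero (fun n => norm_nonneg _) (fun n => Real.le_sqrt_of_sq_le ?_) h1
  rw [inv_mul_eq_div, le_div_iff₀ hκ]
  linarith [h n]



/-- **Variable metric primal–dual algorithm for strongly monotone composite inclusions.**
Under the strongly monotone composite setup with the range condition and the variable
metric forward–backward primal–dual iteration, the primal inclusion has a unique
solution `xb`, the dual variables converge weakly to a dual solution `vb`,
`xb` is recovered from `vb` through the resolvent of `ρ⁻¹A`, and `x n → xb` strongly. -/
theorem strongly_monotone_primal_dual_algorithm
    {H : Type*} [NormedAddCommGroup H] [InnerProductSpace ℝ H] [CompleteSpace H]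
    {m : ℕ} (hm : 0 < m)
    (G : Fin m → Type*) [∀ i, NormedAddCommGroup (G i)] [∀ i, InnerProductSpace ℝ (G i)]
    [∀ i, CompleteSpace (G i)]
    (z : H) (ρ : ℝ) (hρ : 0 < ρ)
    (A : H → Set H)
    (hAmono : ∀ x y u v : H, u ∈ A x → v ∈ A y → ⟪x - y, u - v⟫ ≥ 0)
    (hAmax : ∀ y v : H, (∀ x u : H, u ∈ A x → ⟪x - y, u - v⟫ ≥ 0) → v ∈ A y)
    (r : ∀ i, G i)
    (Bop : ∀ i, G i → Set (G i))
    (hBmono : ∀ i, ∀ x y u v : G i, u ∈ Bop i x → v ∈ Bop i y → ⟪x - y, u - v⟫ ≥ 0)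
    (hBmax : ∀ i, ∀ y v : G i, (∀ x u : G i, u ∈ Bop i x → ⟪x - y, u - v⟫ ≥ 0) → v ∈ Bop i y)
    (ν : Fin m → ℝ) (hν : ∀ i, 0 < ν i)
    (D : ∀ i, G i → Set (G i))
    (hDstrong : ∀ i, ∀ x y u v : G i, u ∈ D i x → v ∈ D i y →
      ⟪x - y, u - v⟫ ≥ ν i * ‖x - y‖ ^ 2)
    (hDmax : ∀ i, ∀ y v : G i, (∀ x u : G i, u ∈ D i x → ⟪x - y, u - v⟫ ≥ 0) → v ∈ D i y)
    (L : ∀ i, H →L[ℝ] G i) (hL : ∀ i, L i ≠ 0)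
    (PrimalSol : H → Prop)
    (hPrimal : ∀ xb : H, PrimalSol xb ↔
      ∃ a ∈ A xb, ∃ w : (i : Fin m) → G i,
        (∀ i, ∃ p q : G i, w i ∈ Bop i p ∧ w i ∈ D i q ∧ L i xb - r i = p + q) ∧
        z = a + ∑ i, (ContinuousLinearMap.adjoint (L i)) (w i) + ρ • xb)
    (hrange : ∃ xb : H, PrimalSol xb)
    (DualSol : ((i : Fin m) → G i) → Prop)
    (hDual : ∀ v : (i : Fin m) → G i, DualSol v ↔
      ∃ x : H, (z - ∑ j, (ContinuousLinearMap.adjoint (L j)) (v j) - ρ • x ∈ A x) ∧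
        ∀ i, ∃ p q : G i, v i ∈ Bop i p ∧ v i ∈ D i q ∧ r i = L i x - p - q)
    (β : ℝ)
    (hβ : β = 1 / ((⨆ i, 1 / ν i) + ρ⁻¹ * ∑ i, ‖L i‖ ^ 2))
    (a : ℕ → H) (ha : Summable fun n => ‖a n‖)
    (α : ℝ) (hα : 0 < α)
    (η : ℕ → ℝ) (hη0 : ∀ n, 0 ≤ η n) (hηsum : Summable η)
    (b d : ∀ i, ℕ → G i)
    (hb : ∀ i, Summable fun n => ‖b i n‖) (hd : ∀ i, Summable fun n => ‖d i n‖)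
    (Uop : ∀ i, ℕ → (G i →L[ℝ] G i))
    (hUsa : ∀ i n, IsSelfAdjoint (Uop i n))
    (hUα : ∀ i n (v : G i), ⟪Uop i n v, v⟫ ≥ α * ‖v‖ ^ 2)
    (μ : ℝ) (hμ : IsLUB {c : ℝ | ∃ i n, ‖Uop i n‖ = c} μ)
    (hUmono : ∀ i n (v : G i), (1 + η n) * ⟪Uop i (n + 1) v, v⟫ ≥ ⟪Uop i n v, v⟫)
    (ε : ℝ) (hε : ε ∈ Set.Ioc 0 (min 1 (2 * β / (μ + 1))))
    (lam : ℕ → ℝ) (hlam : ∀ n, lam n ∈ Set.Icc ε 1)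
    (gam : ℕ → ℝ) (hgam : ∀ n, gam n ∈ Set.Icc ε ((2 * β - ε) / μ))
    (x cseq : ℕ → H) (v t w e : ∀ i, ℕ → G i)
    (hc : ∀ n, (z - ∑ i, (ContinuousLinearMap.adjoint (L i)) (v i n)) - ρ • cseq n
      ∈ A (cseq n))
    (hx : ∀ n, x n = cseq n + a n)
    (ht : ∀ i n, v i n ∈ D i (t i n))
    (hw : ∀ i n, w i n = v i n + gam n • Uop i n (L i (x n) - r i - t i n - d i n))
    (he : ∀ i n, ∃ u : G i, e i n ∈ Bop i u ∧ w i n - e i n = gam n • Uop i n u)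
    (hv : ∀ i n, v i (n + 1) = v i n + lam n • (e i n + b i n - v i n)) :
    ∃ xb : H, (PrimalSol xb ∧ ∀ x' : H, PrimalSol x' → x' = xb) ∧
      ∃ vb : (i : Fin m) → G i, DualSol vb ∧
        (∀ i, ∀ w' : G i, Tendsto (fun n => ⟪v i n, w'⟫) atTop (𝓝 ⟪vb i, w'⟫)) ∧
        ((z - ∑ i, (ContinuousLinearMap.adjoint (L i)) (vb i)) - ρ • xb ∈ A xb) ∧
        Tendsto x atTop (𝓝 xb) := by
  have hDmono : ∀ i, ∀ x y u v : G i, u ∈ D i x → v ∈ D i y → ⟪x - y, u - v⟫ ≥ 0 :=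
    fun i x y u v hu hv' => le_trans (by have := hν i; positivity) (hDstrong i x y u v hu hv')
  obtain ⟨xb, hxb⟩ := hrange
  obtain ⟨a0, ha0, w0, hw0, hz0⟩ := (hPrimal xb).1 hxb
  choose p q hp hq hpq using hw0
  choose u hu1 hu2 using he
  -- constants
  have i0 : Fin m := ⟨0, hm⟩
  have : Nonempty (Fin m) := ⟨i0⟩
  have hUle : ∀ i n, ‖Uop i n‖ ≤ μ := fun i n => hμ.1 ⟨i, n, rfl⟩
  have hμ0 : 0 < μ := by
    obtain ⟨y, hy⟩ : ∃ y, L i0 y ≠ 0 := by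
      by_contra! h
      exact hL i0 (ContinuousLinearMap.ext h)
    have h1 := hUα i0 0 (L i0 y)
    have h2 := (real_inner_le_norm (Uop i0 0 (L i0 y)) (L i0 y)).trans
      (mul_le_mul_of_nonneg_right ((Uop i0 0).le_opNorm _) (norm_nonneg _))
    have h3 : 0 < ‖L i0 y‖ ^ 2 := by have := norm_pos_iff.2 hy; positivity
    have h4 : α * ‖L i0 y‖ ^ 2 ≤ ‖Uop i0 0‖ * ‖L i0 y‖ ^ 2 := by linarith
    exact hα.trans_le ((le_of_mul_le_mul_right h4 h3).trans (hUle i0 0))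
  have hε0 : 0 < ε := hε.1
  have hγμ : ∀ n, gam n * μ ≤ 2 * β - ε := fun n => (le_div_iff₀ hμ0).1 (hgam n).2
  set M := ⨆ i, 1 / ν i with hM
  have hνM : ∀ i, 1 / ν i ≤ M := fun i => le_ciSup (f := fun i => 1 / ν i)
    (Set.finite_range _).bddAbove i
  have hM0 : 0 < M := (one_div_pos.2 (hν i0)).trans_le (hνM i0)
  have hσ0 : 0 < ∑ i, ‖L i‖ ^ 2 :=
    Finset.sum_pos (fun i _ => by have := norm_pos_iff.2 (hL i); positivity) Finset.univ_nonempty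
  have hT0 : 0 < M + ρ⁻¹ * ∑ i, ‖L i‖ ^ 2 := by positivity
  -- objects on the direct sum
  set V : ℕ → PiLp 2 G := fun n => WithLp.toLp 2 fun i => v i n with hV
  set E : ℕ → PiLp 2 G := fun n => WithLp.toLp 2 fun i => e i n with hE
  set u' : ℕ → PiLp 2 G := fun n => WithLp.toLp 2 fun i => u i n with hu'
  set g : ℕ → PiLp 2 G := fun n => WithLp.toLp 2 fun i => t i n + r i - L i (cseq n) with hg
  set err : ℕ → PiLp 2 G := fun n => WithLp.toLp 2 fun i => d i n - L i (a n) with herr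
  set b' : ℕ → PiLp 2 G := fun n => WithLp.toLp 2 fun i => b i n with hb'
  set g' : PiLp 2 G := WithLp.toLp 2 fun i => q i + r i - L i xb with hg'
  set p' : PiLp 2 G := WithLp.toLp 2 p with hp'
  have hgp : g' = -p' := by
    ext i
    have : L i xb = p i + q i + r i := by rw [← hpq]; abel
    simp only [hg', hp', PiLp.neg_apply, this]
    abel
  set U : ℕ → PiLp 2 G →L[ℝ] PiLp 2 G := fun n => piLpDiagonal fun i => Uop i n with hU
  have hUsym : ∀ n x y, ⟪U n x, y⟫ = ⟪x, U n y⟫ := fun n x y => by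
    simp only [hU]
    rw [inner_piLpDiagonal, real_inner_comm, inner_piLpDiagonal]
    refine Finset.sum_congr rfl fun i _ => ?_
    rw [real_inner_comm]
    exact ((hUsa i n).isSymmetric _ _).symm
  have hUlow : ∀ n x, α * ‖x‖ ^ 2 ≤ ⟪U n x, x⟫ := fun n x => by
    rw [inner_piLpDiagonal, PiLp.norm_sq_eq_of_L2, Finset.mul_sum]
    exact Finset.sum_le_sum fun i _ => hUα i n _
  have hU0 : ∀ n x, 0 ≤ ⟪U n x, x⟫ := fun n x => le_trans (by positivity) (hUlow n x)
  have hUup : ∀ n x, ⟪U n x, x⟫ ≤ μ * ‖x‖ ^ 2 := fun n x => by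
    rw [inner_piLpDiagonal, PiLp.norm_sq_eq_of_L2, Finset.mul_sum]
    refine Finset.sum_le_sum fun i _ => (real_inner_le_norm _ _).trans ?_
    rw [pow_two, ← mul_assoc]
    gcongr
    exact (Uop i n).le_of_opNorm_le (hUle i n) _
  have hUsucc : ∀ n x, ⟪U n x, x⟫ ≤ (1 + η n) * ⟪U (n + 1) x, x⟫ := fun n x => by
    rw [inner_piLpDiagonal, inner_piLpDiagonal, Finset.mul_sum]
    exact Finset.sum_le_sum fun i _ => hUmono i n _
  choose W hUW hWU hWsym hWlow hWup using fun n =>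
    exists_inverse_of_form_bounds (hUsym n) hα hμ0 (hUlow n) (hUup n)
  have hW0 : ∀ n x, 0 ≤ ⟪W n x, x⟫ := fun n x =>
    nonneg_of_mul_nonneg_right ((sq_nonneg _).trans (hWlow n x)) hμ0
  have hWsucc : ∀ n x, ⟪W (n + 1) x, x⟫ ≤ (1 + η n) * ⟪W n x, x⟫ := fun n x =>
    inverse_form_le (hUsym n) (hU0 n) (hUW n) (hUW (n + 1)) (by linarith [hη0 n]) (hUsucc n) x
  have herrs : Summable fun n => ‖err n‖ := by
    refine Summable.of_nonneg_of_le (fun n => norm_nonneg _)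
      (fun n => (norm_piLp_le_sum _).trans (Finset.sum_le_sum fun i _ =>
        (norm_sub_le _ _).trans (add_le_add_right ((L i).le_opNorm _) _)))
      (summable_sum fun i _ => (hd i).add (ha.mul_left _))
  have hbs : Summable fun n => ‖b' n‖ :=
    Summable.of_nonneg_of_le (fun n => norm_nonneg _) (fun n => norm_piLp_le_sum _)
      (summable_sum fun i _ => hb i)
  have hVE : ∀ n, V n - E n = gam n • U n (u' n + g n + err n) := fun n => by
    ext i
    have h1 := hu2 i n
    rw [hw, hx] at h1
    have h2 : v i n - e i n = gam n • Uop i n (u i n) -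
        gam n • Uop i n (L i (cseq n + a n) - r i - t i n - d i n) := by rw [← h1]; abel
    change v i n - e i n = gam n • Uop i n (u i n + (t i n + r i - L i (cseq n)) +
      (d i n - L i (a n)))
    rw [h2, ← smul_sub, ← map_sub, map_add (L i)]
    congr 2
    abel
  have hVsucc : ∀ n, V (n + 1) = V n + lam n • (E n + b' n - V n) := fun n => by
    ext i
    exact hv i n
  set S : Set (PiLp 2 G) := {y | z - ∑ i, ContinuousLinearMap.adjoint (L i) (y i) - ρ • xb ∈ A xb ∧
    ∀ i, y i ∈ Bop i (p i) ∧ y i ∈ D i (q i)} with hS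
  have hinner : ∀ y ∈ S, ∀ n, ∑ i, ν i * ‖t i n - q i‖ ^ 2 + ρ * ‖cseq n - xb‖ ^ 2 ≤
      ⟪V n - y, g n - g'⟫ := by
    rintro y ⟨hyA, hyBD⟩ n
    have h1 := le_sum_inner_sub_apply L (ρ := ρ) (ν := ν) (t := fun i => t i n - q i)
      (v := fun i => v i n - y i) (c := cseq n - xb)
      (fun i => hDstrong i _ _ _ _ (ht i n) (hyBD i).2) (by
        have h2 := hAmono _ _ _ _ (hc n) hyA
        convert h2 using 2
        simp only [map_sub, Finset.sum_sub_distrib, smul_sub]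
        abel)
    rw [PiLp.inner_apply]
    refine h1.trans (le_of_eq (Finset.sum_congr rfl fun i _ => ?_))
    change _ = ⟪v i n - y i, t i n + r i - L i (cseq n) - (q i + r i - L i xb)⟫
    congr 1
    rw [map_sub]
    abel
  have hcoc : ∀ y ∈ S, ∀ n, β * ‖g n - g'‖ ^ 2 ≤ ⟪V n - y, g n - g'⟫ := by
    intro y hy n
    refine le_trans ?_ (hinner y hy n)
    rw [hβ, one_div, inv_mul_le_iff₀ hT0]
    refine le_trans (le_of_eq ?_)
      (sum_norm_sub_apply_sq_le L hρ hM0 hσ0 hν hνM (fun i => t i n - q i) (cseq n - xb))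
    rw [PiLp.norm_sq_eq_of_L2]
    refine Finset.sum_congr rfl fun i _ => ?_
    change ‖t i n + r i - L i (cseq n) - (q i + r i - L i xb)‖ ^ 2 = _
    congr 2
    rw [map_sub]
    abel
  have hmono : ∀ y ∈ S, ∀ n, 0 ≤ ⟪E n - y, u' n + g'⟫ := by
    rintro y ⟨-, hyBD⟩ n
    rw [hgp, ← sub_eq_add_neg, PiLp.inner_apply]
    refine Finset.sum_nonneg fun i _ => ?_
    rw [real_inner_comm]
    exact hBmono i _ _ _ _ (hu1 i n) (hyBD i).1
  have hfb := fun y hy => variable_metric_forward_backward hWsym hWU hα hμ0 hε0 hUup hWlow hWup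
    hη0 hηsum hWsucc (fun n => (hgam n).1) hγμ (fun n => (hlam n).1) (fun n => (hlam n).2)
    herrs hbs hVE (hmono y hy) (hcoc y hy) hVsucc
  set y0 : PiLp 2 G := WithLp.toLp 2 w0 with hy0
  have hy0S : y0 ∈ S := by
    refine ⟨?_, fun i => ⟨hp i, hq i⟩⟩
    have : z - ∑ i, ContinuousLinearMap.adjoint (L i) (w0 i) - ρ • xb = a0 := by
      rw [hz0]; abel
    change z - ∑ i, ContinuousLinearMap.adjoint (L i) (w0 i) - ρ • xb ∈ A xb
    rwa [this]
  obtain ⟨⟨l0, hl0⟩, hglim, hflim⟩ := hfb y0 hy0S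
  -- boundedness
  obtain ⟨C, hC⟩ : ∃ C, ∀ n, ‖V n‖ ≤ C := by
    obtain ⟨B, hB⟩ := hl0.bddAbove_range
    refine ⟨√(μ * B) + ‖y0‖, fun n => ?_⟩
    have h1 : ‖V n - y0‖ ≤ √(μ * B) := Real.le_sqrt_of_sq_le ((hWlow n _).trans
      (mul_le_mul_of_nonneg_left (hB ⟨n, rfl⟩) hμ0.le))
    have h2 := norm_add_le (V n - y0) y0
    rw [sub_add_cancel] at h2
    linarith
  have hvC : ∀ i n, ‖v i n‖ ≤ C := fun i n => (PiLp.norm_apply_le (V n) i).trans (hC n)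
  -- strong convergence of the auxiliary sequences
  have hQ : Tendsto (fun n => ∑ i, ν i * ‖t i n - q i‖ ^ 2 + ρ * ‖cseq n - xb‖ ^ 2) atTop (𝓝 0) := by
    have h1 := (tendsto_iff_norm_sub_tendsto_zero.1 hglim).const_mul (C + ‖y0‖)
    rw [mul_zero] at h1
    refine squeeze_zero (fun n => ?_) (fun n => (hinner y0 hy0S n).trans
      ((real_inner_le_norm _ _).trans (mul_le_mul_of_nonneg_right
        ((norm_sub_le _ _).trans (add_le_add_left (hC n) _)) (norm_nonneg _)))) h1
    exact add_nonneg (Finset.sum_nonneg fun i _ => by have := hν i; positivity) (by positivity)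
  have hclim : Tendsto cseq atTop (𝓝 xb) := by
    refine tendsto_of_mul_norm_sub_sq_le hρ hQ fun n => ?_
    exact le_add_of_nonneg_left (Finset.sum_nonneg fun i _ => by have := hν i; positivity)
  have htlim : ∀ i, Tendsto (t i) atTop (𝓝 (q i)) := fun i => by
    refine tendsto_of_mul_norm_sub_sq_le (hν i) hQ fun n => ?_
    exact (Finset.single_le_sum (f := fun i => ν i * ‖t i n - q i‖ ^ 2)
      (fun i _ => by have := hν i; positivity) (Finset.mem_univ i)).trans
      (le_add_of_nonneg_right (by positivity))
  have hulim : Tendsto u' atTop (𝓝 p') := by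
    have h1 : Tendsto (fun n => u' n + g n + err n) atTop (𝓝 0) := by
      have h2 := hflim.norm.const_mul (ε * α)⁻¹
      rw [norm_zero, mul_zero] at h2
      refine squeeze_zero_norm (fun n => ?_) h2
      set k := u' n + g n + err n
      rw [inv_mul_eq_div, le_div_iff₀ (by positivity)]
      rcases (norm_nonneg k).eq_or_lt with h | h
      · rw [← h, zero_mul]; exact norm_nonneg _
      · have h3 := real_inner_le_norm (V n - E n) k
        rw [hVE, real_inner_smul_left, ← hVE] at h3
        have h4 := mul_le_mul (hgam n).1 (hUlow n k) (by positivity)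
          (hε0.le.trans (hgam n).1)
        refine le_of_mul_le_mul_right ?_ h
        nlinarith
    have h2 := (h1.sub hglim).sub (tendsto_zero_iff_norm_tendsto_zero.2
      herrs.tendsto_atTop_zero)
    rw [zero_sub, sub_zero, hgp, neg_neg] at h2
    refine h2.congr fun n => ?_
    abel
  have hulim' : ∀ i, Tendsto (u i) atTop (𝓝 (p i)) := fun i =>
    ((PiLp.continuous_apply 2 G i).tendsto p').comp hulim
  have hflim' : ∀ i, Tendsto (fun n => v i n - e i n) atTop (𝓝 0) := fun i =>
    ((PiLp.continuous_apply 2 G i).tendsto 0).comp hflim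
  obtain ⟨Cc, hCc⟩ := hclim.norm.bddAbove_range
  obtain ⟨Cf, hCf⟩ := hflim.norm.bddAbove_range
  obtain ⟨y, hyS, hy⟩ := exists_weak_limit_of_variable_metric hWsym hWlow
    (exists_tendsto_apply_of_form_succ_le hη0 hηsum hWsym hW0 (inv_pos.2 hα) hWup hWsucc) hC
    (S := S) (fun y hy => (hfb y hy).1) (by
      intro F hF y hy
      have hyi := fun i w => tendsto_inner_piLp_apply hy i w
      refine ⟨?_, fun i => ⟨?_, ?_⟩⟩
      · refine mem_of_strong_weak_limit hAmono hAmax (hclim.mono_left hF)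
          (C := ‖z‖ + ∑ i, ‖ContinuousLinearMap.adjoint (L i)‖ * C + ρ * Cc) (fun w' => ?_)
          (fun n => ?_) hc
        · simp only [inner_sub_left, sum_inner, ContinuousLinearMap.adjoint_inner_left]
          refine (tendsto_const_nhds.sub (tendsto_finsetSum _ fun i _ => hyi i _)).sub ?_
          exact tendsto_inner_const_of_tendsto ((hclim.mono_left hF).const_smul ρ) w'
        · refine (norm_sub_le _ _).trans (add_le_add ((norm_sub_le _ _).trans
            (add_le_add le_rfl ((norm_sum_le _ _).trans (Finset.sum_le_sum fun i _ => ?_)))) ?_)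
          · exact ((ContinuousLinearMap.le_opNorm _ _).trans
              (mul_le_mul_of_nonneg_left (hvC i n) (norm_nonneg _)))
          · rw [norm_smul, Real.norm_of_nonneg hρ.le]
            exact mul_le_mul_of_nonneg_left (hCc ⟨n, rfl⟩) hρ.le
      · refine mem_of_strong_weak_limit (hBmono i) (hBmax i) ((hulim' i).mono_left hF)
          (u := e i) (C := C + Cf) (fun w' => ?_) (fun n => ?_) (hu1 i)
        · have h1 := (hyi i w').sub
            (tendsto_inner_const_of_tendsto ((hflim' i).mono_left hF) w')
          rw [inner_zero_left, sub_zero] at h1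
          refine h1.congr fun n => ?_
          change ⟪v i n, w'⟫ - ⟪v i n - e i n, w'⟫ = _
          rw [inner_sub_left]
          ring
        · have h1 := norm_sub_le (v i n) (v i n - e i n)
          rw [sub_sub_cancel] at h1
          exact h1.trans (add_le_add (hvC i n)
            ((PiLp.norm_apply_le (V n - E n) i).trans (hCf ⟨n, rfl⟩)))
      · exact mem_of_strong_weak_limit (hDmono i) (hDmax i) ((htlim i).mono_left hF)
          (hyi i) (hvC i) (ht i))
  refine ⟨xb, ⟨hxb, fun x' hx' => ?_⟩, fun i => y i, (hDual _).2 ⟨xb, hyS.1, fun i =>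
    ⟨p i, q i, (hyS.2 i).1, (hyS.2 i).2, ?_⟩⟩, fun i w' => tendsto_inner_piLp_apply hy i w',
    hyS.1, ?_⟩
  · obtain ⟨a1, ha1, w1, hw1, hz1⟩ := (hPrimal x').1 hx'
    choose p1 q1 hp1 hq1 hpq1 using hw1
    have h1 := le_sum_inner_sub_apply L (ρ := ρ) (ν := ν) (t := fun i => q1 i - q i)
      (v := fun i => w1 i - w0 i) (c := x' - xb)
      (fun i => hDstrong i _ _ _ _ (hq1 i) (hq i)) (by
        have h2 := hAmono _ _ _ _ ha1 ha0
        convert h2 using 2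
        have e1 : a1 = z - ∑ i, ContinuousLinearMap.adjoint (L i) (w1 i) - ρ • x' := by
          rw [hz1]; abel
        have e0 : a0 = z - ∑ i, ContinuousLinearMap.adjoint (L i) (w0 i) - ρ • xb := by
          rw [hz0]; abel
        rw [e1, e0]
        simp only [map_sub, Finset.sum_sub_distrib, smul_sub]
        abel)
    have h2 : ∑ i, ⟪w1 i - w0 i, q1 i - q i - L i (x' - xb)⟫ ≤ 0 := by
      refine Finset.sum_nonpos fun i _ => ?_
      have e1 : q1 i - q i - L i (x' - xb) = -(p1 i - p i) := by
        have k1 : L i x' = p1 i + q1 i + r i := by rw [← hpq1]; abel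
        have k0 : L i xb = p i + q i + r i := by rw [← hpq]; abel
        rw [map_sub, k1, k0]; abel
      rw [e1, inner_neg_right, real_inner_comm]
      linarith [hBmono i _ _ _ _ (hp1 i) (hp i)]
    have h3 : 0 ≤ ∑ i, ν i * ‖q1 i - q i‖ ^ 2 :=
      Finset.sum_nonneg fun i _ => by have := hν i; positivity
    have h4 : ‖x' - xb‖ ^ 2 ≤ 0 := by
      refine le_of_mul_le_mul_left ?_ hρ
      rw [mul_zero]
      linarith
    exact sub_eq_zero.1 (norm_eq_zero.1 (pow_eq_zero_iff two_ne_zero |>.1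
      (le_antisymm h4 (sq_nonneg _))))
  · rw [sub_sub, ← hpq]
    abel
  · have h1 := hclim.add (tendsto_zero_iff_norm_tendsto_zero.2 ha.tendsto_atTop_zero)
    rw [add_zero] at h1
    exact h1.congr fun n => (hx n).symm
end
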